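/- Let $\rho,u,\Pi$ be functions on $[0,\infty)\times\mathbb R^2$ (with $\rho,\Pi$ real-valued and $u$ with values in $\mathbb R^2$) such that $(\rho,u,\nabla\Pi)$ is a smooth global solution of the inhomogeneous incompressible Navier–Stokes system $$\partial_t\rho+u\cdot\nabla\rho=0,\qquad \rho\,\partial_tu+\rho(u\cdot\nabla)u-\Delta u+\nabla\Pi=0,\qquad \operatorname{div}u=0,$$ with $\tfrac12\le\rho\le2$. Let the vector fields $v,f$ and the scalar function $\Pi_v$ on $[0,\infty)\times\mathbb R^2$ satisfy the linearized system $$\rho\,\partial_tv+\rho(u\cdot\nabla)v-\Delta v+\nabla\Pi_v=f,\qquad \operatorname{div}v=0 .$$ Assume that $\rho$ is smooth on $[0,\infty)\times\mathbb R^2$, that $\Pi(t,\cdot)$ and $\Pi_v(t,\cdot)$ are smooth for every $t\ge0$, and that $u,\nabla\Pi,v,\nabla\Pi_v,f$ are smooth in time with values in all Sobolev spaces, in the sense that each of them, $g$ say, is smooth on $[0,\infty)\times\mathbb R^2$ and $\partial_t^jg(t,\cdot)\in H^k(\mathbb R^2)$ for all $j,k\in\mathbb N$ and $t\ge0$ (time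 derivatives at $t=0$ are one-sided). Then for every $p\in(1,\infty)$ there is a constant $C$, depending only on $p$, such that at every time $t\ge0$ $$\|\nabla^2v\|_{L^p}+\|\nabla\Pi_v\|_{L^p}\le C\bigl(\|\sqrt\rho\,\partial_tv\|_{L^p}+\|u\|_{L^{2p}}^2\|\nabla v\|_{L^2}+\|f\|_{L^p}\bigr),$$ where for $p<2$ the right-hand side may be $+\infty$, and where the left-hand side is finite whenever the right-hand side is. Moreover, in the case $p=2$, there is an absolute constant $C$ such that at every time $t\ge0$ $$\|\sqrt\rho\,\partial_tv\|_{L^2}^2\le C\bigl(\|\nabla^2v\|_{L^2}^2+\|u\|_{L^4}^4\|\nabla v\|_{L^2}^2+\|f\|_{L^2}^2\bigr).$$ -/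

import Mathlib

open MeasureTheory Set
open scoped ENNReal NNReal ContDiff Laplacian

noncomputable section

/-- The plane `ℝ²` with its Euclidean norm. -/
abbrev Plane : Type := EuclideanSpace ℝ (Fin 2)

/-- Divergence `∑ᵢ ∂ᵢ wᵢ` of a vector field on the plane. -/
def planeDiv (w : Plane → Plane) (x : Plane) : ℝ :=
  ∑ i : Fin 2, fderiv ℝ w x (EuclideanSpace.single i 1) i

/-- `j`-th time derivative `∂ₜʲ g (t, ·)` of a function of `(t, x) ∈ [0, ∞) × ℝ²`
(one-sided at `t = 0`; values at negative times play no role). -/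
def timeDerivN {F : Type*} [NormedAddCommGroup F] [NormedSpace ℝ F]
    (j : ℕ) (g : ℝ → Plane → F) (t : ℝ) (x : Plane) : F :=
  iteratedDerivWithin j (fun s => g s x) (Ici 0) t

/-- Time derivative `∂ₜ g (t, ·)` of a function of `(t, x) ∈ [0, ∞) × ℝ²`
(one-sided at `t = 0`). -/
def timeDeriv {F : Type*} [NormedAddCommGroup F] [NormedSpace ℝ F]
    (g : ℝ → Plane → F) (t : ℝ) (x : Plane) : F :=
  derivWithin (fun s => g s x) (Ici 0) t

/-- Smoothness (jointly in time and space) on `[0, ∞) × ℝ²`. -/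
def SmoothSpaceTime {F : Type*} [NormedAddCommGroup F] [NormedSpace ℝ F]
    (g : ℝ → Plane → F) : Prop :=
  ContDiffOn ℝ ∞ (fun q : ℝ × Plane => g q.1 q.2) (Ici 0 ×ˢ univ)

/-- A smooth function on the plane lies in the Sobolev space `Hᵏ(ℝ²)` for every `k`:
it is smooth and all its derivatives are square integrable. -/
def InAllSobolev {F : Type*} [NormedAddCommGroup F] [NormedSpace ℝ F]
    (g : Plane → F) : Prop :=
  ContDiff ℝ ∞ g ∧ ∀ k : ℕ, MemLp (iteratedFDeriv ℝ k g) 2 volume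

/-- `g` is smooth on `[0, ∞) × ℝ²` and, at every time `t ≥ 0`, each time derivative
`∂ₜʲ g (t, ·)` lies in every Sobolev space `Hᵏ(ℝ²)`. Every smooth map of time `t ≥ 0` into all the
spaces `Hᵏ(ℝ²)` has this property. -/
structure SmoothSobolev {F : Type*} [NormedAddCommGroup F] [NormedSpace ℝ F]
    (g : ℝ → Plane → F) : Prop where
  smooth : SmoothSpaceTime g
  sobolev : ∀ (j : ℕ) (t : ℝ), 0 ≤ t → InAllSobolev (timeDerivN j g t)

/-- `(ρ, u, ∇P)` is a smooth global solution of the inhomogeneous incompressible Navier–Stokes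
system on `[0, ∞) × ℝ²`. The pressure enters through its gradient only. -/
structure IsSolINS2D (ρ : ℝ → Plane → ℝ) (u : ℝ → Plane → Plane) (P : ℝ → Plane → ℝ) :
    Prop where
  smooth_rho : SmoothSpaceTime ρ
  smooth_u : SmoothSobolev u
  smooth_P : ∀ t, 0 ≤ t → ContDiff ℝ ∞ (P t)
  smooth_gradP : SmoothSobolev (fun t => gradient (P t))
  mass : ∀ t, 0 ≤ t → ∀ x, timeDeriv ρ t x + fderiv ℝ (ρ t) x (u t x) = 0
  momentum : ∀ t, 0 ≤ t → ∀ x,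
    ρ t x • timeDeriv u t x + ρ t x • fderiv ℝ (u t) x (u t x)
      - Δ (u t) x + gradient (P t) x = 0
  div_u : ∀ t, 0 ≤ t → ∀ x, planeDiv (u t) x = 0

/-- `(v, Pv, f)` solves the linearized system around the smooth global solution `(ρ, u, ∇P)`,
whose density takes its values in `[1/2, 2]`. -/
structure IsSolLINS2D (ρ : ℝ → Plane → ℝ) (u : ℝ → Plane → Plane) (P : ℝ → Plane → ℝ)
    (v : ℝ → Plane → Plane) (Pv : ℝ → Plane → ℝ) (f : ℝ → Plane → Plane) : Prop where
  base : IsSolINS2D ρ u P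
  rho_mem : ∀ t, 0 ≤ t → ∀ x, ρ t x ∈ Icc (1 / 2 : ℝ) 2
  smooth_v : SmoothSobolev v
  smooth_Pv : ∀ t, 0 ≤ t → ContDiff ℝ ∞ (Pv t)
  smooth_gradPv : SmoothSobolev (fun t => gradient (Pv t))
  smooth_f : SmoothSobolev f
  momentum : ∀ t, 0 ≤ t → ∀ x,
    ρ t x • timeDeriv v t x + ρ t x • fderiv ℝ (v t) x (u t x)
      - Δ (v t) x + gradient (Pv t) x = f t x
  div_v : ∀ t, 0 ≤ t → ∀ x, planeDiv (v t) x = 0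

end

/-! ### A Bellman function -/

section Bellman

open Filter Topology

/-- The Bellman function `M y^q + x² (x^p + y^q)^a` on the quadrant. -/
noncomputable def bellman (p q M : ℝ) (x y : ℝ) : ℝ :=
  M * y ^ q + x ^ 2 * (x ^ p + y ^ q) ^ ((p - 2) / p)

lemma bellman_continuous {p q : ℝ} (hp : 2 ≤ p) (hq : 0 ≤ q) (M : ℝ) :
    Continuous (fun z : ℝ × ℝ => bellman p q M z.1 z.2) := by
  unfold bellman
  have h1 : Continuous fun z : ℝ × ℝ => z.1 ^ p :=
    continuous_fst.rpow_const (fun _ => Or.inr (by linarith))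
  have h2 : Continuous fun z : ℝ × ℝ => z.2 ^ q :=
    continuous_snd.rpow_const (fun _ => Or.inr hq)
  have h3 : Continuous fun z : ℝ × ℝ => (z.1 ^ p + z.2 ^ q) ^ ((p - 2) / p) :=
    (h1.add h2).rpow_const (fun _ => Or.inr (div_nonneg (by linarith) (by linarith)))
  exact (continuous_const.mul h2).add ((continuous_fst.pow 2).mul h3)

lemma sq_mul_rpow_le {p x W : ℝ} (hp : 2 ≤ p) (hx : 0 ≤ x) (hW : x ^ p ≤ W) :
    x ^ 2 * W ^ ((p - 2) / p) ≤ W := by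
  have hp0 : 0 < p := by linarith
  have hW0 : 0 ≤ W := (Real.rpow_nonneg hx p).trans hW
  have h1 : x ^ 2 ≤ W ^ (2 / p) := by
    calc x ^ 2 = (x ^ p) ^ (2 / p) := by
          rw [← Real.rpow_mul hx, mul_div_cancel₀ _ hp0.ne', Real.rpow_two]
      _ ≤ W ^ (2 / p) := Real.rpow_le_rpow (Real.rpow_nonneg hx p) hW (by positivity)
  rcases hW0.eq_or_lt with h0 | h0
  · have : x ^ p = 0 := le_antisymm (h0 ▸ hW) (Real.rpow_nonneg hx p)
    have hx0 : x = 0 := (Real.rpow_eq_zero hx hp0.ne').1 this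
    simp [hx0, ← h0]
  calc x ^ 2 * W ^ ((p - 2) / p) ≤ W ^ (2 / p) * W ^ ((p - 2) / p) := by gcongr
    _ = W := by
      rw [← Real.rpow_add h0]
      have : 2 / p + (p - 2) / p = 1 := by field_simp; ring
      rw [this, Real.rpow_one]

lemma bellman_le {p q M x y : ℝ} (hp : 2 ≤ p) (hM : 0 ≤ M) (hx : 0 ≤ x) (hy : 0 ≤ y) :
    bellman p q M x y ≤ (M + 1) * (x ^ p + y ^ q) := by
  have h1 := Real.rpow_nonneg hx p
  have h2 := Real.rpow_nonneg hy q
  have := sq_mul_rpow_le hp hx (W := x ^ p + y ^ q) (by linarith)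
  unfold bellman
  nlinarith [mul_nonneg hM h1]

lemma bellman_nonneg {p q M x y : ℝ} (hM : 0 ≤ M) (hx : 0 ≤ x) (hy : 0 ≤ y) :
    0 ≤ bellman p q M x y := by
  have h1 := Real.rpow_nonneg hx p
  have h2 := Real.rpow_nonneg hy q
  unfold bellman
  positivity

/-- The quadratic inequality behind the convexity of `bellman`. -/
lemma bellman_quadratic_nonneg {p q a M W Z P Q R α β : ℝ} (hp : 2 ≤ p) (hq : 1 < q)
    (ha0 : 0 ≤ a) (ha1 : a ≤ 1) (hap : (1 - a) * p = 2)
    (hM : 5 * q ^ 2 + 1 ≤ M * (q * (q - 1)))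
    (hW : 0 < W) (hP : 0 ≤ P) (hQ : 0 ≤ Q) (hPQ : P + Q = 1) (hZ : 0 ≤ Z) (hZW : Z ≤ W)
    (hR : R ^ 2 ≤ Z * (Q * W)) :
    0 ≤ M * (q * (q - 1)) * (Q * W) * β ^ 2
      + Z * (2 * α ^ 2 + 4 * a * α * (p * P * α + q * Q * β)
        - a * (1 - a) * (p * P * α + q * Q * β) ^ 2
        + a * (p * (p - 1) * P * α ^ 2 + q * (q - 1) * Q * β ^ 2)) + 2 * R * α * β := by
  have hQ1 : Q ≤ 1 := by linarith
  have hP1 : P ≤ 1 := by linarith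
  have key : α ^ 2 - 5 * q ^ 2 * Q * β ^ 2 ≤
      2 * α ^ 2 + 4 * a * α * (p * P * α + q * Q * β)
        - a * (1 - a) * (p * P * α + q * Q * β) ^ 2
        + a * (p * (p - 1) * P * α ^ 2 + q * (q - 1) * Q * β ^ 2) := by
    have e : 2 * α ^ 2 + 4 * a * α * (p * P * α + q * Q * β)
        - a * (1 - a) * (p * P * α + q * Q * β) ^ 2
        + a * (p * (p - 1) * P * α ^ 2 + q * (q - 1) * Q * β ^ 2)
        = (2 + a * p * P * (4 - ((1 - a) * p) * P + (p - 1))) * α ^ 2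
          + (4 * a * q * Q - 2 * a * ((1 - a) * p) * q * P * Q) * (α * β)
          + (a * q * (q - 1) * Q - a * (1 - a) * q ^ 2 * Q ^ 2) * β ^ 2 := by ring
    rw [e, hap]
    have e2 : 4 * a * q * Q - 2 * a * 2 * q * P * Q = 4 * a * q * Q ^ 2 := by
      have : P = 1 - Q := by linarith
      rw [this]; ring
    rw [e2]
    have h1 : 2 * α ^ 2 ≤ (2 + a * p * P * (4 - 2 * P + (p - 1))) * α ^ 2 := by
      have : 0 ≤ a * p * P * (4 - 2 * P + (p - 1)) := by
        have : 0 ≤ 4 - 2 * P + (p - 1) := by linarith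
        positivity
      nlinarith [sq_nonneg α]
    have hQ2 : Q ^ 2 ≤ Q := by nlinarith
    have hQ4 : Q ^ 4 ≤ Q := by nlinarith [sq_nonneg Q]
    have haa : a ^ 2 ≤ 1 := by nlinarith
    have h2 : -(α ^ 2) - 4 * q ^ 2 * Q * β ^ 2 ≤ 4 * a * q * Q ^ 2 * (α * β) := by
      have hs := sq_nonneg (α + 2 * a * q * Q ^ 2 * β)
      have : a ^ 2 * (Q ^ 4) * (4 * q ^ 2 * β ^ 2) ≤ 1 * Q * (4 * q ^ 2 * β ^ 2) := by
        gcongr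
      nlinarith
    have h3 : -(q ^ 2 * Q * β ^ 2) ≤ (a * q * (q - 1) * Q - a * (1 - a) * q ^ 2 * Q ^ 2) * β ^ 2 := by
      have h4 : 0 ≤ a * q * (q - 1) * Q := by
        have : 0 ≤ q - 1 := by linarith
        positivity
      have h5 : a * (1 - a) * Q ^ 2 ≤ 1 * Q := by
        have : a * (1 - a) ≤ 1 := by nlinarith
        have : 0 ≤ 1 - a := by linarith
        gcongr
      have h6 : a * (1 - a) * Q ^ 2 * q ^ 2 ≤ 1 * Q * q ^ 2 := by gcongr
      have : (-(q ^ 2 * Q)) * β ^ 2 ≤ (a * q * (q - 1) * Q - a * (1 - a) * q ^ 2 * Q ^ 2) * β ^ 2 := by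
        gcongr; linarith
      linarith
    linarith
  have h1 := mul_le_mul_of_nonneg_left key hZ
  have h2 : (5 * q ^ 2 + 1) * ((Q * W) * β ^ 2) ≤ M * (q * (q - 1)) * ((Q * W) * β ^ 2) := by
    gcongr
  have h3 : Z * (5 * q ^ 2 * Q * β ^ 2) ≤ W * (5 * q ^ 2 * Q * β ^ 2) := by gcongr
  have h4 : 0 ≤ Z * α ^ 2 + 2 * R * α * β + Q * W * β ^ 2 := by
    have hQW : 0 ≤ Q * W := by positivity
    rcases hZ.eq_or_lt with h | h
    · have : R = 0 := by
        have : R ^ 2 ≤ 0 := by rw [← h] at hR; linarith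
        exact pow_eq_zero_iff two_ne_zero |>.1 (le_antisymm this (sq_nonneg R))
      rw [this]; nlinarith [sq_nonneg α, sq_nonneg β, mul_nonneg hQW (sq_nonneg β)]
    · have h5 : 0 ≤ Z * (Z * α ^ 2 + 2 * R * α * β + Q * W * β ^ 2) := by
        have : Z * (Z * α ^ 2 + 2 * R * α * β + Q * W * β ^ 2)
          = (Z * α + R * β) ^ 2 + (Z * (Q * W) - R ^ 2) * β ^ 2 := by ring
        rw [this]
        have : 0 ≤ Z * (Q * W) - R ^ 2 := by linarith
        positivity
      exact nonneg_of_mul_nonneg_right h5 h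
  nlinarith

lemma bellman_line_convexOn {p q M : ℝ} (hpq : p.HolderConjugate q) (hp : 2 ≤ p)
    (hM : 5 * q ^ 2 + 1 ≤ M * (q * (q - 1))) {x y d e s : ℝ} (hs : s ^ 2 = 1)
    (hxd : |d| < x) (hye : |e| < y) :
    ConvexOn ℝ (Icc (-1 : ℝ) 1) (fun t => bellman p q M (x + t * d) (y + t * e)
      + s * ((x + t * d) * (y + t * e))) := by
  have hq : 1 < q := hpq.symm.lt
  set a := (p - 2) / p with ha
  have hp0 : 0 < p := by linarith
  have hap : (1 - a) * p = 2 := by rw [ha]; field_simp; ring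
  have ha0 : 0 ≤ a := div_nonneg (by linarith) hp0.le
  have ha1 : a ≤ 1 := by rw [ha, div_le_one hp0]; linarith
  have haq : q * a = 2 - q := by
    have := hpq.mul_eq_add
    have h2 : q * a = q * (p - 2) / p := by rw [ha]; ring
    rw [h2, div_eq_iff hp0.ne']; linarith
  have pos : ∀ {x d t : ℝ}, |d| < x → t ∈ Icc (-1 : ℝ) 1 → 0 < x + t * d := by
    intro x d t h ht
    have : |t * d| ≤ |d| := by
      rw [abs_mul]; exact mul_le_of_le_one_left (abs_nonneg _) (abs_le.2 ht)
    have := neg_abs_le (t * d)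
    linarith
  have hX : ∀ t : ℝ, HasDerivAt (fun t => x + t * d) d t := fun t => by
    simpa using ((hasDerivAt_id t).mul_const d).const_add x
  have hY : ∀ t : ℝ, HasDerivAt (fun t => y + t * e) e t := fun t => by
    simpa using ((hasDerivAt_id t).mul_const e).const_add y
  refine convexOn_of_hasDerivWithinAt2_nonneg (convex_Icc _ _)
    (f' := fun t => M * (e * q * (y + t * e) ^ (q - 1))
      + ((2 * (x + t * d) ^ 1 * d) * ((x + t * d) ^ p + (y + t * e) ^ q) ^ a
        + (x + t * d) ^ 2 * ((d * p * (x + t * d) ^ (p - 1) + e * q * (y + t * e) ^ (q - 1)) * a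
          * ((x + t * d) ^ p + (y + t * e) ^ q) ^ (a - 1)))
      + s * (d * (y + t * e) + (x + t * d) * e))
    (f'' := fun t => M * (e * q * (e * (q - 1) * (y + t * e) ^ (q - 1 - 1)))
      + ((2 * d * d) * ((x + t * d) ^ p + (y + t * e) ^ q) ^ a
         + (2 * (x + t * d) ^ 1 * d) * ((d * p * (x + t * d) ^ (p - 1)
            + e * q * (y + t * e) ^ (q - 1)) * a * ((x + t * d) ^ p + (y + t * e) ^ q) ^ (a - 1))
        + ((2 * (x + t * d) ^ 1 * d) * ((d * p * (x + t * d) ^ (p - 1)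
            + e * q * (y + t * e) ^ (q - 1)) * a * ((x + t * d) ^ p + (y + t * e) ^ q) ^ (a - 1))
          + (x + t * d) ^ 2 * ((d * p * (d * (p - 1) * (x + t * d) ^ (p - 1 - 1))
             + e * q * (e * (q - 1) * (y + t * e) ^ (q - 1 - 1))) * a
              * ((x + t * d) ^ p + (y + t * e) ^ q) ^ (a - 1)
            + (d * p * (x + t * d) ^ (p - 1) + e * q * (y + t * e) ^ (q - 1)) * a
             * ((d * p * (x + t * d) ^ (p - 1) + e * q * (y + t * e) ^ (q - 1)) * (a - 1)
              * ((x + t * d) ^ p + (y + t * e) ^ q) ^ (a - 1 - 1)))))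
      + s * (d * e + d * e)) ?_ ?_ ?_ ?_
  · have h1 := (bellman_continuous hp hpq.symm.nonneg M).comp
      (f := fun t : ℝ => (x + t * d, y + t * e)) (by fun_prop)
    refine (h1.add ?_).continuousOn
    fun_prop
  · intro t ht
    have ht := interior_subset ht
    have hx0 := pos hxd ht
    have hy0 := pos hye ht
    have hW : HasDerivAt (fun t => (x + t * d) ^ p + (y + t * e) ^ q)
      (d * p * (x + t * d) ^ (p - 1) + e * q * (y + t * e) ^ (q - 1)) t :=
      ((hX t).rpow_const (Or.inl hx0.ne')).add ((hY t).rpow_const (Or.inl hy0.ne'))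
    have hW0 : 0 < (x + t * d) ^ p + (y + t * e) ^ q := by positivity
    have hsq : HasDerivAt (fun t => (x + t * d) ^ 2) (2 * (x + t * d) ^ 1 * d) t := by
      simpa using (hX t).fun_pow 2
    exact (((((hY t).rpow_const (p := q) (Or.inl hy0.ne')).const_mul M).add
      (hsq.mul (hW.rpow_const (p := a) (Or.inl hW0.ne')))).add
      (((hX t).mul (hY t)).const_mul s)).hasDerivWithinAt
  · intro t ht
    have ht := interior_subset ht
    have hx0 := pos hxd ht
    have hy0 := pos hye ht
    have hW : HasDerivAt (fun t => (x + t * d) ^ p + (y + t * e) ^ q)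
      (d * p * (x + t * d) ^ (p - 1) + e * q * (y + t * e) ^ (q - 1)) t :=
      ((hX t).rpow_const (Or.inl hx0.ne')).add ((hY t).rpow_const (Or.inl hy0.ne'))
    have hW0 : 0 < (x + t * d) ^ p + (y + t * e) ^ q := by positivity
    have hY1 := (hY t).rpow_const (p := q - 1) (Or.inl hy0.ne')
    have hX1 := (hX t).rpow_const (p := p - 1) (Or.inl hx0.ne')
    have h2X : HasDerivAt (fun t => 2 * (x + t * d) ^ 1 * d) (2 * d * d) t := by
      simpa using ((hX t).const_mul 2).mul_const d
    have hsq : HasDerivAt (fun t => (x + t * d) ^ 2) (2 * (x + t * d) ^ 1 * d) t := by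
      simpa using (hX t).fun_pow 2
    have hW1 : HasDerivAt (fun t => d * p * (x + t * d) ^ (p - 1) + e * q * (y + t * e) ^ (q - 1))
      _ t := (hX1.const_mul (d * p)).add (hY1.const_mul (e * q))
    have hlast : HasDerivAt (fun t => d * (y + t * e) + (x + t * d) * e) (d * e + d * e) t :=
      ((hY t).const_mul d).add ((hX t).mul_const e)
    exact (((((hY1.const_mul (e * q)).const_mul M).add
      ((h2X.mul (hW.rpow_const (p := a) (Or.inl hW0.ne'))).add
        (hsq.mul ((hW1.mul_const a).mul (hW.rpow_const (p := a - 1) (Or.inl hW0.ne'))))))).add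
      (hlast.const_mul s)).hasDerivWithinAt
  · intro t ht
    have ht := interior_subset ht
    have hx0 := pos hxd ht
    have hy0 := pos hye ht
    generalize x + t * d = X at hx0 ⊢
    generalize y + t * e = Y at hy0 ⊢
    have hXp : 0 < X ^ p := by positivity
    have hYq : 0 < Y ^ q := by positivity
    have hW0 : 0 < X ^ p + Y ^ q := by positivity
    have hZW := sq_mul_rpow_le hp hx0.le (W := X ^ p + Y ^ q) (by linarith)
    rw [← ha] at hZW
    have hYa : Y ^ 2 ≤ (X ^ p + Y ^ q) ^ a * Y ^ q := by
      calc Y ^ 2 = (Y ^ q) ^ a * Y ^ q := by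
            rw [← Real.rpow_mul hy0.le, ← Real.rpow_add hy0, haq, sub_add_cancel, Real.rpow_two]
        _ ≤ _ := by gcongr; linarith
    have := bellman_quadratic_nonneg (p := p) (q := q) (a := a) (M := M) (W := X ^ p + Y ^ q)
      (Z := X ^ 2 * (X ^ p + Y ^ q) ^ a) (P := X ^ p / (X ^ p + Y ^ q))
      (Q := Y ^ q / (X ^ p + Y ^ q)) (R := s * (X * Y)) (α := d / X) (β := e / Y) hp hq ha0 ha1 hap
      hM hW0 (by positivity) (by positivity) (by field_simp) (by positivity) hZW (by
        rw [div_mul_cancel₀ _ hW0.ne', mul_pow, hs, one_mul, mul_pow, mul_assoc]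
        gcongr)
    simp only [Real.rpow_sub_one hW0.ne', Real.rpow_sub_one hx0.ne', Real.rpow_sub_one hy0.ne']
    convert this using 1
    field_simp
    ring

lemma bellman_midpoint {p q M : ℝ} (hpq : p.HolderConjugate q) (hp : 2 ≤ p)
    (hM : 5 * q ^ 2 + 1 ≤ M * (q * (q - 1))) {x y d e : ℝ} (hxd : |d| ≤ x) (hye : |e| ≤ y) :
    bellman p q M x y + |d| * |e|
      ≤ (bellman p q M (x + d) (y + e) + bellman p q M (x - d) (y - e)) / 2 := by
  have main : ∀ s : ℝ, s ^ 2 = 1 → ∀ x y : ℝ, |d| < x → |e| < y → bellman p q M x y - s * (d * e)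
      ≤ (bellman p q M (x + d) (y + e) + bellman p q M (x - d) (y - e)) / 2 := by
    intro s hs x y hx hy
    have h := (bellman_line_convexOn hpq hp hM hs hx hy).2 (left_mem_Icc.2 (by norm_num))
      (right_mem_Icc.2 (by norm_num)) (by norm_num : (0 : ℝ) ≤ 1 / 2)
      (by norm_num : (0 : ℝ) ≤ 1 / 2) (by norm_num)
    simp only [smul_eq_mul] at h
    norm_num at h
    have e1 : x + -d = x - d := by ring
    have e2 : y + -e = y - e := by ring
    rw [e1, e2] at h
    nlinarith
  have strict : ∀ x y : ℝ, |d| < x → |e| < y → bellman p q M x y + |d| * |e|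
      ≤ (bellman p q M (x + d) (y + e) + bellman p q M (x - d) (y - e)) / 2 := by
    intro x y hx hy
    rw [← abs_mul]
    rcases abs_cases (d * e) with h | h <;> rw [h.1]
    · simpa using main (-1) (by norm_num) x y hx hy
    · simpa [sub_eq_add_neg] using main 1 (by norm_num) x y hx hy
  have hc := bellman_continuous hp hpq.symm.nonneg M
  have hc' : ∀ d e : ℝ, Continuous fun ε : ℝ => bellman p q M (x + ε + d) (y + ε + e) :=
    fun d e => hc.comp (f := fun ε : ℝ => (x + ε + d, y + ε + e)) (by fun_prop)
  have hl := ((hc' 0 0).add_const (|d| * |e|)).tendsto 0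
  have hr := (((hc' d e).add (hc' (-d) (-e))).div_const 2).tendsto 0
  have := le_of_tendsto_of_tendsto (b := 𝓝[>] (0 : ℝ)) (hl.mono_left nhdsWithin_le_nhds)
    (hr.mono_left nhdsWithin_le_nhds) (by
      filter_upwards [self_mem_nhdsWithin] with ε hε
      have hε : 0 < ε := hε
      simpa [sub_eq_add_neg] using strict (x + ε) (y + ε) (by linarith) (by linarith))
  simpa [sub_eq_add_neg] using this

/-- A function on the quadrant of size at most `K (x^p + y^q)` whose midpoint convexity defect
dominates the product of the increments. -/
structure IsBellman (p q K : ℝ) (B : ℝ → ℝ → ℝ) : Prop where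
  continuous : Continuous (fun z : ℝ × ℝ => B z.1 z.2)
  nonneg : ∀ {x y}, 0 ≤ x → 0 ≤ y → 0 ≤ B x y
  le : ∀ {x y}, 0 ≤ x → 0 ≤ y → B x y ≤ K * (x ^ p + y ^ q)
  midpoint : ∀ {x y d e}, |d| ≤ x → |e| ≤ y →
    B x y + |d| * |e| ≤ (B (x + d) (y + e) + B (x - d) (y - e)) / 2

lemma exists_isBellman {p q : ℝ} (hpq : p.HolderConjugate q) :
    ∃ K : ℝ, 0 ≤ K ∧ ∃ B, IsBellman p q K B := by
  have key : ∀ {p q : ℝ}, p.HolderConjugate q → 2 ≤ p →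
      ∃ K : ℝ, 0 ≤ K ∧ ∃ B, IsBellman p q K B := by
    intro p q hpq hp
    have hq : 0 < q * (q - 1) := mul_pos hpq.symm.pos (by linarith [hpq.symm.lt])
    set M := (5 * q ^ 2 + 1) / (q * (q - 1)) with hM
    have hM' : 5 * q ^ 2 + 1 ≤ M * (q * (q - 1)) := by rw [hM, div_mul_cancel₀ _ hq.ne']
    have hM0 : 0 ≤ M := by positivity
    exact ⟨M + 1, by positivity, bellman p q M, bellman_continuous hp hpq.symm.nonneg M,
      bellman_nonneg hM0, bellman_le hp hM0, bellman_midpoint hpq hp hM'⟩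
  rcases le_total 2 p with hp | hp
  · exact key hpq hp
  · have hq : 2 ≤ q := by
      have := hpq.mul_eq_add
      nlinarith [hpq.lt, hpq.symm.lt]
    obtain ⟨K, hK, B, hB⟩ := key hpq.symm hq
    refine ⟨K, hK, fun x y => B y x, hB.continuous.comp continuous_swap,
      fun hx hy => hB.nonneg hy hx, fun hx hy => ?_, fun hx hy => ?_⟩
    · rw [add_comm]; exact hB.le hy hx
    · rw [mul_comm]; exact hB.midpoint hy hx

end Bellman

/-! ### The algebra of translations -/

section Translations

/-- Finite linear combinations of translations of the plane. -/
abbrev TransAlg : Type := AddMonoidAlgebra ℝ Plane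

/-- The translations, as operators on functions. -/
noncomputable def translateHom : Multiplicative Plane →* Module.End ℝ (Plane → ℝ) where
  toFun y :=
    { toFun := fun f x => f (x + y.toAdd)
      map_add' := fun _ _ => rfl
      map_smul' := fun _ _ => rfl }
  map_one' := by ext f x; simp
  map_mul' y z := by ext f x; simp [add_assoc]

/-- The action of combinations of translations on functions. -/
noncomputable def act : TransAlg →ₐ[ℝ] Module.End ℝ (Plane → ℝ) :=
  AddMonoidAlgebra.lift ℝ _ Plane translateHom

/-- The translation `f ↦ f (· + y)`. -/
noncomputable def tau (y : Plane) : TransAlg := AddMonoidAlgebra.single y 1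

lemma act_tau (y : Plane) (f : Plane → ℝ) (x : Plane) : act (tau y) f x = f (x + y) := by
  simp [act, tau, AddMonoidAlgebra.lift_single, translateHom]

lemma tau_add (y z : Plane) : tau (y + z) = tau y * tau z := by
  simp [tau, AddMonoidAlgebra.single_mul_single]

lemma tau_zero : tau 0 = 1 := rfl

lemma tau_mul_neg (y : Plane) : tau y * tau (-y) = 1 := by
  rw [← tau_add, add_neg_cancel, tau_zero]

lemma transAlg_induction {motive : TransAlg → Prop} (r : TransAlg) (htau : ∀ y, motive (tau y))
    (hadd : ∀ r s, motive r → motive s → motive (r + s))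
    (hsmul : ∀ (c : ℝ) r, motive r → motive (c • r)) : motive r :=
  AddMonoidAlgebra.induction_on r htau hadd hsmul

lemma act_mul (r s : TransAlg) (f : Plane → ℝ) : act (r * s) f = act r (act s f) := by
  rw [map_mul]; rfl

lemma act_add (r s : TransAlg) (f : Plane → ℝ) : act (r + s) f = act r f + act s f := by
  rw [map_add]; rfl

lemma act_sub (r s : TransAlg) (f : Plane → ℝ) : act (r - s) f = act r f - act s f := by
  rw [map_sub]; rfl

lemma act_smul (c : ℝ) (r : TransAlg) (f : Plane → ℝ) : act (c • r) f = c • act r f := by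
  rw [map_smul]; rfl

lemma act_one (f : Plane → ℝ) : act 1 f = f := by rw [map_one]; rfl

lemma memLp_act {s : ℝ≥0∞} {f : Plane → ℝ} (hf : MemLp f s volume) (r : TransAlg) :
    MemLp (act r f) s volume := by
  induction r using transAlg_induction with
  | htau y =>
    have : act (tau y) f = f ∘ (fun x => x + y) := by ext x; exact act_tau y f x
    rw [this]
    exact hf.comp_measurePreserving (measurePreserving_add_right volume y)
  | hadd r s hr hs => rw [act_add]; exact hr.add hs
  | hsmul c r hr => rw [act_smul]; exact hr.const_smul c

lemma eLpNorm_act_tau {s : ℝ≥0∞} {f : Plane → ℝ} (hf : AEStronglyMeasurable f volume) (y : Plane) :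
    eLpNorm (act (tau y) f) s volume = eLpNorm f s volume := by
  have : act (tau y) f = f ∘ (fun x => x + y) := by ext x; exact act_tau y f x
  rw [this]
  exact eLpNorm_comp_measurePreserving hf (measurePreserving_add_right volume y)

lemma integrable_mul_of_memLp_two {f g : Plane → ℝ} (hf : MemLp f 2 volume)
    (hg : MemLp g 2 volume) : Integrable (fun x => f x * g x) volume :=
  hf.integrable_mul hg

/-- `r'` acts as the adjoint of `r` for the `L²` pairing. -/
def IsAdj (r r' : TransAlg) : Prop :=
  ∀ f g : Plane → ℝ, MemLp f 2 volume → MemLp g 2 volume →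
    ∫ x, act r f x * g x = ∫ x, f x * act r' g x

lemma isAdj_tau (y : Plane) : IsAdj (tau y) (tau (-y)) := by
  intro f g _ _
  simp only [act_tau]
  rw [← integral_add_right_eq_self (fun x => f x * g (x + -y)) y]
  simp

lemma IsAdj.add {r r' s s' : TransAlg} (h : IsAdj r r') (h' : IsAdj s s') :
    IsAdj (r + s) (r' + s') := by
  intro f g hf hg
  simp only [act_add, Pi.add_apply, add_mul, mul_add]
  rw [integral_add (integrable_mul_of_memLp_two (memLp_act hf _) hg)
      (integrable_mul_of_memLp_two (memLp_act hf _) hg),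
    integral_add (integrable_mul_of_memLp_two hf (memLp_act hg _))
      (integrable_mul_of_memLp_two hf (memLp_act hg _)), h f g hf hg, h' f g hf hg]

lemma IsAdj.smul {r r' : TransAlg} (c : ℝ) (h : IsAdj r r') : IsAdj (c • r) (c • r') := by
  intro f g hf hg
  simp only [act_smul, Pi.smul_apply, smul_eq_mul, mul_assoc, mul_left_comm _ c]
  rw [integral_const_mul, integral_const_mul, h f g hf hg]

lemma IsAdj.neg {r r' : TransAlg} (h : IsAdj r r') : IsAdj (-r) (-r') := by
  simpa using h.smul (-1)

lemma IsAdj.mul {r r' s s' : TransAlg} (h : IsAdj r r') (h' : IsAdj s s') :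
    IsAdj (r * s) (r' * s') := by
  intro f g hf hg
  rw [act_mul, mul_comm r', act_mul, h _ _ (memLp_act hf _) hg, h' _ _ hf (memLp_act hg _)]

lemma isAdj_one : IsAdj 1 1 := fun f g _ _ => by simp

lemma IsAdj.pow {r r' : TransAlg} (h : IsAdj r r') (n : ℕ) : IsAdj (r ^ n) (r' ^ n) := by
  induction n with
  | zero => simpa using isAdj_one
  | succ n ih => rw [pow_succ, pow_succ]; exact ih.mul h

/-- The central difference `f (· + y) - f (· - y)`. -/
noncomputable def del (y : Plane) : TransAlg := tau y - tau (-y)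

lemma act_del (y : Plane) (f : Plane → ℝ) (x : Plane) :
    act (del y) f x = f (x + y) - f (x - y) := by
  rw [del, act_sub, Pi.sub_apply, act_tau, act_tau, sub_eq_add_neg x]

lemma isAdj_del (y : Plane) : IsAdj (del y) (-del y) := by
  have := (isAdj_tau y).add (isAdj_tau (-y)).neg
  rw [neg_neg] at this
  convert this using 1
  · rw [del, sub_eq_add_neg]
  · rw [del, neg_sub, sub_eq_add_neg]

/-- The `i`-th coordinate vector of the plane. -/
noncomputable abbrev ee (i : Fin 2) : Plane := EuclideanSpace.single i 1

/-- Half of the stencil of the averaging operator of step `k`. -/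
noncomputable def stencil (k : ℝ) : Fin 4 → Plane :=
  ![(2 * k) • ee 0, (2 * k) • ee 1, k • ee 0 + k • ee 1, k • ee 0 - k • ee 1]

/-- The averaging operator of step `k`. -/
noncomputable def avg (k : ℝ) : TransAlg :=
  (1 / 8 : ℝ) • ∑ i, (tau (stencil k i) + tau (-stencil k i))

lemma act_avg (k : ℝ) (f : Plane → ℝ) (x : Plane) :
    act (avg k) f x = (1 / 8) * ∑ i, (f (x + stencil k i) + f (x - stencil k i)) := by
  rw [avg, act_smul, Pi.smul_apply, smul_eq_mul]
  simp only [Fin.sum_univ_four, act_add, Pi.add_apply, act_tau, sub_eq_add_neg]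

lemma isAdj_avg (k : ℝ) : IsAdj (avg k) (avg k) := by
  have h : ∀ y, IsAdj (tau y + tau (-y)) (tau y + tau (-y)) := fun y => by
    have := (isAdj_tau y).add (isAdj_tau (-y))
    rwa [neg_neg, add_comm (tau (-y))] at this
  rw [avg]
  refine IsAdj.smul _ ?_
  simp only [Fin.sum_univ_four]
  exact (((h _).add (h _)).add (h _)).add (h _)

lemma act_avg_nonneg {k : ℝ} {f : Plane → ℝ} (hf : ∀ x, 0 ≤ f x) (x : Plane) :
    0 ≤ act (avg k) f x := by
  rw [act_avg]
  have : 0 ≤ ∑ i, (f (x + stencil k i) + f (x - stencil k i)) :=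
    Finset.sum_nonneg fun i _ => add_nonneg (hf _) (hf _)
  positivity

lemma act_avg_pow_nonneg {k : ℝ} {f : Plane → ℝ} (hf : ∀ x, 0 ≤ f x) (n : ℕ) (x : Plane) :
    0 ≤ act (avg k ^ n) f x := by
  induction n generalizing x with
  | zero => simpa [act_one] using hf x
  | succ n ih => rw [pow_succ', act_mul]; exact act_avg_nonneg ih x

lemma integrable_act {f : Plane → ℝ} (hf : Integrable f volume) (r : TransAlg) :
    Integrable (act r f) volume :=
  memLp_one_iff_integrable.1 (memLp_act (memLp_one_iff_integrable.2 hf) r)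

lemma integral_act_avg (k : ℝ) {f : Plane → ℝ} (hf : Integrable f volume) :
    ∫ x, act (avg k) f x = ∫ x, f x := by
  simp only [act_avg]
  have h1 : ∀ y, Integrable (fun x => f (x + y)) volume := fun y => hf.comp_add_right y
  have h2 : ∀ y, Integrable (fun x => f (x - y)) volume := fun y => hf.comp_sub_right y
  rw [integral_const_mul, integral_finsetSum _ fun i _ => (h1 (stencil k i)).fun_add (h2 (stencil k i))]
  have : ∀ i, ∫ x, (f (x + stencil k i) + f (x - stencil k i)) = 2 * ∫ x, f x := fun i => by
    rw [integral_add (h1 _) (h2 _), integral_add_right_eq_self, integral_sub_right_eq_self]; ring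
  simp only [this, Fin.sum_univ_four]; ring

lemma del_stencil_mul_del_stencil (k : ℝ) :
    del (stencil k 0) * del (stencil k 1)
      = del (stencil k 2) * del (stencil k 2) - del (stencil k 3) * del (stencil k 3) := by
  have ha := tau_mul_neg (k • ee 0)
  have hb := tau_mul_neg (k • ee 1)
  have e0 : tau (stencil k 0) = tau (k • ee 0) * tau (k • ee 0) := by
    rw [← tau_add, ← two_smul ℝ (k • ee 0), smul_smul]; rfl
  have e1 : tau (stencil k 1) = tau (k • ee 1) * tau (k • ee 1) := by
    rw [← tau_add, ← two_smul ℝ (k • ee 1), smul_smul]; rfl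
  have f0 : tau (-stencil k 0) = tau (-(k • ee 0)) * tau (-(k • ee 0)) := by
    rw [← tau_add, ← neg_add, ← two_smul ℝ (k • ee 0), smul_smul]; rfl
  have f1 : tau (-stencil k 1) = tau (-(k • ee 1)) * tau (-(k • ee 1)) := by
    rw [← tau_add, ← neg_add, ← two_smul ℝ (k • ee 1), smul_smul]; rfl
  have e2 : tau (stencil k 2) = tau (k • ee 0) * tau (k • ee 1) := by rw [← tau_add]; rfl
  have e3 : tau (stencil k 3) = tau (k • ee 0) * tau (-(k • ee 1)) := by
    rw [← tau_add, ← sub_eq_add_neg]; rfl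
  have f2 : tau (-stencil k 2) = tau (-(k • ee 0)) * tau (-(k • ee 1)) := by
    rw [← tau_add, ← neg_add]; rfl
  have f3 : tau (-stencil k 3) = tau (-(k • ee 0)) * tau (k • ee 1) := by
    rw [← tau_add]
    have : -stencil k 3 = -(k • ee 0) + k • ee 1 := by
      change -(k • ee 0 - k • ee 1) = _
      abel
    rw [this]
  simp only [del, e0, e1, e2, e3, f0, f1, f2, f3]
  ring

end Translations

/-! ### Bilinear estimates by the Bellman function -/

section Bilinear

variable {p q K : ℝ} {B : ℝ → ℝ → ℝ}

lemma IsBellman.midpoint_two (hB : IsBellman p q K B) {x x' y y' : ℝ} (hx : 0 ≤ x) (hx' : 0 ≤ x')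
    (hy : 0 ≤ y) (hy' : 0 ≤ y') :
    B ((x + x') / 2) ((y + y') / 2) + |x - x'| * |y - y'| / 4 ≤ (B x y + B x' y') / 2 := by
  have h := hB.midpoint (x := (x + x') / 2) (y := (y + y') / 2) (d := (x - x') / 2)
    (e := (y - y') / 2) (by rw [abs_le]; constructor <;> linarith)
    (by rw [abs_le]; constructor <;> linarith)
  rw [show (x + x') / 2 + (x - x') / 2 = x by ring, show (y + y') / 2 + (y - y') / 2 = y by ring,
    show (x + x') / 2 - (x - x') / 2 = x' by ring, show (y + y') / 2 - (y - y') / 2 = y' by ring,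
    abs_div, abs_div, abs_two] at h
  linarith

lemma IsBellman.average (hB : IsBellman p q K B) {x x' y y' : Fin 4 → ℝ} (hx : ∀ i, 0 ≤ x i)
    (hx' : ∀ i, 0 ≤ x' i) (hy : ∀ i, 0 ≤ y i) (hy' : ∀ i, 0 ≤ y' i) :
    B ((1 / 8) * ∑ i, (x i + x' i)) ((1 / 8) * ∑ i, (y i + y' i))
        + (1 / 16) * ∑ i, |x i - x' i| * |y i - y' i|
      ≤ (1 / 8) * ∑ i, (B (x i) (y i) + B (x' i) (y' i)) := by
  have h := fun i => hB.midpoint_two (hx i) (hx' i) (hy i) (hy' i)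
  have hm : ∀ i, 0 ≤ (x i + x' i) / 2 := fun i => by linarith [hx i, hx' i]
  have hn : ∀ i, 0 ≤ (y i + y' i) / 2 := fun i => by linarith [hy i, hy' i]
  have drop : ∀ {x x' y y' : ℝ}, 0 ≤ x → 0 ≤ x' → 0 ≤ y → 0 ≤ y' →
      B ((x + x') / 2) ((y + y') / 2) ≤ (B x y + B x' y') / 2 := by
    intro x x' y y' h1 h2 h3 h4
    have := hB.midpoint_two h1 h2 h3 h4
    have : 0 ≤ |x - x'| * |y - y'| / 4 := by positivity
    linarith
  have a := drop (hm 0) (hm 1) (hn 0) (hn 1)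
  have b := drop (hm 2) (hm 3) (hn 2) (hn 3)
  have c := drop (div_nonneg (add_nonneg (hm 0) (hm 1)) zero_le_two)
    (div_nonneg (add_nonneg (hm 2) (hm 3)) zero_le_two)
    (div_nonneg (add_nonneg (hn 0) (hn 1)) zero_le_two)
    (div_nonneg (add_nonneg (hn 2) (hn 3)) zero_le_two)
  simp only [Fin.sum_univ_four]
  have h0 := h 0
  have h1 := h 1
  have h2 := h 2
  have h3 := h 3
  rw [show (1 / 8) * (x 0 + x' 0 + (x 1 + x' 1) + (x 2 + x' 2) + (x 3 + x' 3)) =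
      (((x 0 + x' 0) / 2 + (x 1 + x' 1) / 2) / 2 + ((x 2 + x' 2) / 2 + (x 3 + x' 3) / 2) / 2) / 2 by
      ring,
    show (1 / 8) * (y 0 + y' 0 + (y 1 + y' 1) + (y 2 + y' 2) + (y 3 + y' 3)) =
      (((y 0 + y' 0) / 2 + (y 1 + y' 1) / 2) / 2 + ((y 2 + y' 2) / 2 + (y 3 + y' 3) / 2) / 2) / 2 by
      ring]
  linarith

lemma memLp_integrable_abs_rpow (hp : 0 < p) {f : Plane → ℝ}
    (hf : MemLp f (ENNReal.ofReal p) volume) : Integrable (fun x => |f x| ^ p) volume := by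
  have := hf.integrable_norm_rpow (by simpa using hp) ENNReal.ofReal_ne_top
  simpa [ENNReal.toReal_ofReal hp.le] using this

lemma IsBellman.integrable (hB : IsBellman p q K B) (hp : 0 < p) (hq : 0 < q) {U V : Plane → ℝ}
    (hU : ∀ x, 0 ≤ U x) (hV : ∀ x, 0 ≤ V x) (hUp : MemLp U (ENNReal.ofReal p) volume)
    (hVq : MemLp V (ENNReal.ofReal q) volume) :
    Integrable (fun x => B (U x) (V x)) volume := by
  have h1 := ((memLp_integrable_abs_rpow hp hUp).add (memLp_integrable_abs_rpow hq hVq)).const_mul K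
  refine h1.mono' ?_ (Filter.Eventually.of_forall fun x => ?_)
  · exact hB.continuous.comp_aestronglyMeasurable
      (hUp.aestronglyMeasurable.prodMk hVq.aestronglyMeasurable)
  · rw [Real.norm_of_nonneg (hB.nonneg (hU x) (hV x))]
    simpa [abs_of_nonneg (hU x), abs_of_nonneg (hV x)] using hB.le (hU x) (hV x)

lemma IsBellman.integral_step (hB : IsBellman p q K B) (hp : 0 < p) (hq : 0 < q) {U V : Plane → ℝ}
    (hU : ∀ x, 0 ≤ U x) (hV : ∀ x, 0 ≤ V x) (hUp : MemLp U (ENNReal.ofReal p) volume)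
    (hVq : MemLp V (ENNReal.ofReal q) volume) (k : ℝ) (i : Fin 4) :
    Integrable (fun x => |act (del (stencil k i)) U x| * |act (del (stencil k i)) V x|) volume ∧
    ∫ x, |act (del (stencil k i)) U x| * |act (del (stencil k i)) V x|
      ≤ 16 * (∫ x, B (U x) (V x)) - 16 * ∫ x, B (act (avg k) U x) (act (avg k) V x) := by
  have hH := hB.integrable hp hq hU hV hUp hVq
  have hH' := hB.integrable hp hq (act_avg_nonneg (k := k) hU) (act_avg_nonneg (k := k) hV)
    (memLp_act hUp _) (memLp_act hVq _)
  have hHa := integrable_act hH (avg k)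
  have key : ∀ x, |act (del (stencil k i)) U x| * |act (del (stencil k i)) V x|
      ≤ 16 * act (avg k) (fun x => B (U x) (V x)) x
        - 16 * B (act (avg k) U x) (act (avg k) V x) := by
    intro x
    have h := hB.average (x := fun i => U (x + stencil k i)) (x' := fun i => U (x - stencil k i))
      (y := fun i => V (x + stencil k i)) (y' := fun i => V (x - stencil k i))
      (fun _ => hU _) (fun _ => hU _) (fun _ => hV _) (fun _ => hV _)
    rw [act_del, act_del, act_avg, act_avg, act_avg]
    have := Finset.single_le_sum (f := fun i => |U (x + stencil k i) - U (x - stencil k i)|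
      * |V (x + stencil k i) - V (x - stencil k i)|) (fun i _ => by positivity)
      (Finset.mem_univ i)
    linarith
  have hR := (hHa.const_mul 16).sub (hH'.const_mul 16)
  have hI : Integrable (fun x => |act (del (stencil k i)) U x| * |act (del (stencil k i)) V x|)
      volume := by
    refine hR.mono' ?_ (Filter.Eventually.of_forall fun x => ?_)
    · exact (memLp_act hUp _).aestronglyMeasurable.norm.mul
        (memLp_act hVq _).aestronglyMeasurable.norm
    · rw [Real.norm_of_nonneg (by positivity)]; exact key x
  refine ⟨hI, ?_⟩
  have := integral_mono hI hR key
  rwa [integral_sub' (hHa.const_mul 16) (hH'.const_mul 16), integral_const_mul, integral_const_mul,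
    integral_act_avg k hH] at this

lemma IsBellman.sum_integral_le (hB : IsBellman p q K B) (hp : 0 < p) (hq : 0 < q)
    {f g : Plane → ℝ} (hf : ∀ x, 0 ≤ f x) (hg : ∀ x, 0 ≤ g x)
    (hfp : MemLp f (ENNReal.ofReal p) volume) (hgq : MemLp g (ENNReal.ofReal q) volume)
    (k : ℝ) (i : Fin 4) (N : ℕ) :
    ∑ n ∈ Finset.range N, ∫ x, |act (del (stencil k i) * avg k ^ n) f x|
        * |act (del (stencil k i) * avg k ^ n) g x|
      ≤ 16 * K * ((∫ x, f x ^ p) + ∫ x, g x ^ q) := by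
  have h1 : ∀ n, ∫ x, |act (del (stencil k i) * avg k ^ n) f x|
        * |act (del (stencil k i) * avg k ^ n) g x|
      ≤ 16 * (∫ x, B (act (avg k ^ n) f x) (act (avg k ^ n) g x))
        - 16 * ∫ x, B (act (avg k ^ (n + 1)) f x) (act (avg k ^ (n + 1)) g x) := fun n => by
    simp only [act_mul, pow_succ']
    exact (hB.integral_step hp hq (act_avg_pow_nonneg hf n) (act_avg_pow_nonneg hg n)
      (memLp_act hfp _) (memLp_act hgq _) k i).2
  refine (Finset.sum_le_sum fun n _ => h1 n).trans ?_
  rw [Finset.sum_range_sub' (fun n => 16 * ∫ x, B (act (avg k ^ n) f x) (act (avg k ^ n) g x))]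
  have h2 : 0 ≤ ∫ x, B (act (avg k ^ N) f x) (act (avg k ^ N) g x) :=
    integral_nonneg fun x => hB.nonneg (act_avg_pow_nonneg hf N x) (act_avg_pow_nonneg hg N x)
  have hfi := memLp_integrable_abs_rpow hp hfp
  have hgi := memLp_integrable_abs_rpow hq hgq
  simp only [fun x => abs_of_nonneg (hf x), fun x => abs_of_nonneg (hg x)] at hfi hgi
  have h3 : ∫ x, B (f x) (g x) ≤ K * ((∫ x, f x ^ p) + ∫ x, g x ^ q) := by
    rw [← integral_add hfi hgi, ← integral_const_mul]
    exact integral_mono (hB.integrable hp hq hf hg hfp hgq) ((hfi.add hgi).const_mul K)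
      fun x => hB.le (hf x) (hg x)
  simp only [pow_zero, act_one]
  linarith

lemma IsBellman.abs_sum_integral_le (hB : IsBellman p q K B) (hK : 0 ≤ K) (hp : 0 < p) (hq : 0 < q)
    {f g : Plane → ℝ} (hfp : MemLp f (ENNReal.ofReal p) volume)
    (hgq : MemLp g (ENNReal.ofReal q) volume) (k : ℝ) (i : Fin 4) (N : ℕ) :
    |∑ n ∈ Finset.range N, ∫ x, act (del (stencil k i) * avg k ^ n) f x
        * act (del (stencil k i) * avg k ^ n) g x|
      ≤ 64 * K * ((∫ x, |f x| ^ p) + ∫ x, |g x| ^ q) := by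
  have split : ∀ {p : ℝ}, 0 < p → ∀ {f : Plane → ℝ}, MemLp f (ENNReal.ofReal p) volume →
      ∃ F : Bool → Plane → ℝ, (∀ b x, 0 ≤ F b x) ∧
      (∀ b, MemLp (F b) (ENNReal.ofReal p) volume) ∧ (∀ b, ∫ x, F b x ^ p ≤ ∫ x, |f x| ^ p) ∧
      f = F true - F false := by
    intro p hp f hfp
    have hn : MemLp (fun x => max (-f x) 0) (ENNReal.ofReal p) volume := hfp.neg.pos_part
    have hF : ∀ b : Bool, MemLp (fun x => max (if b then f x else -f x) 0) (ENNReal.ofReal p)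
        volume := by
      intro b; cases b
      · simpa using hn
      · simpa using hfp.pos_part
    refine ⟨fun b x => max (if b then f x else -f x) 0, fun b x => le_max_right _ _, hF,
      fun b => ?_, ?_⟩
    · have := memLp_integrable_abs_rpow hp (hF b)
      refine integral_mono (by simpa [abs_of_nonneg] using this)
        (memLp_integrable_abs_rpow hp hfp) fun x => ?_
      refine Real.rpow_le_rpow (le_max_right _ _) (max_le ?_ (abs_nonneg _)) hp.le
      cases b
      · simpa using neg_le_abs (f x)
      · simpa using le_abs_self (f x)
    · ext x
      simp only [Pi.sub_apply, if_true, Bool.false_eq_true, if_false]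
      rcases le_total (f x) 0 with h | h
      · rw [max_eq_right h, max_eq_left (by linarith)]; ring
      · rw [max_eq_left h, max_eq_right (by linarith)]; ring
  obtain ⟨F, hF0, hFp, hFi, hfF⟩ := split hp hfp
  obtain ⟨G, hG0, hGq, hGi, hgG⟩ := split hq hgq
  have hmono : ∀ n b c, Integrable (fun x => |act (del (stencil k i) * avg k ^ n) (F b) x|
        * |act (del (stencil k i) * avg k ^ n) (G c) x|) volume := fun n b c => by
    simp only [act_mul]
    exact (hB.integral_step hp hq (act_avg_pow_nonneg (hF0 b) n) (act_avg_pow_nonneg (hG0 c) n)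
      (memLp_act (hFp b) _) (memLp_act (hGq c) _) k i).1
  have h1 : ∀ n, |∫ x, act (del (stencil k i) * avg k ^ n) f x
        * act (del (stencil k i) * avg k ^ n) g x|
      ≤ ∑ b, ∑ c, ∫ x, |act (del (stencil k i) * avg k ^ n) (F b) x|
        * |act (del (stencil k i) * avg k ^ n) (G c) x| := fun n => by
    have e : ∑ b, ∑ c, ∫ x, |act (del (stencil k i) * avg k ^ n) (F b) x|
        * |act (del (stencil k i) * avg k ^ n) (G c) x|
        = ∫ x, ∑ b, ∑ c, |act (del (stencil k i) * avg k ^ n) (F b) x|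
          * |act (del (stencil k i) * avg k ^ n) (G c) x| := by
      rw [integral_finsetSum _ fun b _ => integrable_finsetSum _ fun c _ => hmono n b c]
      refine Finset.sum_congr rfl fun b _ => ?_
      rw [integral_finsetSum _ fun c _ => hmono n b c]
    rw [e]
    rw [← Real.norm_eq_abs]
    refine norm_integral_le_of_norm_le (integrable_finsetSum _ fun b _ =>
      integrable_finsetSum _ fun c _ => hmono n b c) (Filter.Eventually.of_forall fun x => ?_)
    rw [hfF, hgG, map_sub, map_sub]
    simp only [Pi.sub_apply, Fintype.sum_bool, Real.norm_eq_abs, abs_mul]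
    generalize act (del (stencil k i) * avg k ^ n) (F true) x = a
    generalize act (del (stencil k i) * avg k ^ n) (F false) x = b
    generalize act (del (stencil k i) * avg k ^ n) (G true) x = c
    generalize act (del (stencil k i) * avg k ^ n) (G false) x = d
    have h1 : |a - b| ≤ |a| + |b| := abs_sub a b
    have h2 : |c - d| ≤ |c| + |d| := abs_sub c d
    calc |a - b| * |c - d| ≤ (|a| + |b|) * (|c| + |d|) := by gcongr
      _ = _ := by ring
  calc _ ≤ ∑ n ∈ Finset.range N, ∑ b, ∑ c, ∫ x, |act (del (stencil k i) * avg k ^ n) (F b) x|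
        * |act (del (stencil k i) * avg k ^ n) (G c) x| :=
        (Finset.abs_sum_le_sum_abs _ _).trans (Finset.sum_le_sum fun n _ => h1 n)
    _ = ∑ b, ∑ c, ∑ n ∈ Finset.range N, ∫ x, |act (del (stencil k i) * avg k ^ n) (F b) x|
        * |act (del (stencil k i) * avg k ^ n) (G c) x| := by
      rw [Finset.sum_comm]
      refine Finset.sum_congr rfl fun b _ => ?_
      rw [Finset.sum_comm]
    _ ≤ ∑ b : Bool, ∑ c : Bool, 16 * K * ((∫ x, |f x| ^ p) + ∫ x, |g x| ^ q) := by
      refine Finset.sum_le_sum fun b _ => Finset.sum_le_sum fun c _ => ?_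
      refine (hB.sum_integral_le hp hq (hF0 b) (hG0 c) (hFp b) (hGq c) k i N).trans ?_
      exact mul_le_mul_of_nonneg_left (add_le_add (hFi b) (hGi c)) (by positivity)
    _ = _ := by simp only [Fintype.sum_bool]; ring

end Bilinear

/-! ### Difference quotients in `L²` -/

section DifferenceQuotients

open Filter Topology

/-- The derivative of `φ` in the direction `e`. -/
noncomputable def pd (e : Plane) (φ : Plane → ℝ) (x : Plane) : ℝ := fderiv ℝ φ x e

lemma two_le_infty : (2 : WithTop ℕ∞) ≤ ((⊤ : ℕ∞) : WithTop ℕ∞) := by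
  exact WithTop.coe_le_coe.2 (le_top : (2 : ℕ∞) ≤ ⊤)

lemma contDiff_pd {φ : Plane → ℝ} (hφ : ContDiff ℝ ∞ φ) (e : Plane) : ContDiff ℝ ∞ (pd e φ) :=
  (hφ.fderiv_right (m := ∞) (by simp)).clm_apply contDiff_const

lemma pd_smul_left (c : ℝ) (e : Plane) (φ : Plane → ℝ) : pd (c • e) φ = c • pd e φ := by
  ext x; simp [pd]

lemma pd_add_left (e e' : Plane) (φ : Plane → ℝ) : pd (e + e') φ = pd e φ + pd e' φ := by
  ext x; simp [pd]

lemma pd_neg_left (e : Plane) (φ : Plane → ℝ) : pd (-e) φ = -pd e φ := by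
  ext x; simp [pd]

lemma pd_sub_left (e e' : Plane) (φ : Plane → ℝ) : pd (e - e') φ = pd e φ - pd e' φ := by
  ext x; simp [pd]

lemma pd_add {φ ψ : Plane → ℝ} (hφ : ContDiff ℝ ∞ φ) (hψ : ContDiff ℝ ∞ ψ) (e : Plane) :
    pd e (φ + ψ) = pd e φ + pd e ψ := by
  ext x
  simp [pd, fderiv_add (hφ.differentiable (by simp) x) (hψ.differentiable (by simp) x)]

lemma pd_sub {φ ψ : Plane → ℝ} (hφ : ContDiff ℝ ∞ φ) (hψ : ContDiff ℝ ∞ ψ) (e : Plane) :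
    pd e (φ - ψ) = pd e φ - pd e ψ := by
  ext x
  simp [pd, fderiv_sub (hφ.differentiable (by simp) x) (hψ.differentiable (by simp) x)]

lemma pd_smul {φ : Plane → ℝ} (hφ : ContDiff ℝ ∞ φ) (c : ℝ) (e : Plane) :
    pd e (c • φ) = c • pd e φ := by
  ext x
  simp [pd, fderiv_const_smul (hφ.differentiable (by simp) x)]

lemma pd_neg (φ : Plane → ℝ) (e : Plane) : pd e (-φ) = -pd e φ := by
  ext x
  rw [pd, fderiv_neg]; rfl

lemma pd_comm {φ : Plane → ℝ} (hφ : ContDiff ℝ ∞ φ) (y z : Plane) :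
    pd y (pd z φ) = pd z (pd y φ) := by
  have h1 : ∀ y z x, pd y (pd z φ) x = fderiv ℝ (fderiv ℝ φ) x y z := by
    intro y z x
    have hd : DifferentiableAt ℝ (fderiv ℝ φ) x :=
      (hφ.fderiv_right (m := ∞) (by simp)).differentiable (by simp) x
    have : pd z φ = fun x => (fderiv ℝ φ x) z := rfl
    rw [pd, this, fderiv_clm_apply hd (differentiableAt_const z)]
    simp
  ext x
  rw [h1, h1]
  exact (hφ.contDiffAt.isSymmSndFDerivAt (by simp [two_le_infty])).eq y z

lemma act_sub_one (y : Plane) (f : Plane → ℝ) (x : Plane) :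
    act (tau y - 1) f x = f (x + y) - f x := by
  rw [act_sub, act_one, Pi.sub_apply, act_tau]

lemma contDiff_act {φ : Plane → ℝ} (hφ : ContDiff ℝ ∞ φ) (r : TransAlg) :
    ContDiff ℝ ∞ (act r φ) := by
  induction r using transAlg_induction with
  | htau y =>
    have : act (tau y) φ = fun x => φ (x + y) := by ext x; exact act_tau y φ x
    rw [this]; exact hφ.comp (contDiff_id.add contDiff_const)
  | hadd r s hr hs => rw [act_add]; exact hr.add hs
  | hsmul c r hr => rw [act_smul]; exact contDiff_const.smul hr

lemma pd_act {φ : Plane → ℝ} (hφ : ContDiff ℝ ∞ φ) (r : TransAlg) (e : Plane) :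
    pd e (act r φ) = act r (pd e φ) := by
  induction r using transAlg_induction with
  | htau y =>
    have : act (tau y) φ = fun x => φ (x + y) := by ext x; exact act_tau y φ x
    ext x
    rw [act_tau, this, pd, pd, fderiv_comp_add_right]
  | hadd r s hr hs =>
    rw [act_add, act_add, ← hr, ← hs, pd_add (contDiff_act hφ r) (contDiff_act hφ s)]
  | hsmul c r hr => rw [act_smul, act_smul, ← hr, pd_smul (contDiff_act hφ r)]

lemma eLpNorm_two_sq (f : Plane → ℝ) :
    eLpNorm f 2 volume ^ 2 = ∫⁻ x, ‖f x‖ₑ ^ 2 := by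
  rw [eLpNorm_eq_lintegral_rpow_enorm_toReal two_ne_zero ENNReal.ofNat_ne_top]
  simp only [ENNReal.toReal_ofNat, ENNReal.rpow_ofNat]
  rw [← ENNReal.rpow_ofNat, ← ENNReal.rpow_mul]
  simp

/-- Minkowski's inequality for an average of `L²` functions. -/
lemma eLpNorm_integral_le {H : ℝ → Plane → ℝ} (hH : Continuous (fun z : ℝ × Plane => H z.1 z.2))
    {C : ℝ≥0∞} (hC : ∀ s ∈ Icc (0 : ℝ) 1, eLpNorm (H s) 2 volume ≤ C) :
    eLpNorm (fun x => ∫ s in (0 : ℝ)..1, H s x) 2 volume ≤ C := by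
  set ν : Measure ℝ := volume.restrict (Ioc 0 1) with hν
  have : IsProbabilityMeasure ν := ⟨by simp [hν]⟩
  have h1 : ∀ x, ‖∫ s in (0 : ℝ)..1, H s x‖ₑ ^ 2 ≤ ∫⁻ s, ‖H s x‖ₑ ^ 2 ∂ν := by
    intro x
    have hm : AEStronglyMeasurable (fun s => H s x) ν :=
      (hH.comp (f := fun s : ℝ => (s, x)) (by fun_prop)).aestronglyMeasurable
    rw [intervalIntegral.integral_of_le zero_le_one]
    have a := enorm_integral_le_lintegral_enorm (μ := ν) (fun s => H s x)
    have b := eLpNorm_le_eLpNorm_of_exponent_le (μ := ν) (p := 1) (q := 2) (by norm_num) hm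
    rw [eLpNorm_one_eq_lintegral_enorm] at b
    have c := pow_le_pow_left' (a.trans b) 2
    refine c.trans (le_of_eq ?_)
    rw [eLpNorm_eq_lintegral_rpow_enorm_toReal two_ne_zero ENNReal.ofNat_ne_top]
    simp only [ENNReal.toReal_ofNat, ENNReal.rpow_ofNat]
    rw [← ENNReal.rpow_ofNat, ← ENNReal.rpow_mul]
    simp
  have h2 : eLpNorm (fun x => ∫ s in (0 : ℝ)..1, H s x) 2 volume ^ 2 ≤ C ^ 2 := by
    rw [eLpNorm_two_sq]
    calc _ ≤ ∫⁻ x, ∫⁻ s, ‖H s x‖ₑ ^ 2 ∂ν := lintegral_mono h1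
      _ = ∫⁻ s, (∫⁻ x, ‖H s x‖ₑ ^ 2) ∂ν := by
        refine lintegral_lintegral_swap ?_
        have : Continuous (fun z : Plane × ℝ => H z.2 z.1) := hH.comp continuous_swap
        exact (this.measurable.enorm.pow_const 2).aemeasurable
      _ ≤ ∫⁻ s, C ^ 2 ∂ν := by
        refine lintegral_mono_ae ?_
        filter_upwards [ae_restrict_mem measurableSet_Ioc] with s hs
        rw [← eLpNorm_two_sq]
        exact pow_le_pow_left' (hC s ⟨hs.1.le, hs.2⟩) 2
      _ = C ^ 2 := by simp
  exact (ENNReal.pow_le_pow_left_iff two_ne_zero).1 h2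

lemma sub_eq_integral_pd {φ : Plane → ℝ} (hφ : ContDiff ℝ ∞ φ) (x y : Plane) :
    φ (x + y) - φ x = ∫ s in (0 : ℝ)..1, pd y φ (x + s • y) := by
  have hd : ∀ s : ℝ, HasDerivAt (fun s : ℝ => φ (x + s • y)) (pd y φ (x + s • y)) s := by
    intro s
    have h1 : HasDerivAt (fun s : ℝ => x + s • y) y s := by
      simpa using ((hasDerivAt_id s).smul_const y).const_add x
    exact ((hφ.differentiable (by simp) (x + s • y)).hasFDerivAt).comp_hasDerivAt s h1
  have hc : Continuous fun s : ℝ => pd y φ (x + s • y) :=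
    (contDiff_pd hφ y).continuous.comp (by fun_prop)
  rw [intervalIntegral.integral_eq_sub_of_hasDerivAt (fun s _ => hd s)
    (hc.intervalIntegrable 0 1)]
  simp

lemma eLpNorm_act_sub_one_le {φ : Plane → ℝ} (hφ : ContDiff ℝ ∞ φ) (y : Plane) :
    eLpNorm (act (tau y - 1) φ) 2 volume ≤ eLpNorm (pd y φ) 2 volume := by
  have e : act (tau y - 1) φ = fun x => ∫ s in (0 : ℝ)..1, pd y φ (x + s • y) := by
    ext x; rw [act_sub_one, sub_eq_integral_pd hφ]
  have hc := (contDiff_pd hφ y).continuous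
  rw [e]
  refine eLpNorm_integral_le (H := fun s x => pd y φ (x + s • y))
    (hc.comp (by fun_prop)) fun s _ => le_of_eq ?_
  exact eLpNorm_comp_measurePreserving (g := pd y φ) hc.aestronglyMeasurable
    (measurePreserving_add_right volume (s • y))

lemma eLpNorm_act_sub_one_sub_le {φ : Plane → ℝ} (hφ : ContDiff ℝ ∞ φ) (y : Plane) :
    eLpNorm (act (tau y - 1) φ - pd y φ) 2 volume ≤ eLpNorm (pd y (pd y φ)) 2 volume := by
  have hc := (contDiff_pd hφ y).continuous
  have e : act (tau y - 1) φ - pd y φ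
      = fun x => ∫ s in (0 : ℝ)..1, (pd y φ (x + s • y) - pd y φ x) := by
    ext x
    have : Continuous fun s : ℝ => pd y φ (x + s • y) := hc.comp (by fun_prop)
    rw [Pi.sub_apply, act_sub_one, sub_eq_integral_pd hφ, intervalIntegral.integral_sub
      (this.intervalIntegrable _ _) intervalIntegrable_const]
    simp
  rw [e]
  refine eLpNorm_integral_le (H := fun s x => pd y φ (x + s • y) - pd y φ x)
    ((hc.comp (by fun_prop)).sub (hc.comp continuous_snd)) fun s hs => ?_
  have e2 : (fun x => pd y φ (x + s • y) - pd y φ x) = act (tau (s • y) - 1) (pd y φ) := by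
    ext x; rw [act_sub_one]
  rw [e2]
  refine (eLpNorm_act_sub_one_le (contDiff_pd hφ y) _).trans ?_
  rw [pd_smul_left, eLpNorm_const_smul]
  have : ‖s‖ₑ ≤ 1 := by
    rw [Real.enorm_eq_ofReal hs.1]; simpa using hs.2
  exact mul_le_of_le_one_left' this

/-! Sobolev functions -/

lemma InAllSobolev.memLp {φ : Plane → ℝ} (h : InAllSobolev φ) : MemLp φ 2 volume := by
  have := h.2 0
  refine this.of_le h.1.continuous.aestronglyMeasurable (Eventually.of_forall fun x => ?_)
  rw [norm_iteratedFDeriv_zero]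

lemma InAllSobolev.pd {φ : Plane → ℝ} (h : InAllSobolev φ) (e : Plane) :
    InAllSobolev (pd e φ) := by
  have hs := contDiff_pd h.1 e
  refine ⟨hs, fun k => ?_⟩
  refine ((h.2 (k + 1)).const_smul ‖e‖).of_le
    (hs.continuous_iteratedFDeriv (m := k) (by exact_mod_cast le_top)).aestronglyMeasurable
    (Eventually.of_forall fun x => ?_)
  have h1 : ContDiffAt ℝ k (fderiv ℝ φ) x :=
    (h.1.fderiv_right (m := k) (by exact_mod_cast le_top)).contDiffAt
  have := norm_iteratedFDeriv_clm_apply_const (c := e) h1 le_rfl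
  rw [norm_iteratedFDeriv_fderiv] at this
  rw [Pi.smul_apply, norm_smul, norm_norm]
  exact this

lemma InAllSobolev.add {φ ψ : Plane → ℝ} (h : InAllSobolev φ) (h' : InAllSobolev ψ) :
    InAllSobolev (φ + ψ) := by
  refine ⟨h.1.add h'.1, fun k => ?_⟩
  have : iteratedFDeriv ℝ k (φ + ψ) = iteratedFDeriv ℝ k φ + iteratedFDeriv ℝ k ψ :=
    iteratedFDeriv_add (h.1.of_le (by exact_mod_cast le_top)) (h'.1.of_le (by exact_mod_cast le_top))
  rw [this]
  exact (h.2 k).add (h'.2 k)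

lemma InAllSobolev.smul {φ : Plane → ℝ} (h : InAllSobolev φ) (c : ℝ) :
    InAllSobolev (c • φ) := by
  refine ⟨contDiff_const.smul h.1, fun k => ?_⟩
  have : iteratedFDeriv ℝ k (c • φ) = c • iteratedFDeriv ℝ k φ :=
    funext fun x => iteratedFDeriv_const_smul_apply
      (h.1.of_le (by exact_mod_cast le_top)).contDiffAt
  rw [this]
  exact (h.2 k).const_smul c

/-- Convergence in `L²` as the step tends to `0`. -/
structure TendstoL2 (F : ℝ → Plane → ℝ) (f : Plane → ℝ) : Prop where
  memLp : ∀ k, MemLp (F k) 2 volume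
  memLp_lim : MemLp f 2 volume
  tendsto : Tendsto (fun k => eLpNorm (F k - f) 2 volume) (𝓝[>] 0) (𝓝 0)

lemma TendstoL2.add {F G : ℝ → Plane → ℝ} {f g : Plane → ℝ} (h : TendstoL2 F f)
    (h' : TendstoL2 G g) : TendstoL2 (fun k => F k + G k) (f + g) := by
  refine ⟨fun k => (h.memLp k).add (h'.memLp k), h.memLp_lim.add h'.memLp_lim, ?_⟩
  refine tendsto_of_tendsto_of_tendsto_of_le_of_le tendsto_const_nhds
    (by simpa using h.tendsto.add h'.tendsto) (fun _ => zero_le) fun k => ?_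
  have : F k + G k - (f + g) = (F k - f) + (G k - g) := by ring
  simp only [this]
  exact eLpNorm_add_le ((h.memLp k).sub h.memLp_lim).1 ((h'.memLp k).sub h'.memLp_lim).1
    one_le_two

lemma TendstoL2.smul {F : ℝ → Plane → ℝ} {f : Plane → ℝ} (h : TendstoL2 F f) (c : ℝ) :
    TendstoL2 (fun k => c • F k) (c • f) := by
  refine ⟨fun k => (h.memLp k).const_smul c, h.memLp_lim.const_smul c, ?_⟩
  simp only [← smul_sub, eLpNorm_const_smul]
  have := ENNReal.Tendsto.const_mul h.tendsto (a := ‖c‖ₑ) (Or.inr enorm_ne_top)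
  rwa [mul_zero] at this

lemma TendstoL2.neg {F : ℝ → Plane → ℝ} {f : Plane → ℝ} (h : TendstoL2 F f) :
    TendstoL2 (fun k => -F k) (-f) := by simpa using h.smul (-1)

lemma TendstoL2.sub {F G : ℝ → Plane → ℝ} {f g : Plane → ℝ} (h : TendstoL2 F f)
    (h' : TendstoL2 G g) : TendstoL2 (fun k => F k - G k) (f - g) := by
  simpa [sub_eq_add_neg] using h.add h'.neg

lemma TendstoL2.act_tau {F : ℝ → Plane → ℝ} (h : TendstoL2 F 0) (y : ℝ → Plane) :
    TendstoL2 (fun k => act (tau (y k)) (F k)) 0 := by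
  refine ⟨fun k => memLp_act (h.memLp k) _, h.memLp_lim, ?_⟩
  have := h.tendsto
  simp only [sub_zero] at this ⊢
  simpa only [eLpNorm_act_tau (h.memLp _).1] using this

lemma TendstoL2.act_avg {F : ℝ → Plane → ℝ} (h : TendstoL2 F 0) :
    TendstoL2 (fun k => act (avg k) (F k)) 0 := by
  have h1 := fun i : Fin 4 => (h.act_tau (fun k => stencil k i)).add
    (h.act_tau (fun k => -stencil k i))
  have := ((((h1 0).add (h1 1)).add (h1 2)).add (h1 3)).smul (1 / 8)
  simpa only [avg, act_smul, Fin.sum_univ_four, act_add, add_zero, smul_zero] using this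

lemma TendstoL2.of_le {F : ℝ → Plane → ℝ} {f : Plane → ℝ} (hF : ∀ k, MemLp (F k) 2 volume)
    (hf : MemLp f 2 volume) {C : ℝ≥0∞} (hC : C ≠ ⊤)
    (h : ∀ k : ℝ, 0 < k → eLpNorm (F k - f) 2 volume ≤ ENNReal.ofReal k * C) :
    TendstoL2 F f := by
  refine ⟨hF, hf, ?_⟩
  have h0 : Tendsto (fun k : ℝ => ENNReal.ofReal k * C) (𝓝[>] 0) (𝓝 0) := by
    have h1 : Tendsto (fun k : ℝ => ENNReal.ofReal k) (𝓝[>] 0) (𝓝 0) := by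
      have := (ENNReal.continuous_ofReal.tendsto 0).mono_left
        (nhdsWithin_le_nhds (a := (0 : ℝ)) (s := Ioi 0))
      rwa [ENNReal.ofReal_zero] at this
    have := ENNReal.Tendsto.mul_const h1 (b := C) (Or.inr hC)
    rwa [zero_mul] at this
  refine tendsto_of_tendsto_of_tendsto_of_le_of_le' tendsto_const_nhds h0
    (Eventually.of_forall fun _ => zero_le) ?_
  filter_upwards [self_mem_nhdsWithin] with k hk using h k hk

lemma eLpNorm_quotient_le {π : Plane → ℝ} (hπ : ContDiff ℝ ∞ π) (y : Plane) {k : ℝ} (hk : 0 < k) :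
    eLpNorm (k⁻¹ • act (tau (k • y) - 1) π - pd y π) 2 volume
      ≤ ENNReal.ofReal k * eLpNorm (pd y (pd y π)) 2 volume := by
  have e : k⁻¹ • act (tau (k • y) - 1) π - pd y π
      = k⁻¹ • (act (tau (k • y) - 1) π - pd (k • y) π) := by
    rw [pd_smul_left, smul_sub, smul_smul, inv_mul_cancel₀ hk.ne', one_smul]
  rw [e, eLpNorm_const_smul]
  refine (mul_le_mul_right (eLpNorm_act_sub_one_sub_le hπ (k • y)) _).trans ?_
  rw [pd_smul_left, pd_smul_left, pd_smul (contDiff_pd hπ y), smul_smul, eLpNorm_const_smul,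
    ← mul_assoc, ← enorm_mul]
  have : k⁻¹ * (k * k) = k := by field_simp
  rw [this, Real.enorm_eq_ofReal hk.le]

lemma memLp_act_sub_one {π : Plane → ℝ} (hπ : ContDiff ℝ ∞ π) (y : Plane)
    (h : MemLp (pd y π) 2 volume) : MemLp (act (tau y - 1) π) 2 volume :=
  ⟨(contDiff_act hπ _).continuous.aestronglyMeasurable,
    (eLpNorm_act_sub_one_le hπ y).trans_lt h.2⟩

lemma tendstoL2_quotient {π : Plane → ℝ} (hπ : ContDiff ℝ ∞ π) (y : Plane)
    (h : InAllSobolev (pd y π)) :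
    TendstoL2 (fun k => k⁻¹ • act (tau (k • y) - 1) π) (pd y π) := by
  refine TendstoL2.of_le (fun k => MemLp.const_smul ?_ _) h.memLp (h.pd y).memLp.2.ne
    fun k hk => eLpNorm_quotient_le hπ y hk
  refine memLp_act_sub_one hπ _ ?_
  rw [pd_smul_left]; exact h.memLp.const_smul k

lemma tendstoL2_quotient_two {φ : Plane → ℝ} (h : InAllSobolev φ) (y z : Plane) :
    TendstoL2 (fun k => (k ^ 2)⁻¹ • act ((tau (k • y) - 1) * (tau (k • z) - 1)) φ)
      (pd y (pd z φ)) := by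
  refine TendstoL2.of_le (C := eLpNorm (pd z (pd z (pd y φ))) 2 volume
    + eLpNorm (pd y (pd y (pd z φ))) 2 volume) (fun k => (memLp_act h.memLp _).const_smul _)
    ((h.pd z).pd y).memLp
    (ENNReal.add_ne_top.2 ⟨(((h.pd y).pd z).pd z).memLp.2.ne, (((h.pd z).pd y).pd y).memLp.2.ne⟩)
    fun k hk => ?_
  set ψ := k⁻¹ • act (tau (k • z) - 1) φ - pd z φ with hψ
  have hψs : ContDiff ℝ ∞ ψ := (contDiff_const.smul (contDiff_act h.1 _)).sub (contDiff_pd h.1 z)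
  have e : (k ^ 2)⁻¹ • act ((tau (k • y) - 1) * (tau (k • z) - 1)) φ - pd y (pd z φ)
      = k⁻¹ • act (tau (k • y) - 1) ψ
        + (k⁻¹ • act (tau (k • y) - 1) (pd z φ) - pd y (pd z φ)) := by
    rw [hψ, map_sub, map_smul, ← act_mul, smul_sub, smul_smul, pow_two, mul_inv]
    abel
  rw [e, mul_add]
  refine (eLpNorm_add_le ((contDiff_act hψs _).continuous.const_smul _).aestronglyMeasurable
    (((contDiff_act (contDiff_pd h.1 z) _).continuous.const_smul _).sub
      (contDiff_pd (contDiff_pd h.1 z) y).continuous).aestronglyMeasurable one_le_two).trans ?_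
  refine add_le_add ?_ (eLpNorm_quotient_le (contDiff_pd h.1 z) y hk)
  rw [eLpNorm_const_smul]
  refine (mul_le_mul_right (eLpNorm_act_sub_one_le hψs (k • y)) _).trans ?_
  rw [pd_smul_left, eLpNorm_const_smul, ← mul_assoc, ← enorm_mul, inv_mul_cancel₀ hk.ne', enorm_one,
    one_mul]
  have e2 : pd y ψ = k⁻¹ • act (tau (k • z) - 1) (pd y φ) - pd z (pd y φ) := by
    have hs : ContDiff ℝ ∞ (k⁻¹ • act (tau (k • z) - 1) φ) :=
      contDiff_const.smul (contDiff_act h.1 _)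
    rw [hψ, pd_sub hs (contDiff_pd h.1 z),
      pd_smul (contDiff_act h.1 _), pd_act h.1, pd_comm h.1]
  rw [e2]
  exact eLpNorm_quotient_le (contDiff_pd h.1 y) z hk

/-- The central difference of step `2k` in the `i`-th coordinate. -/
noncomputable def delta (k : ℝ) (i : Fin 2) : TransAlg := del ((2 * k) • ee i)

lemma delta_eq (k : ℝ) (i : Fin 2) :
    delta k i = (tau (k • ((2 : ℝ) • ee i)) - 1) - (tau (k • (-(2 : ℝ) • ee i)) - 1) := by
  rw [delta, del, smul_smul, smul_smul, mul_comm k 2, ← neg_smul, mul_neg, mul_comm k 2]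
  abel

lemma tendstoL2_delta {π : Plane → ℝ} (hπ : ContDiff ℝ ∞ π) (i : Fin 2)
    (h : InAllSobolev (pd (ee i) π)) :
    TendstoL2 (fun k => k⁻¹ • act (delta k i) π) ((4 : ℝ) • pd (ee i) π) := by
  have h1 := tendstoL2_quotient hπ ((2 : ℝ) • ee i) (by rw [pd_smul_left]; exact h.smul 2)
  have h2 := tendstoL2_quotient hπ (-(2 : ℝ) • ee i) (by rw [pd_smul_left]; exact h.smul (-2))
  have := h1.sub h2
  simp only [← smul_sub, ← act_sub, ← delta_eq] at this
  convert this using 1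
  rw [pd_smul_left, pd_smul_left, ← sub_smul]; norm_num

lemma tendstoL2_delta_mul_delta {φ : Plane → ℝ} (h : InAllSobolev φ) (i j : Fin 2) :
    TendstoL2 (fun k => (k ^ 2)⁻¹ • act (delta k i * delta k j) φ)
      ((16 : ℝ) • pd (ee i) (pd (ee j) φ)) := by
  have h1 := fun a b : ℝ => tendstoL2_quotient_two h (a • ee i) (b • ee j)
  have := ((h1 2 2).sub (h1 2 (-2))).sub ((h1 (-2) 2).sub (h1 (-2) (-2)))
  simp only [← smul_sub, ← act_sub, ← mul_sub, ← sub_mul, ← delta_eq] at this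
  convert this using 1
  simp only [pd_smul_left, pd_smul (contDiff_pd h.1 _), smul_smul, ← sub_smul]
  norm_num

/-- The Laplacian, in coordinates. -/
noncomputable def lap (φ : Plane → ℝ) : Plane → ℝ :=
  pd (ee 0) (pd (ee 0) φ) + pd (ee 1) (pd (ee 1) φ)

lemma InAllSobolev.lap {φ : Plane → ℝ} (h : InAllSobolev φ) : InAllSobolev (lap φ) :=
  ((h.pd _).pd _).add ((h.pd _).pd _)

lemma one_sub_avg (k : ℝ) :
    1 - avg k = (1 / 8 : ℝ) • ∑ i, (tau (stencil k i) - 1) * (tau (-stencil k i) - 1) := by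
  have h : ∀ i, (tau (stencil k i) - 1) * (tau (-stencil k i) - 1)
      = 2 - (tau (stencil k i) + tau (-stencil k i)) := fun i => by
    linear_combination tau_mul_neg (stencil k i)
  simp only [h, Finset.sum_sub_distrib, smul_sub, avg]
  congr 1
  simp only [Finset.sum_const, Finset.card_univ, Fintype.card_fin]
  rw [show (4 • (2 : TransAlg)) = (8 : ℝ) • (1 : TransAlg) by
    rw [← Nat.cast_smul_eq_nsmul ℝ, show (2 : TransAlg) = (2 : ℝ) • (1 : TransAlg) by
      rw [two_smul]; norm_num, smul_smul]; norm_num]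
  rw [smul_smul]; norm_num

lemma stencil_eq_smul (k : ℝ) (i : Fin 4) : stencil k i = k • stencil 1 i := by
  fin_cases i <;> simp [stencil, smul_smul, smul_sub, mul_comm]

lemma tendstoL2_one_sub_avg {φ : Plane → ℝ} (h : InAllSobolev φ) :
    TendstoL2 (fun k => (k ^ 2)⁻¹ • act (1 - avg k) φ) (-(3 / 4 : ℝ) • lap φ) := by
  have h1 := fun i : Fin 4 => tendstoL2_quotient_two h (stencil 1 i) (-stencil 1 i)
  have := ((((h1 0).add (h1 1)).add (h1 2)).add (h1 3)).smul (1 / 8)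
  simp only [← smul_add, ← act_add, smul_neg, ← stencil_eq_smul] at this
  convert this using 1
  · ext k
    rw [one_sub_avg, Fin.sum_univ_four, act_smul, smul_comm]
  · have hc : ∀ y z, ContDiff ℝ ∞ (pd y (pd z φ)) := fun y z => contDiff_pd (contDiff_pd h.1 z) y
    ext x
    simp only [lap, stencil, Matrix.cons_val_zero, Matrix.cons_val_one, Matrix.cons_val, mul_one,
      one_smul, pd_neg_left, pd_neg, pd_smul_left, pd_smul (contDiff_pd h.1 _), pd_add_left,
      pd_sub_left, pd_add (contDiff_pd h.1 _) (contDiff_pd h.1 _),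
      pd_sub (contDiff_pd h.1 _) (contDiff_pd h.1 _), Pi.add_apply, Pi.smul_apply, Pi.neg_apply,
      Pi.sub_apply, smul_eq_mul]
    ring

lemma tendstoL2_one_sub_avg_sq {φ : Plane → ℝ} (h : InAllSobolev φ) :
    TendstoL2 (fun k => (k ^ 2)⁻¹ • act (1 - avg k * avg k) φ) (-(3 / 2 : ℝ) • lap φ) := by
  have h1 := tendstoL2_one_sub_avg h
  have hL : InAllSobolev (-(3 / 4 : ℝ) • lap φ) := h.lap.smul _
  have hz : TendstoL2 (fun k => (k ^ 2)⁻¹ • act (1 - avg k) φ - (-(3 / 4 : ℝ) • lap φ)) 0 := by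
    refine ⟨fun k => (h1.memLp k).sub h1.memLp_lim, MemLp.zero, ?_⟩
    simpa using h1.tendsto
  have h2 := hz.sub hz.act_avg
  have h3 : TendstoL2 (fun k => act (1 - avg k) (-(3 / 4 : ℝ) • lap φ)) 0 := by
    have h4 := tendstoL2_one_sub_avg hL
    refine ⟨fun k => memLp_act hL.memLp _, MemLp.zero, ?_⟩
    simp only [sub_zero]
    set L := -(3 / 4 : ℝ) • lap (-(3 / 4 : ℝ) • lap φ)
    have hk2 : Tendsto (fun k : ℝ => ‖k ^ 2‖ₑ) (𝓝[>] 0) (𝓝 0) := by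
      have : Continuous fun k : ℝ => ‖k ^ 2‖ₑ := by fun_prop
      simpa using (this.tendsto 0).mono_left (nhdsWithin_le_nhds (a := (0 : ℝ)) (s := Ioi 0))
    have hb : Tendsto (fun k : ℝ => ‖k ^ 2‖ₑ * (eLpNorm ((k ^ 2)⁻¹ • act (1 - avg k)
        (-(3 / 4 : ℝ) • lap φ) - L) 2 volume + eLpNorm L 2 volume)) (𝓝[>] 0) (𝓝 0) := by
      have := ENNReal.Tendsto.mul hk2 (Or.inr (by simpa using h4.memLp_lim.2.ne))
        (h4.tendsto.add_const (eLpNorm L 2 volume)) (Or.inr (by simp))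
      simpa using this
    refine tendsto_of_tendsto_of_tendsto_of_le_of_le' tendsto_const_nhds hb
      (Eventually.of_forall fun _ => zero_le) ?_
    filter_upwards [self_mem_nhdsWithin] with k hk
    have hk : (k : ℝ) ^ 2 ≠ 0 := pow_ne_zero 2 (ne_of_gt hk)
    have e : act (1 - avg k) (-(3 / 4 : ℝ) • lap φ) = (k ^ 2) • (((k ^ 2)⁻¹ • act (1 - avg k)
        (-(3 / 4 : ℝ) • lap φ) - L) + L) := by
      rw [sub_add_cancel, smul_smul, mul_inv_cancel₀ hk, one_smul]
    conv_lhs => rw [e, eLpNorm_const_smul]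
    gcongr
    exact eLpNorm_add_le ((h4.memLp k).sub h4.memLp_lim).1 h4.memLp_lim.1 one_le_two
  have h5 := (h1.smul 2).sub (h2.add h3)
  convert h5 using 1
  · ext1 k
    have : 1 - avg k * avg k = (2 : ℝ) • (1 - avg k) - (1 - avg k) * (1 - avg k) := by
      rw [two_smul]; ring
    have h6 : ∀ w, w - act (avg k) w = act (1 - avg k) w := fun w => by rw [act_sub, act_one]
    rw [h6, this, act_sub, act_smul, act_mul, map_sub (act (1 - avg k)), map_smul (act (1 - avg k)),
      sub_add_cancel, smul_sub, smul_comm]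
  · rw [sub_zero, add_zero, sub_zero, smul_smul]; norm_num

end DifferenceQuotients

/-! ### Singular integrals as limits of sums of averaged differences -/

section SingularIntegrals

open Filter Topology

lemma abs_integral_mul_le {f g : Plane → ℝ} (hf : MemLp f 2 volume) (hg : MemLp g 2 volume) :
    |∫ x, f x * g x| ≤ (eLpNorm f 2 volume).toReal * (eLpNorm g 2 volume).toReal := by
  have h1 : ‖∫ x, f x * g x‖ₑ ≤ eLpNorm f 2 volume * eLpNorm g 2 volume := by
    refine (enorm_integral_le_lintegral_enorm _).trans ?_
    rw [← eLpNorm_one_eq_lintegral_enorm]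
    have := eLpNorm_smul_le_mul_eLpNorm (p := 2) (q := 2) (r := 1) hg.1 hf.1
    exact this
  rw [← ENNReal.toReal_mul, ← Real.norm_eq_abs, ← toReal_enorm]
  exact ENNReal.toReal_mono (ENNReal.mul_ne_top hf.2.ne hg.2.ne) h1

lemma integral_abs_rpow_two {f : Plane → ℝ} (hf : MemLp f 2 volume) :
    ∫ x, |f x| ^ (2 : ℝ) = (eLpNorm f 2 volume).toReal ^ 2 := by
  have h1 : ∫ x, |f x| ^ (2 : ℝ) = ∫ x, f x ^ 2 := by simp
  rw [h1, ← ENNReal.toReal_pow, eLpNorm_two_sq, integral_eq_lintegral_of_nonneg_ae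
    (Eventually.of_forall fun x => sq_nonneg _) hf.integrable_sq.1]
  congr 1
  refine lintegral_congr fun x => ?_
  rw [← sq_abs, ENNReal.ofReal_pow (abs_nonneg _), ← Real.norm_eq_abs, ofReal_norm]

lemma TendstoL2.tendsto_integral {F : ℝ → Plane → ℝ} {f g : Plane → ℝ} (h : TendstoL2 F f)
    (hg : MemLp g 2 volume) :
    Tendsto (fun k => ∫ x, F k x * g x) (𝓝[>] 0) (𝓝 (∫ x, f x * g x)) := by
  rw [tendsto_iff_norm_sub_tendsto_zero]
  have h0 : Tendsto (fun k => (eLpNorm (F k - f) 2 volume).toReal * (eLpNorm g 2 volume).toReal)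
      (𝓝[>] 0) (𝓝 0) := by
    have := ((ENNReal.tendsto_toReal ENNReal.zero_ne_top).comp h.tendsto).mul_const
      (eLpNorm g 2 volume).toReal
    simpa using this
  refine squeeze_zero (fun _ => norm_nonneg _) (fun k => ?_) h0
  rw [← integral_sub (integrable_mul_of_memLp_two (h.memLp k) hg)
    (integrable_mul_of_memLp_two h.memLp_lim hg)]
  simp only [← sub_mul]
  exact abs_integral_mul_le ((h.memLp k).sub h.memLp_lim) hg

/-- The partial sums of the Neumann series of `(1 - avg²)⁻¹`. -/
noncomputable def neumann (k : ℝ) (N : ℕ) : TransAlg := ∑ n ∈ Finset.range N, (avg k * avg k) ^ n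

lemma one_sub_mul_neumann (k : ℝ) (N : ℕ) :
    (1 - avg k * avg k) * neumann k N = 1 - (avg k * avg k) ^ N :=
  mul_neg_geom_sum _ _

lemma integral_act_neumann (k : ℝ) (N : ℕ) (i : Fin 4) {f g : Plane → ℝ} (hf : MemLp f 2 volume)
    (hg : MemLp g 2 volume) :
    ∫ x, act (neumann k N * (del (stencil k i) * del (stencil k i))) f x * g x
      = -∑ n ∈ Finset.range N, ∫ x, act (del (stencil k i) * avg k ^ n) f x
        * act (del (stencil k i) * avg k ^ n) g x := by
  have h1 : ∀ n, ∫ x, act (del (stencil k i) * avg k ^ n) f x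
      * act (del (stencil k i) * avg k ^ n) g x
      = -∫ x, act ((avg k * avg k) ^ n * (del (stencil k i) * del (stencil k i))) f x * g x := by
    intro n
    have hadj := (isAdj_del (stencil k i)).neg.mul ((isAdj_avg k).pow n)
    rw [neg_neg] at hadj
    rw [← hadj _ _ (memLp_act hf _) hg, ← act_mul, ← integral_neg]
    have : -del (stencil k i) * avg k ^ n * (del (stencil k i) * avg k ^ n)
        = (-1 : ℝ) • ((avg k * avg k) ^ n * (del (stencil k i) * del (stencil k i))) := by
      rw [neg_one_smul, mul_pow]; ring
    rw [this, act_smul]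
    simp
  simp only [h1, Finset.sum_neg_distrib, neg_neg]
  rw [neumann, Finset.sum_mul, map_sum]
  simp only [LinearMap.sum_apply, Finset.sum_apply, Finset.sum_mul]
  exact integral_finsetSum _ fun n _ => integrable_mul_of_memLp_two (memLp_act hf _) hg

lemma exists_abs_integral_act_neumann_le {p q : ℝ} (hpq : p.HolderConjugate q) :
    ∃ K : ℝ, 0 ≤ K ∧ ∀ (k : ℝ) (N : ℕ) (i j : Fin 2) (f g : Plane → ℝ), MemLp f 2 volume →
      MemLp f (ENNReal.ofReal p) volume → MemLp g 2 volume → MemLp g (ENNReal.ofReal q) volume →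
      |∫ x, act (neumann k N * (delta k i * delta k j)) f x * g x|
        ≤ K * ((∫ x, |f x| ^ p) + ∫ x, |g x| ^ q) := by
  obtain ⟨K, hK, B, hB⟩ := exists_isBellman hpq
  refine ⟨128 * K, by positivity, fun k N i j f g hf hfp hg hgq => ?_⟩
  have hX : 0 ≤ (∫ x, |f x| ^ p) + ∫ x, |g x| ^ q :=
    add_nonneg (integral_nonneg fun x => by positivity) (integral_nonneg fun x => by positivity)
  have h1 : ∀ m : Fin 4,
      |∫ x, act (neumann k N * (del (stencil k m) * del (stencil k m))) f x * g x|
        ≤ 64 * K * ((∫ x, |f x| ^ p) + ∫ x, |g x| ^ q) := fun m => by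
    rw [integral_act_neumann k N m hf hg, abs_neg]
    exact hB.abs_sum_integral_le hK hpq.pos hpq.symm.pos hfp hgq k m N
  have h2 : |∫ x, act (neumann k N * (del (stencil k 0) * del (stencil k 1))) f x * g x|
        ≤ 128 * K * ((∫ x, |f x| ^ p) + ∫ x, |g x| ^ q) := by
    rw [del_stencil_mul_del_stencil, mul_sub, act_sub]
    simp only [Pi.sub_apply, sub_mul]
    rw [integral_sub (integrable_mul_of_memLp_two (memLp_act hf _) hg)
      (integrable_mul_of_memLp_two (memLp_act hf _) hg)]
    refine (abs_sub _ _).trans ((add_le_add (h1 2) (h1 3)).trans (le_of_eq ?_))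
    ring
  have h3 : 64 * K * ((∫ x, |f x| ^ p) + ∫ x, |g x| ^ q)
      ≤ 128 * K * ((∫ x, |f x| ^ p) + ∫ x, |g x| ^ q) := by gcongr; norm_num
  fin_cases i <;> fin_cases j
  · exact (h1 0).trans h3
  · exact h2
  · have : delta k 1 * delta k 0 = delta k 0 * delta k 1 := mul_comm _ _
    simp only [Fin.mk_one, Fin.zero_eta, this]
    exact h2
  · exact (h1 1).trans h3

lemma tendsto_eLpNorm_delta_avg (k : ℝ) (i : Fin 2) {f : Plane → ℝ} (hf : MemLp f 2 volume) :
    Tendsto (fun n => (eLpNorm (act (delta k i * avg k ^ n) f) 2 volume).toReal) atTop (𝓝 0) := by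
  obtain ⟨K, hK, B, hB⟩ := exists_isBellman (p := 2) (q := 2) (Real.HolderConjugate.two_two)
  obtain ⟨m, hm⟩ : ∃ m : Fin 4, delta k i = del (stencil k m) := by
    fin_cases i
    · exact ⟨0, rfl⟩
    · exact ⟨1, rfl⟩
  have hf' : MemLp f (ENNReal.ofReal 2) volume := by simpa using hf
  have h1 := fun N => (le_abs_self _).trans
    (hB.abs_sum_integral_le hK two_pos two_pos hf' hf' k m N)
  have h2 := (summable_of_sum_range_le (fun n => integral_nonneg fun x => mul_self_nonneg _)
    h1).tendsto_atTop_zero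
  have h3 : ∀ n, ∫ x, act (del (stencil k m) * avg k ^ n) f x * act (del (stencil k m) * avg k ^ n) f x
      = (eLpNorm (act (delta k i * avg k ^ n) f) 2 volume).toReal ^ 2 := fun n => by
    rw [hm, ← integral_abs_rpow_two (memLp_act hf _)]
    simp [pow_two]
  simp only [h3] at h2
  have := (Real.continuous_sqrt.tendsto 0).comp h2
  simpa [Function.comp_def, Real.sqrt_sq] using this

/-- The estimate of the singular integral of data that are exhibited, up to errors that are small in
`L²`, by discrete potentials. -/
lemma exists_abs_integral_le_of_approx {p q : ℝ} (hpq : p.HolderConjugate q) :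
    ∃ K : ℝ, 0 ≤ K ∧ ∀ (f : Fin 2 → Plane → ℝ) (w : Plane → ℝ) (i : Fin 2) (Ψ : ℝ → Plane → ℝ)
      (e : Fin 2 → ℝ → Plane → ℝ), (∀ l, MemLp (f l) 2 volume) →
      (∀ l, MemLp (f l) (ENNReal.ofReal p) volume) → (∀ k, MemLp (Ψ k) 2 volume) →
      (∀ l, TendstoL2 (e l) 0) →
      (∀ k, 0 < k → act (delta k 0) (f 0) + act (delta k 1) (f 1)
        = act (1 - avg k * avg k) (Ψ k) + (act (delta k 0) (e 0 k) + act (delta k 1) (e 1 k))) →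
      TendstoL2 (fun k => act (delta k i) (Ψ k)) w →
      ∀ g : Plane → ℝ, MemLp g 2 volume → MemLp g (ENNReal.ofReal q) volume →
        |∫ x, w x * g x| ≤ K * (((∫ x, |f 0 x| ^ p) + ∫ x, |f 1 x| ^ p) + ∫ x, |g x| ^ q) := by
  obtain ⟨K, hK, hKb⟩ := exists_abs_integral_act_neumann_le hpq
  obtain ⟨L, hL, hLb⟩ := exists_abs_integral_act_neumann_le Real.HolderConjugate.two_two
  refine ⟨2 * K, by positivity, fun f w i Ψ e hf hfp hΨ he heq hw g hg hgq => ?_⟩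
  have hnn : ∀ (h : Plane → ℝ) (s : ℝ), 0 ≤ ∫ x, |h x| ^ s := fun h s =>
    integral_nonneg fun x => by positivity
  set nr : (Plane → ℝ) → ℝ := fun h => (eLpNorm h 2 volume).toReal with hnr
  have hLb' : ∀ (t : ℝ), 0 < t → ∀ k N l (h : Plane → ℝ), MemLp h 2 volume →
      |∫ x, act (neumann k N * (delta k i * delta k l)) h x * g x|
        ≤ L * (t⁻¹ * nr h ^ 2 + t * nr g ^ 2) := by
    intro t ht k N l h hh
    have h2 : MemLp (t⁻¹ • h) 2 volume := hh.const_smul _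
    have h1 := hLb k N i l (t⁻¹ • h) g h2 (by simpa using h2) hg (by simpa using hg)
    rw [integral_abs_rpow_two h2, integral_abs_rpow_two hg, map_smul] at h1
    simp only [Pi.smul_apply, smul_eq_mul, mul_assoc] at h1
    rw [integral_const_mul, abs_mul, abs_of_pos (inv_pos.2 ht), eLpNorm_const_smul,
      ENNReal.toReal_mul, toReal_enorm, Real.norm_of_nonneg (inv_pos.2 ht).le] at h1
    have h3 := mul_le_mul_of_nonneg_left h1 ht.le
    rw [← mul_assoc, mul_inv_cancel₀ ht.ne', one_mul] at h3
    refine h3.trans (le_of_eq ?_)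
    simp only [hnr]
    field_simp
  have step : ∀ t : ℝ, 0 < t → ∀ k : ℝ, 0 < k → |∫ x, act (delta k i) (Ψ k) x * g x|
      ≤ 2 * K * (((∫ x, |f 0 x| ^ p) + ∫ x, |f 1 x| ^ p) + ∫ x, |g x| ^ q)
        + (L * (t⁻¹ * nr (e 0 k) ^ 2 + t * nr g ^ 2) + L * (t⁻¹ * nr (e 1 k) ^ 2 + t * nr g ^ 2)) := by
    intro t ht k hk
    have hlim : Tendsto (fun N => nr (act (delta k i * avg k ^ (2 * N)) (Ψ k)) * nr g) atTop
        (𝓝 0) := by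
      have := (tendsto_eLpNorm_delta_avg k i (hΨ k)).comp
        (tendsto_id.const_mul_atTop' (two_pos : 0 < 2))
      simpa [Function.comp_def, hnr] using this.mul_const (nr g)
    have hb := hlim.const_add
      (2 * K * (((∫ x, |f 0 x| ^ p) + ∫ x, |f 1 x| ^ p) + ∫ x, |g x| ^ q)
        + (L * (t⁻¹ * nr (e 0 k) ^ 2 + t * nr g ^ 2) + L * (t⁻¹ * nr (e 1 k) ^ 2 + t * nr g ^ 2)))
    rw [add_zero] at hb
    refine ge_of_tendsto hb (Eventually.of_forall fun N => ?_)
    have hid : act (delta k i) (Ψ k)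
        = act (neumann k N * (delta k i * delta k 0)) (f 0)
          + act (neumann k N * (delta k i * delta k 1)) (f 1)
          - (act (neumann k N * (delta k i * delta k 0)) (e 0 k)
            + act (neumann k N * (delta k i * delta k 1)) (e 1 k))
          + act (delta k i * avg k ^ (2 * N)) (Ψ k) := by
      have h1 := congrArg (act (neumann k N * delta k i)) (heq k hk)
      simp only [map_add, ← act_mul] at h1
      have h2 : neumann k N * delta k i * (1 - avg k * avg k)
          = delta k i - delta k i * avg k ^ (2 * N) := by
        have := one_sub_mul_neumann k N
        rw [pow_mul, pow_two]
        linear_combination (delta k i) * this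
      rw [h2, act_sub] at h1
      simp only [← mul_assoc]
      rw [h1]; abel
    have I : ∀ r {h : Plane → ℝ}, MemLp h 2 volume → Integrable (fun x => act r h x * g x) volume :=
      fun r h hh => integrable_mul_of_memLp_two (memLp_act hh r) hg
    rw [hid]
    simp only [Pi.add_apply, Pi.sub_apply, add_mul, sub_mul]
    have I0 := I (neumann k N * (delta k i * delta k 0)) (hf 0)
    have I1 := I (neumann k N * (delta k i * delta k 1)) (hf 1)
    have J0 := I (neumann k N * (delta k i * delta k 0)) ((he 0).memLp k)
    have J1 := I (neumann k N * (delta k i * delta k 1)) ((he 1).memLp k)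
    have I2 := I (delta k i * avg k ^ (2 * N)) (hΨ k)
    have IJ : Integrable (fun x =>
        (act (neumann k N * (delta k i * delta k 0)) (f 0) x * g x
          + act (neumann k N * (delta k i * delta k 1)) (f 1) x * g x)
        - (act (neumann k N * (delta k i * delta k 0)) (e 0 k) x * g x
          + act (neumann k N * (delta k i * delta k 1)) (e 1 k) x * g x)) volume :=
      (I0.fun_add I1).sub (J0.fun_add J1)
    have s1 := integral_add IJ I2
    have s2 := integral_sub (I0.fun_add I1) (J0.fun_add J1)
    have s3 := integral_add I0 I1
    have s4 := integral_add J0 J1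
    rw [s1, s2, s3, s4]
    have a0 := hKb k N i 0 (f 0) g (hf 0) (hfp 0) hg hgq
    have a1 := hKb k N i 1 (f 1) g (hf 1) (hfp 1) hg hgq
    have b0 := hLb' t ht k N 0 (e 0 k) ((he 0).memLp k)
    have b1 := hLb' t ht k N 1 (e 1 k) ((he 1).memLp k)
    have c := abs_integral_mul_le (memLp_act (hΨ k) (delta k i * avg k ^ (2 * N))) hg
    refine (abs_add_le _ _).trans (add_le_add ((abs_sub _ _).trans (add_le_add
      ((abs_add_le _ _).trans ((add_le_add a0 a1).trans ?_))
      ((abs_add_le _ _).trans (add_le_add b0 b1)))) c)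
    have h0 := mul_nonneg hK (hnn (f 0) p)
    have h1 := mul_nonneg hK (hnn (f 1) p)
    nlinarith
  have step2 : ∀ t : ℝ, 0 < t → |∫ x, w x * g x|
      ≤ 2 * K * (((∫ x, |f 0 x| ^ p) + ∫ x, |f 1 x| ^ p) + ∫ x, |g x| ^ q)
        + (L * (t * nr g ^ 2) + L * (t * nr g ^ 2)) := by
    intro t ht
    have hl := (hw.tendsto_integral hg).abs
    have he0 : ∀ l, Tendsto (fun k => nr (e l k)) (𝓝[>] 0) (𝓝 0) := fun l => by
      have := (ENNReal.tendsto_toReal ENNReal.zero_ne_top).comp (he l).tendsto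
      simpa [Function.comp_def, hnr] using this
    have hr : ∀ l, Tendsto (fun k => L * (t⁻¹ * nr (e l k) ^ 2 + t * nr g ^ 2)) (𝓝[>] 0)
        (𝓝 (L * (t * nr g ^ 2))) := fun l => by
      have := ((((he0 l).pow 2).const_mul t⁻¹).add_const (t * nr g ^ 2)).const_mul L
      simpa using this
    refine le_of_tendsto_of_tendsto hl (((hr 0).add (hr 1)).const_add
      (2 * K * (((∫ x, |f 0 x| ^ p) + ∫ x, |f 1 x| ^ p) + ∫ x, |g x| ^ q))) ?_
    filter_upwards [self_mem_nhdsWithin] with k hk using step t ht k hk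
  have hr : Tendsto (fun t : ℝ => 2 * K * (((∫ x, |f 0 x| ^ p) + ∫ x, |f 1 x| ^ p) + ∫ x, |g x| ^ q)
      + (L * (t * nr g ^ 2) + L * (t * nr g ^ 2))) (𝓝[>] 0)
      (𝓝 (2 * K * (((∫ x, |f 0 x| ^ p) + ∫ x, |f 1 x| ^ p) + ∫ x, |g x| ^ q))) := by
    have : Continuous fun t : ℝ => 2 * K * (((∫ x, |f 0 x| ^ p) + ∫ x, |f 1 x| ^ p)
      + ∫ x, |g x| ^ q) + (L * (t * nr g ^ 2) + L * (t * nr g ^ 2)) := by fun_prop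
    simpa using (this.tendsto 0).mono_left (nhdsWithin_le_nhds (a := (0 : ℝ)) (s := Ioi 0))
  refine ge_of_tendsto hr ?_
  filter_upwards [self_mem_nhdsWithin] with t ht using step2 t ht

lemma lintegral_rpow_le_of_duality {p q : ℝ} (hpq : p.HolderConjugate q) {K : ℝ} (hK : 0 ≤ K) :
    ∃ C : ℝ, 0 ≤ C ∧ ∀ (w : Plane → ℝ) (a : ℝ), Measurable w → MemLp w 2 volume → 0 ≤ a →
      (∀ g : Plane → ℝ, MemLp g 2 volume → MemLp g (ENNReal.ofReal q) volume →
        |∫ x, w x * g x| ≤ K * (a + ∫ x, |g x| ^ q)) →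
      ∫⁻ x, ‖w x‖ₑ ^ p ≤ ENNReal.ofReal (C * a) := by
  have hq1 : 0 < q - 1 := by linarith [hpq.symm.lt]
  have hp0 := hpq.pos
  have hp1 : 0 < p - 1 := by linarith [hpq.lt]
  set ε : ℝ := (2 * (K + 1))⁻¹ ^ (1 / (q - 1)) with hε
  have hε0 : 0 < ε := by positivity
  have hεq : K * ε ^ q ≤ ε / 2 := by
    have h1 : ε ^ (q - 1) = (2 * (K + 1))⁻¹ := by
      rw [hε, ← Real.rpow_mul (by positivity), one_div, inv_mul_cancel₀ hq1.ne', Real.rpow_one]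
    have h2 : ε ^ q = ε ^ (q - 1) * ε := by
      rw [← Real.rpow_add_one hε0.ne']; simp
    rw [h2, h1]
    have : K * (2 * (K + 1))⁻¹ ≤ 1 / 2 := by
      rw [← div_eq_mul_inv, div_le_iff₀ (by positivity)]; linarith
    nlinarith
  refine ⟨2 * K / ε, by positivity, fun w a hw hw2 ha hdual => ?_⟩
  set S : ℕ → Set Plane := fun m => {x | 1 / ((m : ℝ) + 1) ≤ |w x| ∧ |w x| ≤ m + 1} with hS
  have hSm : ∀ m, MeasurableSet (S m) := fun m =>
    (measurableSet_le measurable_const hw.abs).inter (measurableSet_le hw.abs measurable_const)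
  have hSfin : ∀ m, volume (S m) < ⊤ := fun m => by
    have hpos : (0 : ℝ) < 1 / ((m : ℝ) + 1) := by positivity
    refine lt_of_le_of_lt (measure_mono ?_) (hw2.meas_ge_lt_top two_ne_zero ENNReal.ofNat_ne_top
      (ε := ⟨1 / ((m : ℝ) + 1), hpos.le⟩) (by
        intro h; exact hpos.ne' (congrArg NNReal.toReal h)))
    intro x hx
    exact hx.1
  have key : ∀ m, ∫⁻ x in S m, ‖w x‖ₑ ^ p ≤ ENNReal.ofReal (2 * K / ε * a) := by
    intro m
    have hfin : IsFiniteMeasure (volume.restrict (S m)) := ⟨by simpa using hSfin m⟩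
    set h : Plane → ℝ := fun x => ε * (SignType.sign (w x) * |w x| ^ (p - 1)) with hh
    have hsgn : Measurable fun x => ((SignType.sign (w x) : SignType) : ℝ) := by
      have : (fun x => ((SignType.sign (w x) : SignType) : ℝ)) =
          fun x => if 0 < w x then 1 else if w x < 0 then -1 else 0 := by
        ext x
        rw [sign_apply]
        split_ifs <;> simp
      rw [this]
      exact Measurable.ite (measurableSet_lt measurable_const hw) measurable_const
        (Measurable.ite (measurableSet_lt hw measurable_const) measurable_const measurable_const)
    have hhm : Measurable h := (hsgn.mul (hw.abs.pow_const _)).const_mul ε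
    have habs : ∀ x, |w x| ≠ 0 → |h x| = ε * |w x| ^ (p - 1) := by
      intro x hx
      have hx' : w x ≠ 0 := fun h0 => hx (by simp [h0])
      have : |((SignType.sign (w x) : SignType) : ℝ)| = 1 := by
        rcases lt_or_gt_of_ne hx' with h0 | h0
        · simp [sign_neg h0]
        · simp [sign_pos h0]
      rw [hh]
      simp only [abs_mul, this, one_mul]
      rw [abs_of_pos hε0, abs_of_nonneg (by positivity)]
    have hne : ∀ x ∈ S m, |w x| ≠ 0 := fun x hx =>
      (lt_of_lt_of_le (by positivity : (0 : ℝ) < 1 / ((m : ℝ) + 1)) hx.1).ne'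
    have hbd : ∀ r, MemLp ((S m).indicator h) r volume := fun r => by
      rw [memLp_indicator_iff_restrict (hSm m)]
      refine MemLp.of_bound hhm.aestronglyMeasurable (ε * ((m : ℝ) + 1) ^ (p - 1)) ?_
      filter_upwards [ae_restrict_mem (hSm m)] with x hx
      rw [Real.norm_eq_abs, habs x (hne x hx)]
      gcongr
      exact hx.2
    have hI : Integrable (fun x => |w x| ^ p) (volume.restrict (S m)) := by
      refine (memLp_one_iff_integrable.1 (MemLp.of_bound
        (hw.abs.pow_const _).aestronglyMeasurable (((m : ℝ) + 1) ^ p) ?_))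
      filter_upwards [ae_restrict_mem (hSm m)] with x hx
      rw [Real.norm_of_nonneg (by positivity)]
      gcongr
      exact hx.2
    have e1 : ∫ x, w x * (S m).indicator h x = ε * ∫ x in S m, |w x| ^ p := by
      rw [← integral_const_mul, ← integral_indicator (hSm m)]
      congr 1; ext x
      by_cases hx : x ∈ S m
      · rw [indicator_of_mem hx, indicator_of_mem hx, hh]
        simp only
        have h1 : |w x| ^ p = |w x| ^ (p - 1) * |w x| := by
          rw [← Real.rpow_add_one (hne x hx)]; simp
        have h2 : w x * SignType.sign (w x) = |w x| := self_mul_sign (w x)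
        rw [h1, ← h2]; ring
      · simp [indicator_of_notMem hx]
    have e2 : ∫ x, |(S m).indicator h x| ^ q = ε ^ q * ∫ x in S m, |w x| ^ p := by
      rw [← integral_const_mul, ← integral_indicator (hSm m)]
      congr 1; ext x
      by_cases hx : x ∈ S m
      · rw [indicator_of_mem hx, indicator_of_mem hx, habs x (hne x hx),
          Real.mul_rpow hε0.le (by positivity), ← Real.rpow_mul (abs_nonneg _), hpq.sub_one_mul_conj]
      · simp [indicator_of_notMem hx, Real.zero_rpow hpq.symm.pos.ne']
    have hd := hdual _ (hbd 2) (hbd _)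
    set I := ∫ x in S m, |w x| ^ p with hIdef
    have hI0 : 0 ≤ I := integral_nonneg fun x => by positivity
    rw [e1, e2, abs_of_nonneg (by positivity)] at hd
    have hIle : I ≤ 2 * K / ε * a := by
      rw [div_mul_eq_mul_div, le_div_iff₀ hε0]
      nlinarith [mul_le_mul_of_nonneg_right hεq hI0]
    calc ∫⁻ x in S m, ‖w x‖ₑ ^ p = ∫⁻ x in S m, ENNReal.ofReal (|w x| ^ p) := by
          refine lintegral_congr fun x => ?_
          rw [← ENNReal.ofReal_rpow_of_nonneg (abs_nonneg _) hp0.le, ← Real.norm_eq_abs, ofReal_norm]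
      _ = ENNReal.ofReal I := by
          rw [hIdef, ofReal_integral_eq_lintegral_ofReal hI
            (Eventually.of_forall fun x => by positivity)]
      _ ≤ _ := ENNReal.ofReal_le_ofReal hIle
  have hmono : Monotone S := by
    intro m n hmn x hx
    have : (m : ℝ) ≤ n := by exact_mod_cast hmn
    refine ⟨le_trans ?_ hx.1, hx.2.trans (by linarith)⟩
    gcongr
  have hU : ∫⁻ x, ‖w x‖ₑ ^ p = ∫⁻ x in ⋃ m, S m, ‖w x‖ₑ ^ p := by
    rw [← lintegral_indicator (MeasurableSet.iUnion hSm)]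
    refine lintegral_congr fun x => ?_
    by_cases hx : x ∈ ⋃ m, S m
    · rw [indicator_of_mem hx]
    · rw [indicator_of_notMem hx]
      have : w x = 0 := by
        by_contra h0
        apply hx
        have h0 : 0 < |w x| := abs_pos.2 h0
        obtain ⟨m, hm⟩ := exists_nat_gt (max |w x| (1 / |w x|))
        refine mem_iUnion.2 ⟨m, ?_, ?_⟩
        · rw [div_le_iff₀ (by positivity)]
          have h1 := (le_max_right _ _).trans hm.le
          rw [div_le_iff₀ h0] at h1
          nlinarith
        · linarith [(le_max_left |w x| (1 / |w x|)).trans hm.le]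
      simp [this, hp0]
  rw [hU, setLIntegral_iUnion_of_directed _ hmono.directed_le]
  exact iSup_le key

lemma eLpNorm_ofReal_rpow {F : Type*} [NormedAddCommGroup F] {p : ℝ} (hp : 0 < p) (f : Plane → F) :
    eLpNorm f (ENNReal.ofReal p) volume ^ p = ∫⁻ x, ‖f x‖ₑ ^ p := by
  rw [eLpNorm_eq_lintegral_rpow_enorm_toReal (by simpa using hp) ENNReal.ofReal_ne_top,
    ENNReal.toReal_ofReal hp.le, ← ENNReal.rpow_mul, one_div, inv_mul_cancel₀ hp.ne',
    ENNReal.rpow_one]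

lemma ofReal_integral_abs_rpow {p : ℝ} (hp : 0 < p) {f : Plane → ℝ}
    (hf : MemLp f (ENNReal.ofReal p) volume) :
    ENNReal.ofReal (∫ x, |f x| ^ p) = eLpNorm f (ENNReal.ofReal p) volume ^ p := by
  rw [ofReal_integral_eq_lintegral_ofReal (memLp_integrable_abs_rpow hp hf)
    (Eventually.of_forall fun x => by positivity), eLpNorm_ofReal_rpow hp]
  refine lintegral_congr fun x => ?_
  rw [← ENNReal.ofReal_rpow_of_nonneg (abs_nonneg _) hp.le, ← Real.norm_eq_abs, ofReal_norm]

/-- The `L^p` estimate of a singular integral of data that are exhibited, up to errors that are small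
in `L²`, by discrete potentials. -/
lemma exists_eLpNorm_le_of_approx {p : ℝ} (hp : 1 < p) :
    ∃ C : ℝ≥0, ∀ (f : Fin 2 → Plane → ℝ) (w : Plane → ℝ) (i : Fin 2) (Ψ : ℝ → Plane → ℝ)
      (e : Fin 2 → ℝ → Plane → ℝ), (∀ l, MemLp (f l) 2 volume) →
      (∀ k, MemLp (Ψ k) 2 volume) → (∀ l, TendstoL2 (e l) 0) →
      (∀ k, 0 < k → act (delta k 0) (f 0) + act (delta k 1) (f 1)
        = act (1 - avg k * avg k) (Ψ k) + (act (delta k 0) (e 0 k) + act (delta k 1) (e 1 k))) →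
      Measurable w → TendstoL2 (fun k => act (delta k i) (Ψ k)) w →
      eLpNorm w (ENNReal.ofReal p) volume ≤ C * (eLpNorm (f 0) (ENNReal.ofReal p) volume
        + eLpNorm (f 1) (ENNReal.ofReal p) volume) := by
  have hpq := Real.HolderConjugate.conjExponent hp
  have hp0 : 0 < p := by linarith
  obtain ⟨K, hK, hKb⟩ := exists_abs_integral_le_of_approx hpq
  obtain ⟨C, hC, hCb⟩ := lintegral_rpow_le_of_duality hpq hK
  refine ⟨Real.toNNReal (C ^ (1 / p)) + 1, fun f w i Ψ e hf hΨ he heq hwm hw => ?_⟩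
  by_cases hfp : ∀ l, MemLp (f l) (ENNReal.ofReal p) volume
  · have h1 := hCb w ((∫ x, |f 0 x| ^ p) + ∫ x, |f 1 x| ^ p) hwm hw.memLp_lim
      (add_nonneg (integral_nonneg fun x => by positivity)
        (integral_nonneg fun x => by positivity))
      (fun g hg hgq => hKb f w i Ψ e hf hfp hΨ he heq hw g hg hgq)
    rw [← eLpNorm_ofReal_rpow hp0, ENNReal.ofReal_mul hC,
      ENNReal.ofReal_add (integral_nonneg fun x => by positivity)
        (integral_nonneg fun x => by positivity), ofReal_integral_abs_rpow hp0 (hfp 0),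
      ofReal_integral_abs_rpow hp0 (hfp 1)] at h1
    have h2 := h1.trans (mul_le_mul_right (ENNReal.add_rpow_le_rpow_add _ _ hp.le) _)
    have h3 := ENNReal.rpow_le_rpow h2 (one_div_pos.2 hp0).le
    rw [ENNReal.mul_rpow_of_nonneg _ _ (one_div_pos.2 hp0).le, ← ENNReal.rpow_mul,
      ← ENNReal.rpow_mul, mul_one_div_cancel hp0.ne', ENNReal.rpow_one, ENNReal.rpow_one,
      ENNReal.ofReal_rpow_of_nonneg hC (one_div_pos.2 hp0).le] at h3
    refine h3.trans ?_
    gcongr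
    rw [ENNReal.ofReal]
    exact_mod_cast le_add_of_nonneg_right zero_le_one
  · obtain ⟨l, hl⟩ := not_forall.1 hfp
    have htop : eLpNorm (f l) (ENNReal.ofReal p) volume = ⊤ := by
      by_contra h
      exact hl ⟨(hf l).1, lt_top_iff_ne_top.2 h⟩
    have : eLpNorm (f 0) (ENNReal.ofReal p) volume + eLpNorm (f 1) (ENNReal.ofReal p) volume = ⊤ := by
      fin_cases l
      · exact ENNReal.add_eq_top.2 (Or.inl htop)
      · exact ENNReal.add_eq_top.2 (Or.inr htop)
    rw [this, ENNReal.mul_top]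
    · exact le_top
    · simp

lemma TendstoL2.sub_lim {F : ℝ → Plane → ℝ} {f : Plane → ℝ} (h : TendstoL2 F f) :
    TendstoL2 (fun k => f - F k) 0 := by
  refine ⟨fun k => h.memLp_lim.sub (h.memLp k), MemLp.zero, ?_⟩
  simp only [sub_zero, eLpNorm_sub_comm f]
  exact h.tendsto

lemma tendstoL2_zero : TendstoL2 (fun _ => 0) 0 :=
  ⟨fun _ => MemLp.zero, MemLp.zero, by simp⟩

lemma eLpNorm_of_smul_le {c : ℝ} (hc : c ≠ 0) {f : Plane → ℝ} {s X : ℝ≥0∞}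
    (h : eLpNorm (c • f) s volume ≤ X) : eLpNorm f s volume ≤ ‖c⁻¹‖ₑ * X := by
  have : f = c⁻¹ • (c • f) := by rw [smul_smul, inv_mul_cancel₀ hc, one_smul]
  rw [this, eLpNorm_const_smul]
  gcongr

/-- Second derivatives are controlled in `L^p` by the Laplacian. -/
theorem exists_eLpNorm_pd_pd_le {p : ℝ} (hp : 1 < p) :
    ∃ C : ℝ≥0, ∀ φ : Plane → ℝ, InAllSobolev φ → ∀ i j : Fin 2,
      eLpNorm (pd (ee i) (pd (ee j) φ)) (ENNReal.ofReal p) volume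
        ≤ C * eLpNorm (lap φ) (ENNReal.ofReal p) volume := by
  obtain ⟨C, hC⟩ := exists_eLpNorm_le_of_approx hp
  refine ⟨‖(-(2 / 3) * 16 : ℝ)⁻¹‖₊ * C, fun φ h i j => ?_⟩
  have hE : TendstoL2 (fun k => lap φ - (-(2 / 3) : ℝ) • (k ^ 2)⁻¹ • act (1 - avg k * avg k) φ) 0 := by
    have := (tendstoL2_one_sub_avg_sq h).smul (-(2 / 3))
    rw [smul_smul, show (-(2 / 3) * -(3 / 2) : ℝ) = 1 by norm_num, one_smul] at this
    exact this.sub_lim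
  have hW := (tendstoL2_delta_mul_delta h i j).smul (-(2 / 3))
  rw [smul_smul] at hW
  have hpd : Continuous (pd (ee i) (pd (ee j) φ)) := ((h.pd _).pd _).1.continuous
  have key := hC (fun l => if l = j then lap φ else 0) ((-(2 / 3) * 16 : ℝ) • pd (ee i) (pd (ee j) φ))
    i (fun k => (-(2 / 3) : ℝ) • (k ^ 2)⁻¹ • act (delta k j) φ)
    (fun l k => if l = j then lap φ - (-(2 / 3) : ℝ) • (k ^ 2)⁻¹ • act (1 - avg k * avg k) φ else 0)
    (fun l => by split_ifs; exacts [h.lap.memLp, MemLp.zero])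
    (fun k => ((memLp_act h.memLp _).const_smul _).const_smul _)
    (fun l => by split_ifs; exacts [hE, tendstoL2_zero])
    (fun k _ => ?_) (hpd.const_smul _).measurable ?_
  · have h1 := eLpNorm_of_smul_le (by norm_num) key
    rw [ENNReal.coe_mul, mul_assoc]
    refine h1.trans (le_of_eq ?_)
    congr 2
    fin_cases j <;> simp
  · have h2 : act (delta k j) (lap φ) = act (1 - avg k * avg k)
        ((-(2 / 3) : ℝ) • (k ^ 2)⁻¹ • act (delta k j) φ) + act (delta k j)
        (lap φ - (-(2 / 3) : ℝ) • (k ^ 2)⁻¹ • act (1 - avg k * avg k) φ) := by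
      rw [map_sub (act (delta k j))]
      simp only [map_smul, ← act_mul]
      rw [mul_comm (delta k j)]; abel
    fin_cases j <;> simpa using h2
  · convert hW using 1
    ext1 k
    simp only [map_smul, ← act_mul]

/-- The `L^p` estimate of the vorticity gradient for the Stokes system. -/
theorem exists_eLpNorm_curl_le {p : ℝ} (hp : 1 < p) :
    ∃ C : ℝ≥0, ∀ v₀ v₁ π : Plane → ℝ, InAllSobolev v₀ → InAllSobolev v₁ → ContDiff ℝ ∞ π →
      InAllSobolev (pd (ee 0) π) → InAllSobolev (pd (ee 1) π) → ∀ i : Fin 2,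
      eLpNorm (pd (ee i) (pd (ee 1) v₀ - pd (ee 0) v₁)) (ENNReal.ofReal p) volume
        ≤ C * (eLpNorm (pd (ee 0) π - lap v₀) (ENNReal.ofReal p) volume
          + eLpNorm (pd (ee 1) π - lap v₁) (ENNReal.ofReal p) volume) := by
  obtain ⟨C, hC⟩ := exists_eLpNorm_le_of_approx hp
  refine ⟨‖((2 / 3) * 16 : ℝ)⁻¹‖₊ * C, fun v₀ v₁ π h₀ h₁ hπ hπ₀ hπ₁ i => ?_⟩
  have hE : ∀ {v : Plane → ℝ} (j : Fin 2), InAllSobolev v → InAllSobolev (pd (ee j) π) →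
      TendstoL2 (fun k => (pd (ee j) π - lap v) - ((1 / 4 : ℝ) • k⁻¹ • act (delta k j) π
        + (2 / 3 : ℝ) • (k ^ 2)⁻¹ • act (1 - avg k * avg k) v)) 0 := by
    intro v j hv hj
    have := ((tendstoL2_delta hπ j hj).smul (1 / 4)).add ((tendstoL2_one_sub_avg_sq hv).smul (2 / 3))
    rw [smul_smul, smul_smul, show (2 / 3 * -(3 / 2) : ℝ) = -1 by norm_num,
      show (1 / 4 * 4 : ℝ) = 1 by norm_num, one_smul, neg_one_smul, ← sub_eq_add_neg] at this
    exact this.sub_lim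
  have hW := ((tendstoL2_delta_mul_delta h₀ i 1).sub (tendstoL2_delta_mul_delta h₁ i 0)).smul (2 / 3)
  rw [← smul_sub, smul_smul, ← pd_sub (h₀.pd _).1 (h₁.pd _).1] at hW
  have hF₀ : MemLp (pd (ee 0) π - lap v₀) 2 volume := hπ₀.memLp.sub h₀.lap.memLp
  have hF₁ : MemLp (pd (ee 1) π - lap v₁) 2 volume := hπ₁.memLp.sub h₁.lap.memLp
  have hcont : Continuous (pd (ee i) (pd (ee 1) v₀ - pd (ee 0) v₁)) :=
    (contDiff_pd ((h₀.pd _).1.sub (h₁.pd _).1) _).continuous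
  have key := hC ![-(pd (ee 1) π - lap v₁), pd (ee 0) π - lap v₀]
    (((2 / 3) * 16 : ℝ) • pd (ee i) (pd (ee 1) v₀ - pd (ee 0) v₁)) i
    (fun k => (2 / 3 : ℝ) • (k ^ 2)⁻¹ • (act (delta k 1) v₀ - act (delta k 0) v₁))
    ![fun k => -((pd (ee 1) π - lap v₁) - ((1 / 4 : ℝ) • k⁻¹ • act (delta k 1) π
        + (2 / 3 : ℝ) • (k ^ 2)⁻¹ • act (1 - avg k * avg k) v₁)),
      fun k => (pd (ee 0) π - lap v₀) - ((1 / 4 : ℝ) • k⁻¹ • act (delta k 0) π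
        + (2 / 3 : ℝ) • (k ^ 2)⁻¹ • act (1 - avg k * avg k) v₀)]
    (Fin.forall_fin_two.2 ⟨hF₁.neg, hF₀⟩)
    (fun k => (((memLp_act h₀.memLp _).sub (memLp_act h₁.memLp _)).const_smul _).const_smul _)
    (Fin.forall_fin_two.2 ⟨by simpa using (hE 1 h₁ hπ₁).neg, hE 0 h₀ hπ₀⟩)
    (fun k _ => ?_) (hcont.const_smul _).measurable ?_
  · have h1 := eLpNorm_of_smul_le (by norm_num) key
    rw [ENNReal.coe_mul, mul_assoc]
    refine h1.trans (le_of_eq ?_)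
    simp only [Matrix.cons_val_zero, Matrix.cons_val_one, eLpNorm_neg]
    rw [add_comm]
    rfl
  · simp only [Matrix.cons_val_zero, Matrix.cons_val_one, map_neg, map_sub (act (delta k _)),
      map_sub (act (1 - avg k * avg k)), map_add (act (delta k _)), map_smul, ← act_mul]
    rw [mul_comm (delta k 0) (delta k 1), mul_comm (delta k 0) (1 - _),
      mul_comm (delta k 1) (1 - _), smul_sub, smul_sub]
    abel
  · convert hW using 1
    ext1 k
    simp only [map_smul, map_sub (act (delta k i)), ← act_mul, smul_sub]

end SingularIntegrals

/-! ### Gagliardo–Nirenberg inequalities -/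

section GagliardoNirenberg

open Filter Topology

lemma lintegral_closedBall_rpow_le {w : Plane → ℝ} (hw : Measurable w) {s r : ℝ} (hs : 0 < s)
    (hsr : s ≤ r) {R : ℝ} (hR : 0 ≤ R) :
    ∫⁻ x in Metric.closedBall 0 R, ‖w x‖ₑ ^ s
      ≤ (∫⁻ x, ‖w x‖ₑ ^ r) ^ (s / r)
        * (ENNReal.ofReal (R ^ 2) * volume (Metric.ball (0 : Plane) 1)) ^ (1 - s / r) := by
  have hr : 0 < r := hs.trans_le hsr
  have hB : MeasurableSet (Metric.closedBall (0 : Plane) R) := Metric.isClosed_closedBall.measurableSet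
  have h1 := ENNReal.lintegral_mul_norm_pow_le (μ := (volume : Measure Plane))
    (f := fun x => ‖w x‖ₑ ^ r) (g := (Metric.closedBall (0 : Plane) R).indicator 1)
    (hw.enorm.pow_const r).aemeasurable (measurable_one.indicator hB).aemeasurable
    (p := s / r) (q := 1 - s / r) (by positivity) (sub_nonneg.2 ((div_le_one hr).2 hsr)) (by ring)
  rw [lintegral_indicator_one hB, Measure.addHaar_closedBall _ _ hR] at h1
  have hfr : Module.finrank ℝ Plane = 2 := by simp
  rw [hfr] at h1
  refine le_trans ?_ h1
  rw [← lintegral_indicator hB]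
  refine lintegral_mono fun x => ?_
  by_cases hx : x ∈ Metric.closedBall (0 : Plane) R
  · rw [indicator_of_mem hx, indicator_of_mem hx, Pi.one_apply, ENNReal.one_rpow, mul_one,
      ← ENNReal.rpow_mul, mul_div_cancel₀ _ hr.ne']
  · rw [indicator_of_notMem hx]; exact zero_le

lemma exists_cutoff : ∃ M : ℝ, 0 ≤ M ∧ ∀ R : ℝ, 0 < R → ∃ χ : Plane → ℝ, ContDiff ℝ 1 χ ∧
    HasCompactSupport χ ∧ (∀ x, 0 ≤ χ x) ∧ (∀ x, χ x ≤ 1) ∧ (∀ x, ‖x‖ ≤ R → χ x = 1) ∧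
    ∀ x, ‖fderiv ℝ χ x‖ ≤ (Metric.closedBall (0 : Plane) (2 * R)).indicator (fun _ => M / R) x := by
  let b : ContDiffBump (0 : Plane) := ⟨1, 2, one_pos, one_lt_two⟩
  have hb : ContDiff ℝ 1 b := b.contDiff
  have hcont : Continuous (fderiv ℝ b) := hb.continuous_fderiv one_ne_zero
  have hsupp : HasCompactSupport (fderiv ℝ b) := b.hasCompactSupport.fderiv ℝ
  obtain ⟨M, hM⟩ := hcont.bounded_above_of_compact_support hsupp
  have hM0 : 0 ≤ M := (norm_nonneg _).trans (hM 0)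
  refine ⟨M, hM0, fun R hR => ⟨fun x => b (R⁻¹ • x), hb.comp (contDiff_const_smul _), ?_,
    fun x => b.nonneg, fun x => b.le_one, fun x hx => ?_, fun x => ?_⟩⟩
  · have : HasCompactSupport (b ∘ (Homeomorph.smulOfNeZero R⁻¹ (inv_ne_zero hR.ne'))) :=
      b.hasCompactSupport.comp_homeomorph _
    exact this
  · apply b.one_of_mem_closedBall
    rw [mem_closedBall_zero_iff, norm_smul, norm_inv, Real.norm_of_nonneg hR.le]
    rw [inv_mul_le_iff₀ hR]
    exact hx.trans (le_of_eq (mul_one R).symm)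
  · have hfd : fderiv ℝ (fun x => b (R⁻¹ • x)) x = R⁻¹ • fderiv ℝ b (R⁻¹ • x) := by
      have h1 : HasFDerivAt (fun x : Plane => R⁻¹ • x) (R⁻¹ • ContinuousLinearMap.id ℝ Plane) x :=
        (hasFDerivAt_id x).const_smul R⁻¹
      have h2 := ((hb.differentiable one_ne_zero (R⁻¹ • x)).hasFDerivAt).comp x h1
      have h3 : HasFDerivAt (fun x => b (R⁻¹ • x)) _ x := h2
      rw [h3.fderiv]
      ext y
      simp
    rw [hfd, norm_smul, norm_inv, Real.norm_of_nonneg hR.le]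
    by_cases hx : x ∈ Metric.closedBall (0 : Plane) (2 * R)
    · rw [indicator_of_mem hx, div_eq_inv_mul]
      gcongr
      exact hM _
    · rw [indicator_of_notMem hx]
      have : fderiv ℝ b (R⁻¹ • x) = 0 := by
        by_contra hne
        have h4 : R⁻¹ • x ∈ tsupport b := support_fderiv_subset ℝ hne
        rw [b.tsupport_eq, mem_closedBall_zero_iff, norm_smul, norm_inv,
          Real.norm_of_nonneg hR.le, inv_mul_le_iff₀ hR] at h4
        apply hx
        rw [mem_closedBall_zero_iff]
        have h5 : b.rOut = 2 := rfl
        rw [h5] at h4; linarith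
      simp [this]

/-- The Gagliardo–Nirenberg–Sobolev inequality for a power of a function of the plane. -/
lemma exists_lintegral_rpow_le :
    ∃ C : ℝ≥0, ∀ (w : Plane → ℝ) (s r : ℝ), ContDiff ℝ 1 w → 1 < s → s ≤ r → r < 2 * s →
      ∫⁻ x, ‖w x‖ₑ ^ r < ⊤ →
      ∫⁻ x, ‖w x‖ₑ ^ (2 * s)
        ≤ C * (ENNReal.ofReal s * ∫⁻ x, ‖w x‖ₑ ^ (s - 1) * ‖fderiv ℝ w x‖ₑ) ^ 2 := by
  obtain ⟨M, hM, hcut⟩ := exists_cutoff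
  refine ⟨lintegralPowLePowLIntegralFDerivConst (volume : Measure Plane) 2,
    fun w s r hw hs hsr hr2 hfin => ?_⟩
  set C := lintegralPowLePowLIntegralFDerivConst (volume : Measure Plane) 2
  have hs0 : 0 < s := by linarith
  have hr0 : 0 < r := by linarith
  have hwm : Measurable w := hw.continuous.measurable
  have hdm : Measurable fun x => ‖fderiv ℝ w x‖ₑ :=
    (hw.continuous_fderiv one_ne_zero).measurable.enorm
  set J := ENNReal.ofReal s * ∫⁻ x, ‖w x‖ₑ ^ (s - 1) * ‖fderiv ℝ w x‖ₑ with hJ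
  set θ := 1 - s / r with hθ
  have hθ0 : 0 ≤ θ := sub_nonneg.2 ((div_le_one hr0).2 hsr)
  have hθ1 : 2 * θ < 1 := by
    have : 1 / 2 < s / r := by rw [lt_div_iff₀ hr0]; linarith
    linarith
  set E : ℝ → ℝ≥0∞ := fun R => ENNReal.ofReal (M / R) * ((∫⁻ x, ‖w x‖ₑ ^ r) ^ (s / r)
    * (ENNReal.ofReal ((2 * R) ^ 2) * volume (Metric.ball (0 : Plane) 1)) ^ θ) with hE
  have hElim : Tendsto E atTop (𝓝 0) := by
    set A := (∫⁻ x, ‖w x‖ₑ ^ r) ^ (s / r) * volume (Metric.ball (0 : Plane) 1) ^ θ with hA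
    have hAtop : A ≠ ⊤ := ENNReal.mul_ne_top (ENNReal.rpow_ne_top_of_nonneg (by positivity) hfin.ne)
      (ENNReal.rpow_ne_top_of_nonneg hθ0 measure_ball_lt_top.ne)
    have h1 : Tendsto (fun R : ℝ => M * 2 ^ (2 * θ) * R ^ (-(1 - 2 * θ))) atTop (𝓝 0) := by
      have := (tendsto_rpow_neg_atTop (y := 1 - 2 * θ) (by linarith)).const_mul (M * 2 ^ (2 * θ))
      simpa using this
    have h2 := ENNReal.Tendsto.mul_const (b := A) (ENNReal.tendsto_ofReal h1) (Or.inr hAtop)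
    rw [ENNReal.ofReal_zero, zero_mul] at h2
    refine h2.congr' ?_
    filter_upwards [eventually_gt_atTop 0] with R hR
    simp only [hE]
    rw [ENNReal.mul_rpow_of_nonneg _ _ hθ0, ENNReal.ofReal_rpow_of_nonneg (by positivity) hθ0]
    have h3 : M * 2 ^ (2 * θ) * R ^ (-(1 - 2 * θ)) = M / R * ((2 * R) ^ 2) ^ θ := by
      rw [← Real.rpow_natCast, ← Real.rpow_mul (by positivity), Real.mul_rpow (by positivity) hR.le,
        neg_sub, Real.rpow_sub_one hR.ne']
      push_cast
      ring
    rw [h3, ENNReal.ofReal_mul (by positivity), hA]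
    ring
  have main : ∀ n : ℕ, ∀ R : ℝ, 0 < R → n ≤ R →
      ∫⁻ x in Metric.closedBall 0 (n : ℝ), ‖w x‖ₑ ^ (2 * s) ≤ C * (J + E R) ^ 2 := by
    intro n R hR hnR
    obtain ⟨χ, hχs, hχc, hχ0, hχ1, hχR, hχd⟩ := hcut R hR
    have hws : ContDiff ℝ 1 fun x => ‖w x‖ ^ s := hw.norm_rpow hs
    have hg : ContDiff ℝ 1 fun x => χ x * ‖w x‖ ^ s := hχs.mul hws
    have hgc : HasCompactSupport fun x => χ x * ‖w x‖ ^ s := hχc.mul_right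
    have hfr : ((Module.finrank ℝ Plane : ℕ) : ℝ) = 2 := by simp
    have h1 := lintegral_pow_le_pow_lintegral_fderiv (volume : Measure Plane) hg hgc
      (p := 2) (by rw [hfr]; exact Real.HolderConjugate.two_two)
    have h2 : ∫⁻ x in Metric.closedBall 0 (n : ℝ), ‖w x‖ₑ ^ (2 * s)
        ≤ ∫⁻ x, ‖χ x * ‖w x‖ ^ s‖ₑ ^ (2 : ℝ) := by
      rw [← lintegral_indicator Metric.isClosed_closedBall.measurableSet]
      refine lintegral_mono fun x => ?_
      by_cases hx : x ∈ Metric.closedBall (0 : Plane) n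
      · rw [indicator_of_mem hx, hχR x ((mem_closedBall_zero_iff.1 hx).trans hnR), one_mul,
          Real.enorm_rpow_of_nonneg (norm_nonneg _) hs0.le, enorm_norm, ← ENNReal.rpow_mul, mul_comm]
      · rw [indicator_of_notMem hx]; exact zero_le
    have h3 : ∫⁻ x, ‖fderiv ℝ (fun x => χ x * ‖w x‖ ^ s) x‖ₑ ≤ J + E R := by
      have hpt : ∀ x, ‖fderiv ℝ (fun x => χ x * ‖w x‖ ^ s) x‖ₑ
          ≤ ENNReal.ofReal s * (‖w x‖ₑ ^ (s - 1) * ‖fderiv ℝ w x‖ₑ)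
            + ENNReal.ofReal (M / R) * (Metric.closedBall (0 : Plane) (2 * R)).indicator
              (fun x => ‖w x‖ₑ ^ s) x := by
        intro x
        have e : fderiv ℝ (fun x => χ x * ‖w x‖ ^ s) x
            = χ x • fderiv ℝ (fun x => ‖w x‖ ^ s) x + (‖w x‖ ^ s) • fderiv ℝ χ x :=
          fderiv_fun_mul (hχs.differentiable one_ne_zero x) (hws.differentiable one_ne_zero x)
        rw [e]
        refine (enorm_add_le (χ x • fderiv ℝ (fun x => ‖w x‖ ^ s) x)
          ((‖w x‖ ^ s) • fderiv ℝ χ x)).trans (add_le_add ?_ ?_)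
        · rw [enorm_smul]
          have a1 : ‖χ x‖ₑ ≤ 1 := by
            rw [Real.enorm_eq_ofReal (hχ0 x)]; simpa using hχ1 x
          have a2 := enorm_fderiv_norm_rpow_le (x := x) (hw.differentiable one_ne_zero)
            (p := s.toNNReal) (by simpa using hs)
          rw [Real.coe_toNNReal s hs0.le] at a2
          refine (mul_le_of_le_one_left' a1).trans (a2.trans (le_of_eq ?_))
          rw [mul_assoc]; rfl
        · rw [enorm_smul, Real.enorm_rpow_of_nonneg (norm_nonneg _) hs0.le, enorm_norm, mul_comm]
          have a3 := hχd x
          by_cases hx : x ∈ Metric.closedBall (0 : Plane) (2 * R)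
          · rw [indicator_of_mem hx] at a3 ⊢
            gcongr
            rw [← ofReal_norm]
            exact ENNReal.ofReal_le_ofReal a3
          · rw [indicator_of_notMem hx] at a3
            rw [← ofReal_norm, ENNReal.ofReal_of_nonpos a3, zero_mul]
            exact zero_le
      refine (lintegral_mono hpt).trans ?_
      have hm : Measurable fun x => ‖w x‖ₑ ^ (s - 1) * ‖fderiv ℝ w x‖ₑ :=
        (hwm.enorm.pow_const _).mul hdm
      rw [lintegral_add_left (hm.const_mul _), lintegral_const_mul _ hm, lintegral_const_mul _ ((hwm.enorm.pow_const _).indicator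
          Metric.isClosed_closedBall.measurableSet),
        lintegral_indicator Metric.isClosed_closedBall.measurableSet]
      refine add_le_add le_rfl (mul_le_mul_right ?_ _)
      exact lintegral_closedBall_rpow_le hwm hs0 hsr (by positivity)
    refine h2.trans (h1.trans ?_)
    rw [ENNReal.rpow_ofNat]
    gcongr
  have hball : ∀ n : ℕ, ∫⁻ x in Metric.closedBall 0 (n : ℝ), ‖w x‖ₑ ^ (2 * s) ≤ C * J ^ 2 := by
    intro n
    have hlim : Tendsto (fun R => (C : ℝ≥0∞) * (J + E R) ^ 2) atTop (𝓝 (C * J ^ 2)) := by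
      have h1 : Tendsto (fun R => J + E R) atTop (𝓝 J) := by simpa using hElim.const_add J
      exact ENNReal.Tendsto.const_mul ((ENNReal.continuous_pow 2).tendsto J |>.comp h1)
        (Or.inr ENNReal.coe_ne_top)
    refine ge_of_tendsto hlim ?_
    filter_upwards [eventually_gt_atTop 0, eventually_ge_atTop (n : ℝ)] with R h1 h2
      using main n R h1 h2
  have hmono : Monotone fun n : ℕ => Metric.closedBall (0 : Plane) (n : ℝ) := by
    intro m n hmn
    exact Metric.closedBall_subset_closedBall (by exact_mod_cast hmn)
  have hU : ∫⁻ x, ‖w x‖ₑ ^ (2 * s)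
      = ∫⁻ x in ⋃ n : ℕ, Metric.closedBall (0 : Plane) (n : ℝ), ‖w x‖ₑ ^ (2 * s) := by
    rw [Metric.iUnion_closedBall_nat, setLIntegral_univ]
  rw [hU, setLIntegral_iUnion_of_directed _ hmono.directed_le]
  exact iSup_le hball

lemma exists_lintegral_rpow_le_mul :
    ∃ C : ℝ≥0, ∀ (w : Plane → ℝ) (s p q : ℝ), ContDiff ℝ 1 w → 1 < s → p.HolderConjugate q →
      s ≤ (s - 1) * q → (s - 1) * q < 2 * s → ∫⁻ x, ‖w x‖ₑ ^ ((s - 1) * q) < ⊤ →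
      ∫⁻ x, ‖w x‖ₑ ^ (2 * s)
        ≤ C * ENNReal.ofReal s ^ 2 * (∫⁻ x, ‖w x‖ₑ ^ ((s - 1) * q)) ^ (2 / q)
          * (∫⁻ x, ‖fderiv ℝ w x‖ₑ ^ p) ^ (2 / p) := by
  obtain ⟨C, hC⟩ := exists_lintegral_rpow_le
  refine ⟨C, fun w s p q hw hs hpq h1 h2 hfin => (hC w s _ hw hs h1 h2 hfin).trans ?_⟩
  have hwm : Measurable w := hw.continuous.measurable
  have hdm : Measurable fun x => ‖fderiv ℝ w x‖ₑ :=
    (hw.continuous_fderiv one_ne_zero).measurable.enorm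
  have h3 := ENNReal.lintegral_mul_le_Lp_mul_Lq (volume : Measure Plane) hpq.symm
    (f := fun x => ‖w x‖ₑ ^ (s - 1)) (g := fun x => ‖fderiv ℝ w x‖ₑ)
    (hwm.enorm.pow_const _).aemeasurable hdm.aemeasurable
  simp only [Pi.mul_apply, ← ENNReal.rpow_mul] at h3
  calc _ ≤ C * (ENNReal.ofReal s * ((∫⁻ x, ‖w x‖ₑ ^ ((s - 1) * q)) ^ (1 / q)
          * (∫⁻ x, ‖fderiv ℝ w x‖ₑ ^ p) ^ (1 / p))) ^ 2 := by gcongr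
    _ = _ := by
      rw [mul_pow, mul_pow, ← ENNReal.rpow_natCast (_ ^ (1 / q)), ← ENNReal.rpow_natCast (_ ^ (1 / p)),
        ← ENNReal.rpow_mul, ← ENNReal.rpow_mul]
      simp only [Nat.cast_ofNat, one_div_mul_eq_div]
      ring

lemma lintegral_rpow_interpolate {w : Plane → ℝ} (hw : Measurable w) {a b θ : ℝ} (h0 : 0 ≤ θ)
    (h1 : θ ≤ 1) (ha : 0 ≤ a) (hb : 0 ≤ b) :
    ∫⁻ x, ‖w x‖ₑ ^ (a * (1 - θ) + b * θ)
      ≤ (∫⁻ x, ‖w x‖ₑ ^ a) ^ (1 - θ) * (∫⁻ x, ‖w x‖ₑ ^ b) ^ θ := by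
  have h := ENNReal.lintegral_mul_norm_pow_le (μ := (volume : Measure Plane))
    (f := fun x => ‖w x‖ₑ ^ a) (g := fun x => ‖w x‖ₑ ^ b)
    (hw.enorm.pow_const a).aemeasurable (hw.enorm.pow_const b).aemeasurable
    (p := 1 - θ) (q := θ) (by linarith) h0 (by ring)
  refine le_trans (le_of_eq (lintegral_congr fun x => ?_)) h
  rw [← ENNReal.rpow_mul, ← ENNReal.rpow_mul, ENNReal.rpow_add_of_nonneg _ _
    (mul_nonneg ha (by linarith)) (mul_nonneg hb h0)]

lemma InAllSobolev.memLp_fderiv {F : Type*} [NormedAddCommGroup F] [NormedSpace ℝ F]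
    {w : Plane → F} (h : InAllSobolev w) : MemLp (fderiv ℝ w) 2 volume := by
  refine (h.2 1).of_le (h.1.continuous_fderiv (by simp)).aestronglyMeasurable
    (Eventually.of_forall fun x => ?_)
  rw [norm_iteratedFDeriv_one]

lemma InAllSobolev.lintegral_rpow_lt_top {w : Plane → ℝ} (h : InAllSobolev w) {r : ℝ}
    (hr : 2 ≤ r) : ∫⁻ x, ‖w x‖ₑ ^ r < ⊤ := by
  obtain ⟨C, hC⟩ := exists_lintegral_rpow_le_mul
  have hw1 : ContDiff ℝ 1 w := h.1.of_le (by simp)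
  have hD : ∫⁻ x, ‖fderiv ℝ w x‖ₑ ^ (2 : ℝ) < ⊤ := by
    have := (eLpNorm_lt_top_iff_lintegral_rpow_enorm_lt_top two_ne_zero ENNReal.ofNat_ne_top).1
      h.memLp_fderiv.2
    simpa using this
  have h2 : ∫⁻ x, ‖w x‖ₑ ^ (2 : ℝ) < ⊤ := by
    have := (eLpNorm_lt_top_iff_lintegral_rpow_enorm_lt_top two_ne_zero ENNReal.ofNat_ne_top).1
      h.memLp.2
    simpa using this
  have even : ∀ m : ℕ, ∫⁻ x, ‖w x‖ₑ ^ (2 * ((m : ℝ) + 1)) < ⊤ := by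
    intro m
    induction m with
    | zero => simpa using h2
    | succ m ih =>
      have hm : (0 : ℝ) ≤ m := m.cast_nonneg
      have e : ((m : ℝ) + 2 - 1) * 2 = 2 * ((m : ℝ) + 1) := by ring
      have := hC w ((m : ℝ) + 2) 2 2 hw1 (by linarith) Real.HolderConjugate.two_two (by linarith)
        (by linarith) (by rw [e]; exact ih)
      have e2 : 2 * (((m + 1 : ℕ) : ℝ) + 1) = 2 * ((m : ℝ) + 2) := by push_cast; ring
      rw [e2]
      refine this.trans_lt ?_
      rw [e]
      simp only [div_self (two_ne_zero' ℝ), ENNReal.rpow_one]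
      exact ENNReal.mul_lt_top (ENNReal.mul_lt_top (ENNReal.mul_lt_top ENNReal.coe_lt_top
        (ENNReal.pow_lt_top ENNReal.ofReal_lt_top)) ih) hD
  obtain ⟨m, hm⟩ := exists_nat_gt r
  have hwm : Measurable w := h.1.continuous.measurable
  refine lt_of_le_of_lt (lintegral_mono fun x => ?_) (b := ∫⁻ x, (‖w x‖ₑ ^ (2 : ℝ)
    + ‖w x‖ₑ ^ (2 * ((m : ℝ) + 1)))) ?_
  · rcases le_total ‖w x‖ₑ 1 with h1 | h1
    · exact (ENNReal.rpow_le_rpow_of_exponent_ge h1 hr).trans (le_add_of_nonneg_right zero_le)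
    · exact (ENNReal.rpow_le_rpow_of_exponent_le h1 (by linarith)).trans
        (le_add_of_nonneg_left zero_le)
  · rw [lintegral_add_left (hwm.enorm.pow_const _)]
    exact ENNReal.add_lt_top.2 ⟨h2, even m⟩

lemma InAllSobolev.memLp_ofReal {w : Plane → ℝ} (h : InAllSobolev w) {r : ℝ} (hr : 2 ≤ r) :
    MemLp w (ENNReal.ofReal r) volume := by
  have hr0 : 0 < r := by linarith
  refine ⟨h.1.continuous.aestronglyMeasurable, ?_⟩
  rw [eLpNorm_lt_top_iff_lintegral_rpow_enorm_lt_top (by simpa using hr0) ENNReal.ofReal_ne_top,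
    ENNReal.toReal_ofReal hr0.le]
  exact h.lintegral_rpow_lt_top hr

lemma exists_lintegral_gagliardoNirenberg {p : ℝ} (hp : 1 < p) :
    ∃ C : ℝ≥0, ∀ w : Plane → ℝ, InAllSobolev w →
      ∫⁻ x, ‖w x‖ₑ ^ (2 * p)
        ≤ C * (∫⁻ x, ‖w x‖ₑ ^ (2 : ℝ)) ^ (p / 2) * ∫⁻ x, ‖fderiv ℝ w x‖ₑ ^ p := by
  obtain ⟨C, hC⟩ := exists_lintegral_rpow_le_mul
  have hp0 : 0 < p := by linarith
  have hpq := Real.HolderConjugate.conjExponent hp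
  set q := p.conjExponent with hq
  have hq0 : 0 < q := hpq.symm.pos
  have hmul := hpq.mul_eq_add
  rcases le_total p 2 with h2 | h2
  · have hq2 : 2 ≤ q := by nlinarith
    set s := 1 + 2 / q with hs
    have hs1 : 1 < s := by rw [hs]; have : 0 < 2 / q := by positivity
                           linarith
    have e : (s - 1) * q = 2 := by rw [hs]; field_simp; ring
    refine ⟨(C * s.toNNReal ^ 2) ^ (p / 2), fun w hw => ?_⟩
    have hwm : Measurable w := hw.1.continuous.measurable
    have h1 := hC w s p q (hw.1.of_le (by simp)) hs1 hpq (by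
      rw [e, hs]; have : 2 / q ≤ 1 := (div_le_one hq0).2 hq2
      linarith) (by rw [e]; linarith) (by rw [e]; exact hw.lintegral_rpow_lt_top le_rfl)
    rw [e] at h1
    have h3 := lintegral_rpow_interpolate hwm (a := 2) (b := 2 * s) (θ := p / 2) (by positivity)
      (by linarith) (by norm_num) (by linarith)
    have e2 : 2 * (1 - p / 2) + 2 * s * (p / 2) = 2 * p := by
      have : p / q = p - 1 := by rw [div_eq_iff hq0.ne']; linarith
      have : s * p = p + 2 * (p / q) := by rw [hs]; ring
      nlinarith
    rw [e2] at h3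
    refine h3.trans ?_
    set X := ∫⁻ x, ‖w x‖ₑ ^ (2 : ℝ)
    set D := ∫⁻ x, ‖fderiv ℝ w x‖ₑ ^ p
    have e3 : 2 / q * (p / 2) = p - 1 := by field_simp; linarith
    have e4 : 2 / p * (p / 2) = 1 := by field_simp
    calc X ^ (1 - p / 2) * (∫⁻ x, ‖w x‖ₑ ^ (2 * s)) ^ (p / 2)
        ≤ X ^ (1 - p / 2) * (C * ENNReal.ofReal s ^ 2 * X ^ (2 / q) * D ^ (2 / p)) ^ (p / 2) := by
          gcongr
      _ = (C * ENNReal.ofReal s ^ 2) ^ (p / 2) * (X ^ (1 - p / 2) * X ^ (p - 1)) * D := by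
          rw [ENNReal.mul_rpow_of_nonneg _ _ (by positivity), ENNReal.mul_rpow_of_nonneg _ _
            (by positivity), ← ENNReal.rpow_mul, ← ENNReal.rpow_mul, e3, e4, ENNReal.rpow_one]
          ring
      _ = _ := by
          rw [← ENNReal.rpow_add_of_nonneg _ _ (by linarith) (by linarith),
            show 1 - p / 2 + (p - 1) = p / 2 by ring]
          congr 2
          rw [ENNReal.coe_rpow_of_nonneg _ (by positivity : 0 ≤ p / 2)]
          simp [ENNReal.ofReal]
  · have e : (p - 1) * q = p := hpq.sub_one_mul_conj
    refine ⟨(C * p.toNNReal ^ 2) ^ (p / 2), fun w hw => ?_⟩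
    have hwm : Measurable w := hw.1.continuous.measurable
    have h1 := hC w p p q (hw.1.of_le (by simp)) hp hpq (by rw [e]) (by rw [e]; linarith)
      (by rw [e]; exact hw.lintegral_rpow_lt_top h2)
    rw [e] at h1
    have hp1 : 0 < p - 1 := by linarith
    set θ := (p - 2) / (2 * (p - 1)) with hθ
    have hθ1 : 1 - θ = p / (2 * (p - 1)) := by rw [hθ]; field_simp; ring
    have h3 := lintegral_rpow_interpolate hwm (a := 2) (b := 2 * p) (θ := θ)
      (div_nonneg (by linarith) (by linarith)) ((div_le_one (by linarith)).2 (by linarith))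
      (by norm_num) (by linarith)
    have e2 : 2 * (1 - θ) + 2 * p * θ = p := by
      rw [hθ1, hθ]; field_simp; ring
    rw [e2, hθ1] at h3
    have hfin := hw.lintegral_rpow_lt_top (r := 2 * p) (by linarith)
    set X := ∫⁻ x, ‖w x‖ₑ ^ (2 : ℝ)
    set D := ∫⁻ x, ‖fderiv ℝ w x‖ₑ ^ p
    set Y := ∫⁻ x, ‖w x‖ₑ ^ (2 * p)
    have hqp : q = p / (p - 1) := by rw [eq_div_iff hp1.ne']; linarith
    have e3 : p / (2 * (p - 1)) * (2 / q) = 1 := by rw [hqp]; field_simp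
    have e4 : θ * (2 / q) = 1 - 2 / p := by rw [hqp, hθ]; field_simp
    have h4 : Y ≤ C * ENNReal.ofReal p ^ 2 * X * D ^ (2 / p) * Y ^ (1 - 2 / p) := by
      calc Y ≤ C * ENNReal.ofReal p ^ 2 * (X ^ (p / (2 * (p - 1))) * Y ^ θ) ^ (2 / q)
            * D ^ (2 / p) := h1.trans (by gcongr)
        _ = _ := by
          rw [ENNReal.mul_rpow_of_nonneg _ _ (by positivity), ← ENNReal.rpow_mul,
            ← ENNReal.rpow_mul, e3, e4, ENNReal.rpow_one]
          ring
    rcases eq_or_ne Y 0 with hY | hY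
    · rw [hY]; exact zero_le
    have h5 : Y ^ (2 / p) ≤ C * ENNReal.ofReal p ^ 2 * X * D ^ (2 / p) := by
      have hsplit : Y = Y ^ (2 / p) * Y ^ (1 - 2 / p) := by
        rw [← ENNReal.rpow_add _ _ hY hfin.ne]; simp
      have hne : Y ^ (1 - 2 / p) ≠ 0 := by
        simp [ENNReal.rpow_eq_zero_iff, hY, hfin.ne]
      have hnt : Y ^ (1 - 2 / p) ≠ ⊤ := by
        simp [ENNReal.rpow_eq_top_iff, hY, hfin.ne]
      have h6 : Y ^ (2 / p) * Y ^ (1 - 2 / p)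
          ≤ C * ENNReal.ofReal p ^ 2 * X * D ^ (2 / p) * Y ^ (1 - 2 / p) := by
        rw [← hsplit]; exact h4
      exact (ENNReal.mul_le_mul_iff_left hne hnt).1 h6
    have h7 := ENNReal.rpow_le_rpow h5 (by positivity : 0 ≤ p / 2)
    have e5 : 2 / p * (p / 2) = 1 := by field_simp
    rw [← ENNReal.rpow_mul, e5, ENNReal.rpow_one, ENNReal.mul_rpow_of_nonneg _ _ (by positivity),
      ENNReal.mul_rpow_of_nonneg _ _ (by positivity), ← ENNReal.rpow_mul, e5, ENNReal.rpow_one] at h7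
    refine h7.trans (le_of_eq ?_)
    congr 2
    rw [ENNReal.coe_rpow_of_nonneg _ (by positivity : 0 ≤ p / 2)]
    simp [ENNReal.ofReal]

/-- The Gagliardo–Nirenberg inequality
`‖w‖_{2p}² ≤ C ‖w‖₂ ‖∇w‖_p` in the plane. -/
theorem exists_gagliardoNirenberg {p : ℝ} (hp : 1 < p) :
    ∃ C : ℝ≥0, ∀ w : Plane → ℝ, InAllSobolev w →
      eLpNorm w (ENNReal.ofReal (2 * p)) volume ^ 2
        ≤ C * eLpNorm w 2 volume * eLpNorm (fderiv ℝ w) (ENNReal.ofReal p) volume := by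
  obtain ⟨C, hC⟩ := exists_lintegral_gagliardoNirenberg hp
  have hp0 : 0 < p := by linarith
  refine ⟨C ^ (1 / p), fun w hw => ?_⟩
  have h := hC w hw
  rw [← eLpNorm_ofReal_rpow (by positivity), ← eLpNorm_ofReal_rpow hp0,
    ← eLpNorm_ofReal_rpow two_pos, ENNReal.ofReal_ofNat] at h
  have h2 := ENNReal.rpow_le_rpow h (by positivity : 0 ≤ 1 / p)
  rw [ENNReal.mul_rpow_of_nonneg _ _ (by positivity), ENNReal.mul_rpow_of_nonneg _ _ (by positivity),
    ← ENNReal.rpow_mul, ← ENNReal.rpow_mul, ← ENNReal.rpow_mul, ← ENNReal.rpow_mul] at h2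
  rw [show 2 * p * (1 / p) = 2 by field_simp, show 2 * (p / 2 * (1 / p)) = 1 by field_simp,
    show p * (1 / p) = 1 by field_simp, ENNReal.rpow_one, ENNReal.rpow_one, ENNReal.rpow_ofNat] at h2
  rwa [ENNReal.coe_rpow_of_nonneg _ (by positivity : 0 ≤ 1 / p)]

end GagliardoNirenberg

noncomputable section Components

/-- The `j`-th component of a vector field on the plane. -/
def coord (j : Fin 2) (w : Plane → Plane) (x : Plane) : ℝ := w x j

lemma coord_eq_comp (j : Fin 2) (w : Plane → Plane) :
    coord j w = (EuclideanSpace.proj j : Plane →L[ℝ] ℝ) ∘ w := rfl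

lemma contDiff_coord {w : Plane → Plane} (hw : ContDiff ℝ ∞ w) (j : Fin 2) :
    ContDiff ℝ ∞ (coord j w) := by
  rw [coord_eq_comp]
  exact (EuclideanSpace.proj j : Plane →L[ℝ] ℝ).contDiff.comp hw

lemma pd_coord {w : Plane → Plane} (hw : ContDiff ℝ ∞ w) (j : Fin 2) (e x : Plane) :
    pd e (coord j w) x = fderiv ℝ w x e j := by
  have hd : DifferentiableAt ℝ w x := (hw.differentiable (by simp)).differentiableAt
  rw [pd, coord_eq_comp, ((EuclideanSpace.proj j : Plane →L[ℝ] ℝ).hasFDerivAt.comp x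
    hd.hasFDerivAt).fderiv]
  rfl

lemma pd_pd_coord {w : Plane → Plane} (hw : ContDiff ℝ ∞ w) (j : Fin 2) (e e' x : Plane) :
    pd e (pd e' (coord j w)) x = fderiv ℝ (fderiv ℝ w) x e e' j := by
  have hd : DifferentiableAt ℝ (fderiv ℝ w) x :=
    ((hw.fderiv_right (m := ∞) (by simp)).differentiable (by simp)).differentiableAt
  have h : pd e' (coord j w) = ((EuclideanSpace.proj j : Plane →L[ℝ] ℝ).comp
      (ContinuousLinearMap.apply ℝ Plane e')) ∘ fderiv ℝ w := by
    ext y; rw [pd_coord hw]; rfl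
  rw [pd, h, (ContinuousLinearMap.hasFDerivAt _).comp x hd.hasFDerivAt |>.fderiv]
  rfl

lemma coord_laplacian {w : Plane → Plane} (hw : ContDiff ℝ ∞ w) (j : Fin 2) :
    coord j (Δ w) = lap (coord j w) := by
  ext x
  rw [InnerProductSpace.laplacian_eq_iteratedFDeriv_orthonormalBasis w
    (EuclideanSpace.basisFun (Fin 2) ℝ)]
  simp only [coord, Fin.sum_univ_two, lap, Pi.add_apply, iteratedFDeriv_two_apply, PiLp.add_apply]
  rw [← pd_pd_coord hw, ← pd_pd_coord hw]
  simp [ee]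

lemma coord_gradient {π : Plane → ℝ} (j : Fin 2) :
    coord j (gradient π) = pd (ee j) π := by
  ext x
  have h := EuclideanSpace.inner_single_left j (1 : ℝ) (gradient π x)
  simp only [coord, pd, ee]
  rw [← inner_gradient_left, real_inner_comm, h]
  simp

lemma InAllSobolev.coord {w : Plane → Plane} (h : InAllSobolev w) (j : Fin 2) :
    InAllSobolev (coord j w) := by
  refine ⟨contDiff_coord h.1 j, fun k => ?_⟩
  refine (h.2 k).of_le_mul (c := ‖(EuclideanSpace.proj j : Plane →L[ℝ] ℝ)‖)
    ((contDiff_coord h.1 j).continuous_iteratedFDeriv (by exact_mod_cast le_top)).aestronglyMeasurable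
    (Filter.Eventually.of_forall fun x => ?_)
  rw [coord_eq_comp, ContinuousLinearMap.iteratedFDeriv_comp_left _ (h.1.contDiffAt)
    (by exact_mod_cast le_top)]
  exact ContinuousLinearMap.norm_compContinuousMultilinearMap_le _ _

lemma abs_coord_le (w : Plane → Plane) (j : Fin 2) (x : Plane) : ‖coord j w x‖ ≤ ‖w x‖ :=
  PiLp.norm_apply_le (w x) j

lemma Plane.norm_le_sum (y : Plane) : ‖y‖ ≤ ∑ j, ‖y j‖ := by
  conv_lhs => rw [← (EuclideanSpace.basisFun (Fin 2) ℝ).sum_repr y]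
  refine (norm_sum_le _ _).trans (Finset.sum_le_sum fun i _ => ?_)
  simp [norm_smul]

lemma Plane.opNorm_le_sum {F : Type*} [NormedAddCommGroup F] [NormedSpace ℝ F]
    (A : Plane →L[ℝ] F) : ‖A‖ ≤ ∑ j, ‖A (ee j)‖ := by
  refine A.opNorm_le_bound (by positivity) fun y => ?_
  conv_lhs => rw [← (EuclideanSpace.basisFun (Fin 2) ℝ).sum_repr y, map_sum]
  rw [Finset.sum_mul]
  refine (norm_sum_le _ _).trans (Finset.sum_le_sum fun i _ => ?_)
  simp only [map_smul, norm_smul, EuclideanSpace.basisFun_repr, EuclideanSpace.basisFun_apply]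
  rw [mul_comm]
  exact mul_le_mul_of_nonneg_left (PiLp.norm_apply_le y i) (norm_nonneg _)

lemma norm_iteratedFDeriv_two {F : Type*} [NormedAddCommGroup F] [NormedSpace ℝ F]
    (w : Plane → F) (x : Plane) :
    ‖iteratedFDeriv ℝ 2 w x‖ = ‖fderiv ℝ (fderiv ℝ w) x‖ := by
  rw [← norm_iteratedFDeriv_fderiv, norm_iteratedFDeriv_one]

lemma norm_iteratedFDeriv_two_le {w : Plane → Plane} (hw : ContDiff ℝ ∞ w) (x : Plane) :
    ‖iteratedFDeriv ℝ 2 w x‖ ≤ ∑ i, ∑ j, ∑ l, ‖pd (ee i) (pd (ee j) (coord l w)) x‖ := by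
  rw [norm_iteratedFDeriv_two]
  refine (Plane.opNorm_le_sum _).trans (Finset.sum_le_sum fun i _ => ?_)
  refine (Plane.opNorm_le_sum _).trans (Finset.sum_le_sum fun j _ => ?_)
  refine (Plane.norm_le_sum _).trans (Finset.sum_le_sum fun l _ => ?_)
  rw [pd_pd_coord hw]

lemma norm_fderiv_le_sum {w : Plane → Plane} (hw : ContDiff ℝ ∞ w) (x : Plane) :
    ‖fderiv ℝ w x‖ ≤ ∑ i, ∑ l, ‖pd (ee i) (coord l w) x‖ := by
  refine (Plane.opNorm_le_sum _).trans (Finset.sum_le_sum fun j _ => ?_)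
  refine (Plane.norm_le_sum _).trans (Finset.sum_le_sum fun l _ => ?_)
  rw [pd_coord hw]

lemma norm_ee (i : Fin 2) : ‖ee i‖ = 1 := by simp [ee]

lemma norm_pd_coord_le {w : Plane → Plane} (hw : ContDiff ℝ ∞ w) (i l : Fin 2) (x : Plane) :
    ‖pd (ee i) (coord l w) x‖ ≤ ‖fderiv ℝ w x‖ := by
  rw [pd_coord hw]
  refine (PiLp.norm_apply_le _ l).trans (((fderiv ℝ w x).le_opNorm _).trans ?_)
  rw [norm_ee, mul_one]

lemma norm_fderiv_pd_coord_le {w : Plane → Plane} (hw : ContDiff ℝ ∞ w) (i l : Fin 2) (x : Plane) :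
    ‖fderiv ℝ (pd (ee i) (coord l w)) x‖ ≤ ‖iteratedFDeriv ℝ 2 w x‖ := by
  rw [norm_iteratedFDeriv_two]
  refine ContinuousLinearMap.opNorm_le_bound _ (by positivity) fun y => ?_
  change ‖pd y (pd (ee i) (coord l w)) x‖ ≤ _
  rw [pd_pd_coord hw]
  refine (PiLp.norm_apply_le _ l).trans ((ContinuousLinearMap.le_opNorm₂ _ _ _).trans ?_)
  rw [norm_ee, mul_one]

lemma norm_laplacian_le (w : Plane → Plane) (x : Plane) :
    ‖(Δ w) x‖ ≤ 2 * ‖iteratedFDeriv ℝ 2 w x‖ := by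
  rw [InnerProductSpace.laplacian_eq_iteratedFDeriv_orthonormalBasis w
    (EuclideanSpace.basisFun (Fin 2) ℝ)]
  refine (norm_sum_le _ _).trans ?_
  rw [Fin.sum_univ_two, two_mul]
  refine add_le_add ?_ ?_ <;>
  · refine (ContinuousMultilinearMap.le_opNorm _ _).trans (le_of_eq ?_)
    simp [Fin.prod_univ_two]

lemma lap_coord_of_div_eq_zero {v : Plane → Plane} (hv : ContDiff ℝ ∞ v)
    (hdiv : ∀ x, planeDiv v x = 0) :
    lap (coord 0 v) = pd (ee 1) (pd (ee 1) (coord 0 v) - pd (ee 0) (coord 1 v)) ∧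
    lap (coord 1 v) = -pd (ee 0) (pd (ee 1) (coord 0 v) - pd (ee 0) (coord 1 v)) := by
  have h0 := contDiff_coord hv 0
  have h1 := contDiff_coord hv 1
  have hd : pd (ee 0) (coord 0 v) = -pd (ee 1) (coord 1 v) := by
    ext x
    have := hdiv x
    rw [planeDiv, Fin.sum_univ_two] at this
    rw [Pi.neg_apply, pd_coord hv, pd_coord hv]
    linarith
  constructor
  · rw [pd_sub (contDiff_pd h0 _) (contDiff_pd h1 _), lap, hd, pd_neg, pd_comm h1]
    abel
  · have hd' : pd (ee 1) (coord 1 v) = -pd (ee 0) (coord 0 v) := by rw [hd, neg_neg]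
    rw [pd_sub (contDiff_pd h0 _) (contDiff_pd h1 _), lap, hd', pd_neg, pd_comm h0]
    abel

end Components

section Estimates

open Filter Topology

lemma coord_gradient_sub_laplacian {v : Plane → Plane} (hv : ContDiff ℝ ∞ v) (π : Plane → ℝ)
    (j : Fin 2) :
    coord j (fun x => gradient π x - (Δ v) x) = pd (ee j) π - lap (coord j v) := by
  rw [← coord_laplacian hv, ← coord_gradient]
  rfl

lemma eLpNorm_coord_le (w : Plane → Plane) (j : Fin 2) (s : ℝ≥0∞) :
    eLpNorm (coord j w) s volume ≤ eLpNorm w s volume :=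
  eLpNorm_mono (abs_coord_le w j)

lemma eLpNorm_le_sum_of_norm_le {F ι : Type*} [NormedAddCommGroup F] [Fintype ι] {s : ℝ≥0∞}
    (hs : 1 ≤ s) {w : Plane → F} {g : ι → Plane → ℝ} (hg : ∀ i, Continuous (g i))
    (h : ∀ x, ‖w x‖ ≤ ∑ i, ‖g i x‖) :
    eLpNorm w s volume ≤ ∑ i, eLpNorm (g i) s volume := by
  calc eLpNorm w s volume ≤ eLpNorm (∑ i, fun x => ‖g i x‖) s volume := by
        refine eLpNorm_mono_real fun x => ?_
        simpa using h x
    _ ≤ ∑ i, eLpNorm (fun x => ‖g i x‖) s volume :=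
        eLpNorm_sum_le (fun i _ => (hg i).norm.aestronglyMeasurable) hs
    _ = _ := by simp only [eLpNorm_norm]

lemma eLpNorm_le_sum_coord {w : Plane → Plane} (hw : Continuous w) {s : ℝ≥0∞} (hs : 1 ≤ s) :
    eLpNorm w s volume ≤ ∑ j, eLpNorm (coord j w) s volume :=
  eLpNorm_le_sum_of_norm_le hs
    (fun j => (EuclideanSpace.proj j : Plane →L[ℝ] ℝ).continuous.comp hw)
    fun x => Plane.norm_le_sum (w x)

lemma one_le_ofReal {p : ℝ} (hp : 1 < p) : 1 ≤ ENNReal.ofReal p := by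
  simpa using hp.le

lemma eLpNorm_pressure_sub_lap_le {v : Plane → Plane} (hv : ContDiff ℝ ∞ v) (π : Plane → ℝ)
    (j : Fin 2) (s : ℝ≥0∞) : eLpNorm (pd (ee j) π - lap (coord j v)) s volume
      ≤ eLpNorm (fun x => gradient π x - (Δ v) x) s volume := by
  rw [← coord_gradient_sub_laplacian hv]
  exact eLpNorm_coord_le _ j _

lemma InAllSobolev.pd_of_gradient {π : Plane → ℝ} (h : InAllSobolev (gradient π)) (j : Fin 2) :
    InAllSobolev (_root_.pd (ee j) π) := by
  rw [← coord_gradient]; exact h.coord j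

lemma exists_eLpNorm_lap_coord_le {p : ℝ} (hp : 1 < p) :
    ∃ C : ℝ≥0, ∀ (v : Plane → Plane) (π : Plane → ℝ), InAllSobolev v →
      (∀ x, planeDiv v x = 0) → ContDiff ℝ ∞ π → InAllSobolev (gradient π) → ∀ j,
      eLpNorm (lap (coord j v)) (ENNReal.ofReal p) volume
      ≤ C * eLpNorm (fun x => gradient π x - (Δ v) x) (ENNReal.ofReal p) volume := by
  obtain ⟨B, hB⟩ := exists_eLpNorm_curl_le hp
  refine ⟨B * 2, fun v π hv hdiv hπ hgπ j => ?_⟩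
  have hω : ∀ i, eLpNorm (pd (ee i) (pd (ee 1) (coord 0 v) - pd (ee 0) (coord 1 v)))
      (ENNReal.ofReal p) volume
      ≤ (B * 2 : ℝ≥0) * eLpNorm (fun x => gradient π x - (Δ v) x) (ENNReal.ofReal p) volume := by
    intro i
    refine (hB _ _ π (hv.coord 0) (hv.coord 1) hπ (hgπ.pd_of_gradient 0)
      (hgπ.pd_of_gradient 1) i).trans ?_
    rw [ENNReal.coe_mul, mul_assoc, ENNReal.coe_ofNat, two_mul]
    exact mul_le_mul_right (add_le_add (eLpNorm_pressure_sub_lap_le hv.1 π 0 _)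
      (eLpNorm_pressure_sub_lap_le hv.1 π 1 _)) _
  obtain ⟨h0, h1⟩ := lap_coord_of_div_eq_zero hv.1 hdiv
  fin_cases j
  · exact (congrArg (fun g => eLpNorm g (ENNReal.ofReal p) volume) h0).trans_le (hω 1)
  · refine (congrArg (fun g => eLpNorm g (ENNReal.ofReal p) volume) h1).trans_le ?_
    simp only [eLpNorm_neg]
    exact hω 0

lemma eLpNorm_iteratedFDeriv_two_le_sum {w : Plane → Plane} (hw : ContDiff ℝ ∞ w) {s : ℝ≥0∞}
    (hs : 1 ≤ s) : eLpNorm (iteratedFDeriv ℝ 2 w) s volume ≤ ∑ i : Fin 2 × Fin 2 × Fin 2,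
      eLpNorm (pd (ee i.1) (pd (ee i.2.1) (coord i.2.2 w))) s volume := by
  refine eLpNorm_le_sum_of_norm_le (ι := Fin 2 × Fin 2 × Fin 2) hs
    (g := fun i => pd (ee i.1) (pd (ee i.2.1) (coord i.2.2 w)))
    (fun i => (contDiff_pd (contDiff_pd (contDiff_coord hw _) _) _).continuous) fun x => ?_
  simpa only [Fintype.sum_prod_type] using norm_iteratedFDeriv_two_le hw x

/-- The `Lᵖ` estimate for the stationary Stokes system. -/
theorem exists_eLpNorm_stokes_le {p : ℝ} (hp : 1 < p) :
    ∃ C : ℝ≥0, ∀ (v : Plane → Plane) (π : Plane → ℝ), InAllSobolev v →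
      (∀ x, planeDiv v x = 0) → ContDiff ℝ ∞ π → InAllSobolev (gradient π) →
      eLpNorm (iteratedFDeriv ℝ 2 v) (ENNReal.ofReal p) volume
        + eLpNorm (gradient π) (ENNReal.ofReal p) volume
      ≤ C * eLpNorm (fun x => gradient π x - (Δ v) x) (ENNReal.ofReal p) volume := by
  obtain ⟨A, hA⟩ := exists_eLpNorm_pd_pd_le hp
  obtain ⟨B, hB⟩ := exists_eLpNorm_lap_coord_le hp
  have hp1 := one_le_ofReal hp
  refine ⟨8 * (A * B) + 2 * (1 + B), fun v π hv hdiv hπ hgπ => ?_⟩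
  have hlap := hB v π hv hdiv hπ hgπ
  have hF := fun j => eLpNorm_pressure_sub_lap_le hv.1 π j (ENNReal.ofReal p)
  generalize eLpNorm (fun x => gradient π x - (Δ v) x) (ENNReal.ofReal p) volume = E at *
  have hD : eLpNorm (iteratedFDeriv ℝ 2 v) (ENNReal.ofReal p) volume ≤ 8 * (A * B) * E := by
    have h (i : Fin 2 × Fin 2 × Fin 2) : eLpNorm (pd (ee i.1) (pd (ee i.2.1) (coord i.2.2 v)))
        (ENNReal.ofReal p) volume ≤ A * (B * E) :=
      (hA _ (hv.coord i.2.2) i.1 i.2.1).trans (mul_le_mul_right (hlap i.2.2) _)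
    refine (eLpNorm_iteratedFDeriv_two_le_sum hv.1 hp1).trans
      ((Finset.sum_le_sum fun i _ => h i).trans (le_of_eq ?_))
    rw [Finset.sum_const, Finset.card_univ, show Fintype.card (Fin 2 × Fin 2 × Fin 2) = 8 from rfl,
      nsmul_eq_mul]
    push_cast
    ring
  have hG : eLpNorm (gradient π) (ENNReal.ofReal p) volume ≤ 2 * (1 + B) * E := by
    refine (eLpNorm_le_sum_coord hgπ.1.continuous hp1).trans ?_
    have h (j : Fin 2) : eLpNorm (coord j (gradient π)) (ENNReal.ofReal p) volume
        ≤ (1 + B) * E := by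
      rw [coord_gradient, ← sub_add_cancel (pd (ee j) π) (lap (coord j v)), add_mul, one_mul]
      exact (eLpNorm_add_le ((hgπ.pd_of_gradient j).1.continuous.sub
        (hv.coord j).lap.1.continuous).aestronglyMeasurable
        (hv.coord j).lap.1.continuous.aestronglyMeasurable hp1).trans (add_le_add (hF j) (hlap j))
    refine (Finset.sum_le_sum fun j _ => h j).trans (le_of_eq ?_)
    rw [Fin.sum_univ_two]; ring
  refine (add_le_add hD hG).trans (le_of_eq ?_)
  push_cast
  ring

lemma InAllSobolev.memLp_vector {w : Plane → Plane} (h : InAllSobolev w) {r : ℝ} (hr : 2 ≤ r) :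
    MemLp w (ENNReal.ofReal r) volume := by
  refine ⟨h.1.continuous.aestronglyMeasurable, ?_⟩
  refine (eLpNorm_le_sum_coord h.1.continuous (one_le_ofReal (by linarith))).trans_lt ?_
  exact ENNReal.sum_lt_top.2 fun j _ => ((h.coord j).memLp_ofReal hr).2

lemma eLpNorm_fderiv_le_sum {w : Plane → Plane} (hw : ContDiff ℝ ∞ w) {s : ℝ≥0∞} (hs : 1 ≤ s) :
    eLpNorm (fderiv ℝ w) s volume
      ≤ ∑ i : Fin 2 × Fin 2, eLpNorm (pd (ee i.1) (coord i.2 w)) s volume := by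
  refine eLpNorm_le_sum_of_norm_le (ι := Fin 2 × Fin 2) hs
    (g := fun i => pd (ee i.1) (coord i.2 w))
    (fun i => (contDiff_pd (contDiff_coord hw _) _).continuous) fun x => ?_
  simpa only [Fintype.sum_prod_type] using norm_fderiv_le_sum hw x

lemma InAllSobolev.memLp_fderiv_ofReal {w : Plane → Plane} (h : InAllSobolev w) {r : ℝ}
    (hr : 2 ≤ r) : MemLp (fderiv ℝ w) (ENNReal.ofReal r) volume := by
  refine ⟨(h.1.continuous_fderiv (by simp)).aestronglyMeasurable, ?_⟩
  refine (eLpNorm_fderiv_le_sum h.1 (one_le_ofReal (by linarith))).trans_lt ?_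
  exact ENNReal.sum_lt_top.2 fun j _ => (((h.coord _).pd _).memLp_ofReal hr).2

/-- The Gagliardo–Nirenberg inequality for the gradient of a vector field. -/
theorem exists_gagliardoNirenberg_fderiv {p : ℝ} (hp : 1 < p) :
    ∃ C : ℝ≥0, ∀ w : Plane → Plane, InAllSobolev w →
      eLpNorm (fderiv ℝ w) (ENNReal.ofReal (2 * p)) volume ^ 2
        ≤ C * eLpNorm (fderiv ℝ w) 2 volume
          * eLpNorm (iteratedFDeriv ℝ 2 w) (ENNReal.ofReal p) volume := by
  obtain ⟨C, hC⟩ := exists_gagliardoNirenberg hp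
  refine ⟨16 * C, fun w hw => ?_⟩
  set g := fun i : Fin 2 × Fin 2 => eLpNorm (pd (ee i.1) (coord i.2 w))
    (ENNReal.ofReal (2 * p)) volume
  set M := C * eLpNorm (fderiv ℝ w) 2 volume
    * eLpNorm (iteratedFDeriv ℝ 2 w) (ENNReal.ofReal p) volume with hM
  have hg : ∀ i, g i ^ 2 ≤ M := fun i => by
    refine (hC _ ((hw.coord i.2).pd (ee i.1))).trans ?_
    exact mul_le_mul' (mul_le_mul_right (eLpNorm_mono (norm_pd_coord_le hw.1 i.1 i.2)) _)
      (eLpNorm_mono (norm_fderiv_pd_coord_le hw.1 i.1 i.2))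
  obtain ⟨i, -, hi⟩ := Finset.exists_max_image Finset.univ g ⟨(0, 0), Finset.mem_univ _⟩
  have h1 : eLpNorm (fderiv ℝ w) (ENNReal.ofReal (2 * p)) volume ≤ 4 * g i := by
    refine (eLpNorm_fderiv_le_sum hw.1 (one_le_ofReal (by linarith))).trans ?_
    refine (Finset.sum_le_sum fun j hj => hi j hj).trans (le_of_eq ?_)
    simp only [Finset.sum_const, Finset.card_univ, Fintype.card_prod, Fintype.card_fin,
      nsmul_eq_mul]
    norm_num
  calc _ ≤ (4 * g i) ^ 2 := by gcongr
    _ = 16 * g i ^ 2 := by ring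
    _ ≤ 16 * M := by gcongr; exact hg i
    _ = _ := by rw [hM]; push_cast; ring

/-- The convective term in `Lᵖ`. -/
lemma eLpNorm_convection_le {p : ℝ} (hp : 1 < p) {u v : Plane → Plane} (hu : InAllSobolev u)
    (hv : InAllSobolev v) :
    eLpNorm (fun x => fderiv ℝ v x (u x)) (ENNReal.ofReal p) volume
      ≤ eLpNorm (u) (ENNReal.ofReal (2 * p)) volume
        * eLpNorm (fderiv ℝ v) (ENNReal.ofReal (2 * p)) volume := by
  have : ENNReal.HolderTriple (ENNReal.ofReal (2 * p)) (ENNReal.ofReal (2 * p))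
      (ENNReal.ofReal p) := ⟨by
    rw [← ENNReal.ofReal_inv_of_pos (by linarith), ← ENNReal.ofReal_inv_of_pos (by linarith),
      ← ENNReal.ofReal_add (by positivity) (by positivity)]
    congr 1
    field_simp
    norm_num⟩
  have h := eLpNorm_le_eLpNorm_mul_eLpNorm_of_nnnorm (p := ENNReal.ofReal (2 * p))
    (q := ENNReal.ofReal (2 * p)) (r := ENNReal.ofReal p) (μ := volume)
    (f := u) (g := fderiv ℝ v)
    hu.1.continuous.aestronglyMeasurable
    (hv.1.continuous_fderiv (by simp)).aestronglyMeasurable (fun y A => A y) 1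
    (Eventually.of_forall fun x => by
      rw [one_mul, mul_comm]; exact (fderiv ℝ v x).le_opNNNorm (u x))
  simpa using h

lemma real_le_of_absorb (X A U G D C K : ℝ) (hX : 0 ≤ X) (hK : 0 ≤ K) (hD : 0 ≤ D)
    (h : X ≤ C * (A + 2 * (U * G))) (h' : G ^ 2 ≤ K * D * X) :
    X ≤ 2 * C * A + 4 * C ^ 2 * K * (U ^ 2 * D) := by
  have hM : 0 ≤ 4 * C ^ 2 * K * (U ^ 2 * D) := by positivity
  have h1 : (2 * (C * U * G)) ^ 2 ≤ (4 * C ^ 2 * K * (U ^ 2 * D)) * X := by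
    calc (2 * (C * U * G)) ^ 2 = 4 * (C * U) ^ 2 * G ^ 2 := by ring
      _ ≤ 4 * (C * U) ^ 2 * (K * D * X) := by gcongr
      _ = _ := by ring
  have h2 : 2 * (C * U * G) ≤ (4 * C ^ 2 * K * (U ^ 2 * D) + X) / 2 := by
    refine abs_le_of_sq_le_sq' ?_ (by positivity) |>.2
    nlinarith [sq_nonneg (4 * C ^ 2 * K * (U ^ 2 * D) - X)]
  nlinarith

/-- Absorption of a quadratic cross term. -/
lemma le_of_absorb {X A U G D C K : ℝ≥0∞} (hX : X ≠ ⊤) (hA : A ≠ ⊤) (hU : U ≠ ⊤) (hG : G ≠ ⊤)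
    (hD : D ≠ ⊤) (hC : C ≠ ⊤) (hK : K ≠ ⊤) (h : X ≤ C * (A + 2 * (U * G)))
    (h' : G ^ 2 ≤ K * D * X) : X ≤ 2 * C * A + 4 * C ^ 2 * K * (U ^ 2 * D) := by
  lift X to ℝ≥0 using hX
  lift A to ℝ≥0 using hA
  lift U to ℝ≥0 using hU
  lift G to ℝ≥0 using hG
  lift D to ℝ≥0 using hD
  lift C to ℝ≥0 using hC
  lift K to ℝ≥0 using hK
  norm_cast at h h' ⊢
  rw [← NNReal.coe_le_coe] at h h' ⊢
  push_cast at h h' ⊢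
  exact real_le_of_absorb X A U G D C K X.2 K.2 D.2 h h'

end Estimates

section Linearized

open Filter Topology

lemma timeDerivN_zero {F : Type*} [NormedAddCommGroup F] [NormedSpace ℝ F] (g : ℝ → Plane → F)
    (t : ℝ) : timeDerivN 0 g t = g t := by
  ext x; simp [timeDerivN]

lemma timeDerivN_one {F : Type*} [NormedAddCommGroup F] [NormedSpace ℝ F] (g : ℝ → Plane → F)
    (t : ℝ) : timeDerivN 1 g t = timeDeriv g t := by
  ext x; rw [timeDerivN, timeDeriv, iteratedDerivWithin_one]

lemma SmoothSobolev.slice {F : Type*} [NormedAddCommGroup F] [NormedSpace ℝ F]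
    {g : ℝ → Plane → F} (h : SmoothSobolev g) {t : ℝ} (ht : 0 ≤ t) : InAllSobolev (g t) := by
  have := h.sobolev 0 t ht
  rwa [timeDerivN_zero] at this

lemma SmoothSobolev.timeDeriv {F : Type*} [NormedAddCommGroup F] [NormedSpace ℝ F]
    {g : ℝ → Plane → F} (h : SmoothSobolev g) {t : ℝ} (ht : 0 ≤ t) :
    InAllSobolev (timeDeriv g t) := by
  have := h.sobolev 1 t ht
  rwa [timeDerivN_one] at this

lemma SmoothSpaceTime.continuous_slice {F : Type*} [NormedAddCommGroup F] [NormedSpace ℝ F]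
    {g : ℝ → Plane → F} (h : SmoothSpaceTime g) {t : ℝ} (ht : 0 ≤ t) : Continuous (g t) :=
  h.continuousOn.comp_continuous (f := fun x : Plane => (t, x)) (by fun_prop)
    fun x => ⟨ht, mem_univ x⟩

lemma eLpNorm_smul_le_two {s : ℝ≥0∞} {r : Plane → ℝ} (hr : ∀ x, |r x| ≤ 2) (w : Plane → Plane) :
    eLpNorm (fun x => r x • w x) s volume ≤ 2 * eLpNorm w s volume := by
  have h := eLpNorm_le_nnreal_smul_eLpNorm_of_ae_le_mul (μ := volume) (f := fun x => r x • w x)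
    (g := w) (c := 2) (Eventually.of_forall fun x => by
      rw [nnnorm_smul]
      exact mul_le_mul_left (NNReal.coe_le_coe.1 (by simpa using hr x)) _) s
  simpa [ENNReal.smul_def] using h

lemma eLpNorm_force_sub_le {p : ℝ} (hp : 1 < p) {r : Plane → ℝ} (hrc : Continuous r)
    (hr : ∀ x, r x ∈ Icc (1 / 2 : ℝ) 2) {f m u v : Plane → Plane} (hf : Continuous f)
    (hm : Continuous m) (hu : InAllSobolev u) (hv : InAllSobolev v) :
    eLpNorm (fun x => f x - r x • m x - r x • fderiv ℝ v x (u x)) (ENNReal.ofReal p) volume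
      ≤ eLpNorm f (ENNReal.ofReal p) volume
        + 2 * eLpNorm (fun x => √(r x) • m x) (ENNReal.ofReal p) volume
        + 2 * (eLpNorm u (ENNReal.ofReal (2 * p)) volume
          * eLpNorm (fderiv ℝ v) (ENNReal.ofReal (2 * p)) volume) := by
  have hp1 := one_le_ofReal hp
  have hc : Continuous fun x => fderiv ℝ v x (u x) :=
    (hv.1.continuous_fderiv (by simp)).clm_apply hu.1.continuous
  have h0 : ∀ x, 0 ≤ r x := fun x => le_trans (by norm_num) (hr x).1
  have h1 : eLpNorm (fun x => r x • m x) (ENNReal.ofReal p) volume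
      ≤ 2 * eLpNorm (fun x => √(r x) • m x) (ENNReal.ofReal p) volume := by
    have e : (fun x => r x • m x) = fun x => √(r x) • (√(r x) • m x) := by
      ext1 x; rw [smul_smul, Real.mul_self_sqrt (h0 x)]
    rw [e]
    refine eLpNorm_smul_le_two (fun x => ?_) _
    rw [abs_of_nonneg (Real.sqrt_nonneg _)]
    exact Real.sqrt_le_iff.2 ⟨by norm_num, (hr x).2.trans (by norm_num)⟩
  have h2 : eLpNorm (fun x => r x • fderiv ℝ v x (u x)) (ENNReal.ofReal p) volume
      ≤ 2 * (eLpNorm u (ENNReal.ofReal (2 * p)) volume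
          * eLpNorm (fderiv ℝ v) (ENNReal.ofReal (2 * p)) volume) :=
    (eLpNorm_smul_le_two (fun x => by rw [abs_of_nonneg (h0 x)]; exact (hr x).2) _).trans
      (mul_le_mul_right (eLpNorm_convection_le hp hu hv) _)
  refine (eLpNorm_sub_le (f := fun x => f x - r x • m x) (g := fun x => r x • fderiv ℝ v x (u x))
    (hf.sub (hrc.smul hm)).aestronglyMeasurable
    (hrc.smul hc).aestronglyMeasurable hp1).trans (add_le_add ?_ h2)
  exact (eLpNorm_sub_le (f := f) (g := fun x => r x • m x) hf.aestronglyMeasurable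
    (hrc.smul hm).aestronglyMeasurable hp1).trans (add_le_add le_rfl h1)

/-- The `Lᵖ` estimate of `∇²v` and of the pressure gradient. -/
theorem IsSolLINS2D.exists_eLpNorm_le {p : ℝ} (hp : 1 < p) : ∃ C : ℝ≥0,
    ∀ (ρ : ℝ → Plane → ℝ) (u : ℝ → Plane → Plane) (P : ℝ → Plane → ℝ)
      (v : ℝ → Plane → Plane) (Pv : ℝ → Plane → ℝ) (f : ℝ → Plane → Plane),
      IsSolLINS2D ρ u P v Pv f → ∀ t : ℝ, 0 ≤ t →
        eLpNorm (iteratedFDeriv ℝ 2 (v t)) (ENNReal.ofReal p) volume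
          + eLpNorm (gradient (Pv t)) (ENNReal.ofReal p) volume
        ≤ (C : ℝ≥0∞) *
          (eLpNorm (fun x => √(ρ t x) • timeDeriv v t x) (ENNReal.ofReal p) volume
            + eLpNorm (u t) (ENNReal.ofReal (2 * p)) volume ^ 2
                * eLpNorm (fderiv ℝ (v t)) 2 volume
            + eLpNorm (f t) (ENNReal.ofReal p) volume) := by
  obtain ⟨C, hC⟩ := exists_eLpNorm_stokes_le hp
  obtain ⟨K, hK⟩ := exists_gagliardoNirenberg_fderiv hp
  refine ⟨4 * C + 4 * C ^ 2 * K + 1, fun ρ u P v Pv f h t ht => ?_⟩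
  have hv := h.smooth_v.slice ht
  have hu := h.base.smooth_u.slice ht
  have hG := hK _ hv
  have hS := hC _ _ hv (h.div_v t ht) (h.smooth_Pv t ht) (h.smooth_gradPv.slice ht)
  have hF := eLpNorm_force_sub_le hp (h.base.smooth_rho.continuous_slice ht) (h.rho_mem t ht)
    (h.smooth_f.slice ht).1.continuous (h.smooth_v.timeDeriv ht).1.continuous hu hv
  have e : (fun x => gradient (Pv t) x - (Δ (v t)) x)
      = fun x => f t x - ρ t x • timeDeriv v t x - ρ t x • fderiv ℝ (v t) x (u t x) := by
    ext1 x
    rw [← h.momentum t ht x]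
    abel
  rw [e] at hS
  have hU := (hu.memLp_vector (r := 2 * p) (by linarith)).2.ne
  have hGf := (hv.memLp_fderiv_ofReal (r := 2 * p) (by linarith)).2.ne
  have hD := hv.memLp_fderiv.2.ne
  generalize eLpNorm (fun x => f t x - ρ t x • timeDeriv v t x - ρ t x • fderiv ℝ (v t) x (u t x))
    (ENNReal.ofReal p) volume = E at *
  generalize eLpNorm (iteratedFDeriv ℝ 2 (v t)) (ENNReal.ofReal p) volume = X₁ at *
  generalize eLpNorm (gradient (Pv t)) (ENNReal.ofReal p) volume = X₂ at *
  generalize eLpNorm (fun x => √(ρ t x) • timeDeriv v t x) (ENNReal.ofReal p) volume = a at *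
  generalize eLpNorm (u t) (ENNReal.ofReal (2 * p)) volume = U at *
  generalize eLpNorm (fderiv ℝ (v t)) (ENNReal.ofReal (2 * p)) volume = G at *
  generalize eLpNorm (fderiv ℝ (v t)) 2 volume = D at *
  generalize eLpNorm (f t) (ENNReal.ofReal p) volume = b at *
  by_cases hab : a + U ^ 2 * D + b = ⊤
  · rw [hab, ENNReal.mul_top (by positivity)]
    exact le_top
  obtain ⟨haD, hb⟩ := ENNReal.add_ne_top.1 hab
  have ha := (ENNReal.add_ne_top.1 haD).1
  have hA : b + 2 * a ≠ ⊤ := ENNReal.add_ne_top.2 ⟨hb, ENNReal.mul_ne_top (by simp) ha⟩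
  have hE : E ≠ ⊤ := ne_top_of_le_ne_top
    (ENNReal.add_ne_top.2 ⟨hA, ENNReal.mul_ne_top (by simp) (ENNReal.mul_ne_top hU hGf)⟩) hF
  have hX : X₁ + X₂ ≠ ⊤ := ne_top_of_le_ne_top (ENNReal.mul_ne_top (by simp) hE) hS
  have key := le_of_absorb hX hA hU hGf hD (C := C) (K := K) (by simp) (by simp)
    (hS.trans (mul_le_mul_right hF _)) (hG.trans (mul_le_mul_right le_self_add _))
  refine key.trans ?_
  push_cast
  calc 2 * (C : ℝ≥0∞) * (b + 2 * a) + 4 * C ^ 2 * K * (U ^ 2 * D)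
      ≤ 2 * (C : ℝ≥0∞) * (b + 2 * a) + 4 * C ^ 2 * K * (U ^ 2 * D) +
        (2 * C * b + 4 * C * (U ^ 2 * D) + 4 * C ^ 2 * K * (a + b) + (a + U ^ 2 * D + b)) :=
        le_self_add
    _ = _ := by ring

lemma exists_abs_integral_translate_le {f g : Plane → ℝ} (hf : MemLp f 2 volume)
    (hg : MemLp g 2 volume) {δ : ℝ} (hδ : 0 < δ) :
    ∃ R : ℝ, ∀ y : Plane, R < ‖y‖ → |∫ x, act (tau y) f x * g x| ≤ δ := by
  set a := (eLpNorm f 2 volume).toReal with ha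
  set b := (eLpNorm g 2 volume).toReal with hb
  have ha0 : 0 ≤ a := ENNReal.toReal_nonneg
  have hb0 : 0 ≤ b := ENNReal.toReal_nonneg
  obtain ⟨ε, hε, hε1, hεδ⟩ : ∃ ε : ℝ, 0 < ε ∧ ε ≤ 1 ∧ ε * (a + b + 1) ≤ δ := by
    refine ⟨min 1 (δ / (a + b + 1)), by positivity, min_le_left _ _, ?_⟩
    rw [← le_div_iff₀ (by positivity)]
    exact min_le_right _ _
  have hε' : ENNReal.ofReal ε ≠ 0 := by simpa using hε
  obtain ⟨f', hf's, hf'e, -, hf'⟩ := hf.exists_hasCompactSupport_eLpNorm_sub_le (by simp) hε'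
  obtain ⟨g', hg's, hg'e, -, hg'⟩ := hg.exists_hasCompactSupport_eLpNorm_sub_le (by simp) hε'
  obtain ⟨R₁, hR₁⟩ := hf's.isCompact.isBounded.subset_closedBall 0
  obtain ⟨R₂, hR₂⟩ := hg's.isCompact.isBounded.subset_closedBall 0
  refine ⟨R₁ + R₂, fun y hy => ?_⟩
  have hz : ∀ x, act (tau y) f' x * g' x = 0 := fun x => by
    rw [act_tau]
    by_contra hne
    have h1 : x + y ∈ Metric.closedBall 0 R₁ :=
      hR₁ (subset_tsupport _ (left_ne_zero_of_mul hne))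
    have h2 : x ∈ Metric.closedBall 0 R₂ := hR₂ (subset_tsupport _ (right_ne_zero_of_mul hne))
    rw [mem_closedBall_zero_iff] at h1 h2
    have := norm_sub_le (x + y) x
    rw [add_sub_cancel_left] at this
    linarith
  have hτ : ∀ {k : Plane → ℝ}, MemLp k 2 volume →
      eLpNorm (act (tau y) k) 2 volume = eLpNorm k 2 volume :=
    fun hk => eLpNorm_act_tau hk.1 y
  have hfd := hf.sub hf'
  have hgd := hg.sub hg'
  have hfd' : (eLpNorm (f - f') 2 volume).toReal ≤ ε := ENNReal.toReal_le_of_le_ofReal hε.le hf'e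
  have hgd' : (eLpNorm (g - g') 2 volume).toReal ≤ ε := ENNReal.toReal_le_of_le_ofReal hε.le hg'e
  have i1 := abs_integral_mul_le (memLp_act hfd (tau y)) hg
  have i2 := abs_integral_mul_le (memLp_act hf (tau y)) hgd
  have i3 := abs_integral_mul_le (memLp_act hfd (tau y)) hgd
  rw [hτ hfd] at i1 i3
  rw [hτ hf] at i2
  have e : ∫ x, act (tau y) f x * g x = (∫ x, act (tau y) (f - f') x * g x)
      + (∫ x, act (tau y) f x * (g - g') x) - ∫ x, act (tau y) (f - f') x * (g - g') x := by
    have j1 := integrable_mul_of_memLp_two (memLp_act hfd (tau y)) hg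
    have j2 := integrable_mul_of_memLp_two (memLp_act hf (tau y)) hgd
    have j3 := integrable_mul_of_memLp_two (memLp_act hfd (tau y)) hgd
    rw [← integral_add j1 j2, ← integral_sub (j1.fun_add j2) j3]
    refine integral_congr_ae (Eventually.of_forall fun x => ?_)
    have := hz x
    simp only [map_sub, Pi.sub_apply] at this ⊢
    linear_combination this
  rw [e]
  have n1 : (0 : ℝ) ≤ (eLpNorm (f - f') 2 volume).toReal := ENNReal.toReal_nonneg
  have n2 : (0 : ℝ) ≤ (eLpNorm (g - g') 2 volume).toReal := ENNReal.toReal_nonneg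
  have k1 := i1.trans (mul_le_mul_of_nonneg_right hfd' hb0)
  have k2 := i2.trans (mul_le_mul_of_nonneg_left hgd' ha0)
  have k3 := i3.trans (mul_le_mul hfd' hgd' n2 hε.le)
  have k4 : ε * ε ≤ ε := by nlinarith
  refine (abs_sub _ _).trans ((add_le_add_left (abs_add_le _ _) _).trans ?_)
  nlinarith

lemma integral_pd_mul_eq_neg {q m : Plane → ℝ} (hq : ContDiff ℝ ∞ q) (hm : ContDiff ℝ ∞ m)
    (e : Plane) (hq2 : MemLp q 2 volume) (hdq : MemLp (pd e q) 2 volume) (hm2 : MemLp m 2 volume)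
    (hdm : MemLp (pd e m) 2 volume) : ∫ x, pd e q x * m x = -∫ x, q x * pd e m x := by
  have h := integral_mul_fderiv_eq_neg_fderiv_mul_of_integrable (μ := volume) (f := q) (g := m)
    (v := e) (integrable_mul_of_memLp_two hdq hm2) (integrable_mul_of_memLp_two hq2 hdm)
    (integrable_mul_of_memLp_two hq2 hm2) (fun x _ => hq.differentiable (by simp) x)
    (fun x _ => hm.differentiable (by simp) x)
  simp only [pd]
  rw [h, neg_neg]

/-- A gradient in `L²` is orthogonal to the divergence-free fields. -/
lemma integral_gradient_mul_eq_zero {π m₀ m₁ : Plane → ℝ} (hπ : ContDiff ℝ ∞ π)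
    (hπ₀ : MemLp (pd (ee 0) π) 2 volume) (hπ₁ : MemLp (pd (ee 1) π) 2 volume)
    (h₀ : InAllSobolev m₀) (h₁ : InAllSobolev m₁)
    (hdiv : ∀ x, pd (ee 0) m₀ x + pd (ee 1) m₁ x = 0) :
    (∫ x, pd (ee 0) π x * m₀ x) + ∫ x, pd (ee 1) π x * m₁ x = 0 := by
  have key : ∀ c : ℝ, (∫ x, pd (ee 0) π x * m₀ x) + ∫ x, pd (ee 1) π x * m₁ x
      = (∫ x, act (tau (c • ee 0)) (pd (ee 0) π) x * m₀ x)
        + ∫ x, act (tau (c • ee 0)) (pd (ee 1) π) x * m₁ x := by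
    intro c
    set r := tau (c • ee 0) - 1 with hr
    have hq : ContDiff ℝ ∞ (act r π) := contDiff_act hπ r
    have hq2 : MemLp (act r π) 2 volume := memLp_act_sub_one hπ _ (by
      rw [pd_smul_left]; exact hπ₀.const_smul c)
    have i0 := integral_pd_mul_eq_neg hq h₀.1 (ee 0) hq2
      (by rw [pd_act hπ]; exact memLp_act hπ₀ r) h₀.memLp (h₀.pd _).memLp
    have i1 := integral_pd_mul_eq_neg hq h₁.1 (ee 1) hq2
      (by rw [pd_act hπ]; exact memLp_act hπ₁ r) h₁.memLp (h₁.pd _).memLp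
    have i2 : (∫ x, act r π x * pd (ee 0) m₀ x) + ∫ x, act r π x * pd (ee 1) m₁ x = 0 := by
      rw [← integral_add (integrable_mul_of_memLp_two hq2 (h₀.pd _).memLp)
        (integrable_mul_of_memLp_two hq2 (h₁.pd _).memLp)]
      refine (integral_congr_ae (Eventually.of_forall fun x => ?_)).trans (integral_zero _ _)
      simp only [← mul_add, hdiv x, mul_zero]
    have split : ∀ {k m : Plane → ℝ}, MemLp k 2 volume → MemLp m 2 volume →
        ∫ x, act r k x * m x = (∫ x, act (tau (c • ee 0)) k x * m x) - ∫ x, k x * m x := by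
      intro k m hk hm
      rw [← integral_sub (integrable_mul_of_memLp_two (memLp_act hk _) hm)
        (integrable_mul_of_memLp_two hk hm)]
      refine integral_congr_ae (Eventually.of_forall fun x => ?_)
      simp only [hr, act_sub, act_one, Pi.sub_apply, sub_mul]
    rw [pd_act hπ, split hπ₀ h₀.memLp] at i0
    rw [pd_act hπ, split hπ₁ h₁.memLp] at i1
    linarith
  refine abs_eq_zero.1 (le_antisymm (le_of_forall_pos_le_add fun δ hδ => ?_) (abs_nonneg _))
  obtain ⟨R, hR⟩ := exists_abs_integral_translate_le hπ₀ h₀.memLp (half_pos hδ)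
  obtain ⟨R', hR'⟩ := exists_abs_integral_translate_le hπ₁ h₁.memLp (half_pos hδ)
  have hn : ‖(|R| + |R'| + 1) • ee 0‖ = |R| + |R'| + 1 := by
    rw [norm_smul, norm_ee, mul_one, Real.norm_of_nonneg (by positivity)]
  rw [key (|R| + |R'| + 1), zero_add]
  refine (abs_add_le _ _).trans ?_
  have := hR ((|R| + |R'| + 1) • ee 0) (by
    rw [hn]; linarith [le_abs_self R, abs_nonneg R'])
  have := hR' ((|R| + |R'| + 1) • ee 0) (by
    rw [hn]; linarith [le_abs_self R', abs_nonneg R])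
  linarith

lemma planeDiv_timeDeriv {v : ℝ → Plane → Plane} (hv : SmoothSpaceTime v)
    (hdiv : ∀ t, 0 ≤ t → ∀ x, planeDiv (v t) x = 0) {t : ℝ} (ht : 0 ≤ t) (x : Plane) :
    planeDiv (timeDeriv v t) x = 0 := by
  set S : Set (ℝ × Plane) := Ici 0 ×ˢ univ with hS
  set G : ℝ × Plane → Plane := fun q => v q.1 q.2 with hG
  have hSu : UniqueDiffOn ℝ S := (uniqueDiffOn_Ici 0).prod uniqueDiffOn_univ
  have hmem : ∀ {s : ℝ}, 0 ≤ s → ∀ y : Plane, (s, y) ∈ S := fun hs y => ⟨hs, mem_univ y⟩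
  set L := fderivWithin ℝ G S with hL
  have hGd : ∀ q ∈ S, HasFDerivWithinAt G (L q) S q := fun q hq =>
    ((hv q hq).differentiableWithinAt (by simp)).hasFDerivWithinAt
  have hLs : ContDiffOn ℝ ∞ L S := hv.fderivWithin hSu (by simp)
  have hLd : ∀ q ∈ S, HasFDerivWithinAt L (fderivWithin ℝ L S q) S q := fun q hq =>
    ((hLs q hq).differentiableWithinAt (by simp)).hasFDerivWithinAt
  have space : ∀ {F : Type} [NormedAddCommGroup F] [NormedSpace ℝ F] {H : ℝ × Plane → F}
      {H' : ℝ × Plane →L[ℝ] F} {s : ℝ} {y : Plane}, 0 ≤ s → HasFDerivWithinAt H H' S (s, y) →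
      HasFDerivAt (fun z => H (s, z)) (H'.comp (ContinuousLinearMap.inr ℝ ℝ Plane)) y := by
    intro F _ _ H H' s y hs h
    exact h.comp_hasFDerivAt y (hasFDerivAt_prodMk_right s y)
      (Eventually.of_forall fun z => hmem hs z)
  have time : ∀ {F : Type} [NormedAddCommGroup F] [NormedSpace ℝ F] {H : ℝ × Plane → F}
      {H' : ℝ × Plane →L[ℝ] F} {s : ℝ} {y : Plane}, HasFDerivWithinAt H H' S (s, y) →
      HasDerivWithinAt (fun r => H (r, y)) (H' (1, 0)) (Ici 0) s := by
    intro F _ _ H H' s y h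
    have h2 := h.comp s (hasFDerivAt_prodMk_left s y).hasFDerivWithinAt
      (fun r hr => hmem hr y : MapsTo (fun r : ℝ => (r, y)) (Ici 0) S)
    simpa [Function.comp_def] using h2.hasDerivWithinAt
  have hvd : ∀ s, 0 ≤ s → ∀ y e, fderiv ℝ (v s) y e = L (s, y) (0, e) := fun s hs y e => by
    rw [(space hs (hGd _ (hmem hs y))).fderiv]; simp
  have htd : timeDeriv v t = fun y => L (t, y) (1, 0) := by
    ext1 y
    exact (time (hGd _ (hmem ht y))).derivWithin (uniqueDiffOn_Ici 0 t ht)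
  have hsymm : ∀ e : Plane, fderivWithin ℝ L S (t, x) (0, e) (1, 0)
      = fderivWithin ℝ L S (t, x) (1, 0) (0, e) := fun e => by
    have hcl : (t, x) ∈ closure (interior S) := by
      rw [hS, interior_prod_eq, closure_prod_eq, interior_Ici, closure_Ioi, interior_univ,
        closure_univ]
      exact hmem ht x
    exact ((hv _ (hmem ht x)).isSymmSndFDerivWithinAt
      (by simpa using two_le_infty) hSu hcl (hmem ht x)) _ _
  have hdt : ∀ e, fderiv ℝ (timeDeriv v t) x e = fderivWithin ℝ L S (t, x) (1, 0) (0, e) := by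
    intro e
    have h1 := (space ht (hLd _ (hmem ht x))).clm_apply (hasFDerivAt_const ((1 : ℝ), (0 : Plane)) x)
    rw [htd, h1.fderiv, ← hsymm]
    simp
  have h2 : HasDerivWithinAt (fun s => ∑ i : Fin 2, L (s, x) (0, EuclideanSpace.single i 1) i)
      (∑ i : Fin 2, fderivWithin ℝ L S (t, x) (1, 0) (0, EuclideanSpace.single i 1) i) (Ici 0) t := by
    refine HasDerivWithinAt.fun_sum fun i _ => ?_
    have h3 := (time (hLd _ (hmem ht x))).clm_apply
      (hasDerivWithinAt_const t (Ici 0) ((0 : ℝ), (EuclideanSpace.single i 1 : Plane)))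
    have h4 := (EuclideanSpace.proj i : Plane →L[ℝ] ℝ).hasFDerivAt.comp_hasDerivWithinAt t h3
    simpa [Function.comp_def] using h4
  have h5 : HasDerivWithinAt (fun s => ∑ i : Fin 2, L (s, x) (0, EuclideanSpace.single i 1) i)
      0 (Ici 0) t := by
    refine (hasDerivWithinAt_const t (Ici 0) (0 : ℝ)).congr (fun s hs => ?_) ?_
    · have := hdiv s hs x
      simpa only [planeDiv, hvd s hs] using this
    · have := hdiv t ht x
      simpa only [planeDiv, hvd t ht] using this
  rw [planeDiv]
  simp only [hdt]
  exact (uniqueDiffOn_Ici (0 : ℝ) t ht).eq_deriv _ h2 h5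

end Linearized

section Energy

open Filter Topology

lemma eLpNorm_two_sq_eq_ofReal {F : Type*} [NormedAddCommGroup F] {w : Plane → F}
    (hw : MemLp w 2 volume) :
    eLpNorm w 2 volume ^ 2 = ENNReal.ofReal (∫ x, ‖w x‖ ^ 2) := by
  have h := eLpNorm_ofReal_rpow two_pos w
  rw [ENNReal.ofReal_ofNat, ENNReal.rpow_ofNat] at h
  rw [h, ofReal_integral_eq_lintegral_ofReal ((memLp_two_iff_integrable_sq_norm hw.1).1 hw)
    (Eventually.of_forall fun x => by positivity)]
  refine lintegral_congr fun x => ?_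
  rw [ENNReal.rpow_ofNat, ENNReal.ofReal_pow (norm_nonneg _), ofReal_norm]

lemma MeasureTheory.MemLp.smul_bounded {r : Plane → ℝ} (hrc : Continuous r) (hr : ∀ x, |r x| ≤ 2)
    {w : Plane → Plane} {s : ℝ≥0∞} (hw : MemLp w s volume) :
    MemLp (fun x => r x • w x) s volume :=
  ⟨hrc.aestronglyMeasurable.smul hw.1,
    (eLpNorm_smul_le_two hr w).trans_lt (ENNReal.mul_lt_top (by simp) hw.2)⟩

/-- The energy argument: the part of `g` orthogonal to gradients controls `√r m`. -/
lemma eLpNorm_sqrt_smul_sq_le {r : Plane → ℝ} (hrc : Continuous r)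
    (hr : ∀ x, r x ∈ Icc (1 / 2 : ℝ) 2) {m g q : Plane → Plane} (hm : MemLp m 2 volume)
    (hg : MemLp g 2 volume) (hqi : Integrable (fun x => inner ℝ (q x) (m x)) volume)
    (hq : ∫ x, inner ℝ (q x) (m x) = 0) (h : ∀ x, r x • m x + q x = g x) :
    eLpNorm (fun x => √(r x) • m x) 2 volume ^ 2 ≤ 2 * eLpNorm g 2 volume ^ 2 := by
  have h0 : ∀ x, 0 ≤ r x := fun x => le_trans (by norm_num) (hr x).1
  have ha : MemLp (fun x => √(r x) • m x) 2 volume := hm.smul_bounded hrc.sqrt fun x => by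
    rw [abs_of_nonneg (Real.sqrt_nonneg _)]
    exact Real.sqrt_le_iff.2 ⟨by norm_num, (hr x).2.trans (by norm_num)⟩
  have hai := (memLp_two_iff_integrable_sq_norm ha.1).1 ha
  have hgi := (memLp_two_iff_integrable_sq_norm hg.1).1 hg
  have hpt : ∀ x, 1 / 2 * ‖√(r x) • m x‖ ^ 2 ≤ ‖g x‖ ^ 2 - inner ℝ (q x) (m x) := fun x => by
    have e1 : ‖√(r x) • m x‖ ^ 2 = r x * ‖m x‖ ^ 2 := by
      rw [norm_smul, mul_pow, Real.norm_of_nonneg (Real.sqrt_nonneg _), Real.sq_sqrt (h0 x)]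
    have e2 : inner ℝ (g x) (m x) = r x * ‖m x‖ ^ 2 + inner ℝ (q x) (m x) := by
      rw [← h x, inner_add_left, real_inner_smul_left, real_inner_self_eq_norm_sq]
    have e3 := real_inner_le_norm (g x) (m x)
    have e4 : 1 / 2 * ‖m x‖ ^ 2 ≤ r x * ‖m x‖ ^ 2 :=
      mul_le_mul_of_nonneg_right (hr x).1 (by positivity)
    rw [e1]
    nlinarith [sq_nonneg (‖g x‖ - 1 / 2 * ‖m x‖)]
  have hmono := integral_mono (hai.const_mul (1 / 2)) (hgi.sub hqi) hpt
  rw [integral_const_mul, integral_sub' hgi hqi, hq, sub_zero] at hmono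
  rw [eLpNorm_two_sq_eq_ofReal ha, eLpNorm_two_sq_eq_ofReal hg,
    two_mul, ← ENNReal.ofReal_add (by positivity) (by positivity)]
  exact ENNReal.ofReal_le_ofReal (by linarith)

lemma le_of_young {a X F U G D K : ℝ≥0∞} (hX : X ≠ ⊤) (hF : F ≠ ⊤) (hU : U ≠ ⊤) (hG : G ≠ ⊤)
    (hD : D ≠ ⊤) (hK : K ≠ ⊤) (h : a ≤ 2 * (2 * X + F + 2 * (U * G)) ^ 2)
    (h' : G ^ 2 ≤ K * D * X) : a ≤ (24 + 24 * K) * (X ^ 2 + U ^ 4 * D ^ 2 + F ^ 2) := by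
  refine h.trans ?_
  lift X to ℝ≥0 using hX
  lift F to ℝ≥0 using hF
  lift U to ℝ≥0 using hU
  lift G to ℝ≥0 using hG
  lift D to ℝ≥0 using hD
  lift K to ℝ≥0 using hK
  norm_cast at h' ⊢
  rw [← NNReal.coe_le_coe] at h' ⊢
  push_cast at h' ⊢
  have hK : (0 : ℝ) ≤ K := K.2
  generalize (X : ℝ) = X, (F : ℝ) = F, (U : ℝ) = U, (G : ℝ) = G, (D : ℝ) = D, (K : ℝ) = K at *
  have h1 : U ^ 2 * G ^ 2 ≤ K * (U ^ 4 * D ^ 2 + X ^ 2) := by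
    calc U ^ 2 * G ^ 2 ≤ U ^ 2 * (K * D * X) := by gcongr
      _ = K * (U ^ 2 * D * X) := by ring
      _ ≤ _ := by
        refine mul_le_mul_of_nonneg_left ?_ hK
        nlinarith [sq_nonneg (U ^ 2 * D - X), sq_nonneg (U ^ 2 * D), sq_nonneg X]
  have h2 : (2 * X + F + 2 * (U * G)) ^ 2 ≤ 3 * (4 * X ^ 2 + F ^ 2 + 4 * (U ^ 2 * G ^ 2)) := by
    nlinarith [sq_nonneg (2 * X - F), sq_nonneg (2 * X - 2 * (U * G)), sq_nonneg (F - 2 * (U * G))]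
  have h3 : 0 ≤ U ^ 4 * D ^ 2 := by positivity
  have h4 : 0 ≤ K * F ^ 2 := by positivity
  nlinarith [sq_nonneg F, sq_nonneg X]

lemma eLpNorm_laplacian_le (w : Plane → Plane) (s : ℝ≥0∞) :
    eLpNorm (Δ w) s volume ≤ 2 * eLpNorm (iteratedFDeriv ℝ 2 w) s volume := by
  have h := eLpNorm_le_nnreal_smul_eLpNorm_of_ae_le_mul (μ := volume) (f := Δ w)
    (g := iteratedFDeriv ℝ 2 w) (c := 2) (Eventually.of_forall fun x =>
      NNReal.coe_le_coe.1 (by simpa using norm_laplacian_le w x)) s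
  simpa [ENNReal.smul_def] using h

lemma eLpNorm_add_sub_convection_le {r : Plane → ℝ} (hrc : Continuous r) (hr : ∀ x, |r x| ≤ 2)
    {l f u v : Plane → Plane} (hl : Continuous l) (hf : Continuous f) (hu : InAllSobolev u)
    (hv : InAllSobolev v) :
    eLpNorm (fun x => l x + f x - r x • fderiv ℝ v x (u x)) 2 volume
      ≤ eLpNorm l 2 volume + eLpNorm f 2 volume
        + 2 * (eLpNorm u 4 volume * eLpNorm (fderiv ℝ v) 4 volume) := by
  have hc : Continuous fun x => fderiv ℝ v x (u x) :=
    (hv.1.continuous_fderiv (by simp)).clm_apply hu.1.continuous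
  have hconv := eLpNorm_convection_le one_lt_two hu hv
  rw [show ENNReal.ofReal (2 * 2) = 4 by norm_num, ENNReal.ofReal_ofNat] at hconv
  refine (eLpNorm_sub_le (f := fun x => l x + f x) (g := fun x => r x • fderiv ℝ v x (u x))
    (hl.add hf).aestronglyMeasurable
    (hrc.smul hc).aestronglyMeasurable one_le_two).trans (add_le_add ?_ ?_)
  · exact eLpNorm_add_le hl.aestronglyMeasurable hf.aestronglyMeasurable one_le_two
  · exact (eLpNorm_smul_le_two hr _).trans (mul_le_mul_right hconv _)

/-- The pressure gradient is orthogonal to `∂ₜ v`. -/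
lemma IsSolLINS2D.integral_inner_gradient {ρ : ℝ → Plane → ℝ} {u : ℝ → Plane → Plane}
    {P : ℝ → Plane → ℝ} {v : ℝ → Plane → Plane} {Pv : ℝ → Plane → ℝ} {f : ℝ → Plane → Plane}
    (h : IsSolLINS2D ρ u P v Pv f) {t : ℝ} (ht : 0 ≤ t) :
    Integrable (fun x => inner ℝ (gradient (Pv t) x) (timeDeriv v t x)) volume ∧
      ∫ x, inner ℝ (gradient (Pv t) x) (timeDeriv v t x) = 0 := by
  have hm := h.smooth_v.timeDeriv ht
  have hP := h.smooth_gradPv.slice ht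
  have e : (fun x => inner ℝ (gradient (Pv t) x) (timeDeriv v t x))
      = fun x => pd (ee 0) (Pv t) x * coord 0 (timeDeriv v t) x
        + pd (ee 1) (Pv t) x * coord 1 (timeDeriv v t) x := by
    ext1 x
    rw [PiLp.inner_apply, Fin.sum_univ_two, ← coord_gradient, ← coord_gradient]
    simp [coord, mul_comm]
  have i0 := integrable_mul_of_memLp_two (hP.pd_of_gradient 0).memLp (hm.coord 0).memLp
  have i1 := integrable_mul_of_memLp_two (hP.pd_of_gradient 1).memLp (hm.coord 1).memLp
  rw [e]
  refine ⟨i0.add i1, ?_⟩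
  rw [integral_add i0 i1]
  refine integral_gradient_mul_eq_zero (h.smooth_Pv t ht) (hP.pd_of_gradient 0).memLp
    (hP.pd_of_gradient 1).memLp (hm.coord 0) (hm.coord 1) fun x => ?_
  have := planeDiv_timeDeriv h.smooth_v.smooth h.div_v ht x
  rw [planeDiv, Fin.sum_univ_two] at this
  rw [pd_coord hm.1, pd_coord hm.1, this]

lemma InAllSobolev.memLp_two_vector {w : Plane → Plane} (h : InAllSobolev w) :
    MemLp w 2 volume := by
  simpa using h.memLp_vector le_rfl

/-- The `L²` estimate of `√ρ ∂ₜ v`. -/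
theorem IsSolLINS2D.exists_eLpNorm_timeDeriv_sq_le : ∃ C : ℝ≥0,
    ∀ (ρ : ℝ → Plane → ℝ) (u : ℝ → Plane → Plane) (P : ℝ → Plane → ℝ)
      (v : ℝ → Plane → Plane) (Pv : ℝ → Plane → ℝ) (f : ℝ → Plane → Plane),
      IsSolLINS2D ρ u P v Pv f → ∀ t : ℝ, 0 ≤ t →
        eLpNorm (fun x => √(ρ t x) • timeDeriv v t x) 2 volume ^ 2
        ≤ (C : ℝ≥0∞) *
          (eLpNorm (iteratedFDeriv ℝ 2 (v t)) 2 volume ^ 2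
            + eLpNorm (u t) 4 volume ^ 4 * eLpNorm (fderiv ℝ (v t)) 2 volume ^ 2
            + eLpNorm (f t) 2 volume ^ 2) := by
  obtain ⟨K, hK⟩ := exists_gagliardoNirenberg_fderiv one_lt_two
  have h4 : ENNReal.ofReal (2 * 2) = 4 := by norm_num
  refine ⟨24 + 24 * K, fun ρ u P v Pv f h t ht => ?_⟩
  have hv := h.smooth_v.slice ht
  have hu := h.base.smooth_u.slice ht
  have hf := h.smooth_f.slice ht
  have hm := h.smooth_v.timeDeriv ht
  have hP := h.smooth_gradPv.slice ht
  have hρc := h.base.smooth_rho.continuous_slice ht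
  have hρ2 : ∀ x, |ρ t x| ≤ 2 := fun x => by
    rw [abs_of_nonneg (le_trans (by norm_num) (h.rho_mem t ht x).1)]
    exact (h.rho_mem t ht x).2
  have hcc : Continuous fun x => fderiv ℝ (v t) x (u t x) :=
    (hv.1.continuous_fderiv (by simp)).clm_apply hu.1.continuous
  set g : Plane → Plane := fun x => ρ t x • timeDeriv v t x + gradient (Pv t) x with hgdef
  have hg : MemLp g 2 volume :=
    (hm.memLp_two_vector.smul_bounded hρc hρ2).add hP.memLp_two_vector
  obtain ⟨hi, hi0⟩ := h.integral_inner_gradient ht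
  have henergy := eLpNorm_sqrt_smul_sq_le hρc (h.rho_mem t ht) hm.memLp_two_vector hg hi hi0
    fun x => rfl
  have hlapc : Continuous (Δ (v t)) := by
    have e : Δ (v t) = fun x => g x + ρ t x • fderiv ℝ (v t) x (u t x) - f t x := by
      ext1 x
      rw [← h.momentum t ht x]
      simp only [hgdef]
      abel
    rw [e]
    exact ((((hρc.smul hm.1.continuous).add hP.1.continuous).add (hρc.smul hcc)).sub
      hf.1.continuous)
  have e : g = fun x => (Δ (v t)) x + f t x - ρ t x • fderiv ℝ (v t) x (u t x) := by
    ext1 x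
    rw [← h.momentum t ht x]
    simp only [hgdef]
    abel
  have hG := hK _ hv
  have hGf := (hv.memLp_fderiv_ofReal (r := 2 * 2) (by norm_num)).2.ne
  have hUf := (hu.memLp_vector (r := 2 * 2) (by norm_num)).2.ne
  rw [h4, ENNReal.ofReal_ofNat] at hG
  rw [h4] at hGf hUf
  have hgle := (eLpNorm_add_sub_convection_le hρc hρ2 hlapc hf.1.continuous hu hv).trans
    (add_le_add (add_le_add (eLpNorm_laplacian_le (v t) 2) le_rfl) le_rfl)
  rw [← e] at hgle
  have := le_of_young (hv.2 2).2.ne hf.memLp_two_vector.2.ne hUf hGf hv.memLp_fderiv.2.ne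
    (K := K) (by simp) (henergy.trans (mul_le_mul_right (pow_le_pow_left' hgle 2) _)) hG
  simpa using this

end Energy


theorem stmt_3 :
    (∀ p : ℝ, 1 < p → ∃ C : ℝ≥0,
      ∀ (ρ : ℝ → Plane → ℝ) (u : ℝ → Plane → Plane) (P : ℝ → Plane → ℝ)
        (v : ℝ → Plane → Plane) (Pv : ℝ → Plane → ℝ) (f : ℝ → Plane → Plane),
        IsSolLINS2D ρ u P v Pv f → ∀ t : ℝ, 0 ≤ t →
          eLpNorm (iteratedFDeriv ℝ 2 (v t)) (ENNReal.ofReal p) volume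
            + eLpNorm (gradient (Pv t)) (ENNReal.ofReal p) volume
          ≤ (C : ℝ≥0∞) *
            (eLpNorm (fun x => √(ρ t x) • timeDeriv v t x) (ENNReal.ofReal p) volume
              + eLpNorm (u t) (ENNReal.ofReal (2 * p)) volume ^ 2
                  * eLpNorm (fderiv ℝ (v t)) 2 volume
              + eLpNorm (f t) (ENNReal.ofReal p) volume)) ∧
    (∃ C : ℝ≥0,
      ∀ (ρ : ℝ → Plane → ℝ) (u : ℝ → Plane → Plane) (P : ℝ → Plane → ℝ)
        (v : ℝ → Plane → Plane) (Pv : ℝ → Plane → ℝ) (f : ℝ → Plane → Plane),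
        IsSolLINS2D ρ u P v Pv f → ∀ t : ℝ, 0 ≤ t →
          eLpNorm (fun x => √(ρ t x) • timeDeriv v t x) 2 volume ^ 2
          ≤ (C : ℝ≥0∞) *
            (eLpNorm (iteratedFDeriv ℝ 2 (v t)) 2 volume ^ 2
              + eLpNorm (u t) 4 volume ^ 4 * eLpNorm (fderiv ℝ (v t)) 2 volume ^ 2
              + eLpNorm (f t) 2 volume ^ 2)) := by
  exact ⟨fun p hp => IsSolLINS2D.exists_eLpNorm_le hp, IsSolLINS2D.exists_eLpNorm_timeDeriv_sq_le⟩
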